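/- Let χ : ℝ² → [0,1] be smooth, equal to 1 on the closed ball of radius 1 centered at 0, and supported in the open ball of radius 2. For an integer n ≥ 1 let Γ_n(x) = χ(x)·‖x‖^{−(2n+1)} for x ≠ 0 (and Γ_n(0) = 0), and for Schwartz functions h, ρ : ℝ² → ℝ define K_n ρ(x) = ∇_x ∫_{ℝ²} ρ(y) (h(x) − h(y))^{2n} Γ_n(x − y) dy. Let k ≥ 0 be an integer, let p ∈ (1, ∞), q ∈ (1, ∞], and let r be defined by 1/r = 1/p + 1/q. Then there is a constant B = B(k, p, q, χ) such that for every integer n ≥ 1 and all Schwartz h, ρ: ‖K_n ρ‖_{W^{k,r}} ≤ B^n · ‖h‖_{W^{2,∞}}^{2n−1} · ‖h‖_{W^{k+3,q}} · ‖ρ‖_{W^{k,p}}. -/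

import Mathlib

open MeasureTheory
open scoped ENNReal

noncomputable section

/-- The Sobolev norm `‖u‖_{W^{m,s}} = Σ_{j=0}^{m} ‖∇ʲu‖_{L^s(ℝ²)}` (valued in `ℝ≥0∞`). -/
def sobNorm {F : Type*} [NormedAddCommGroup F] [NormedSpace ℝ F]
    (m : ℕ) (s : ℝ≥0∞) (u : EuclideanSpace ℝ (Fin 2) → F) : ℝ≥0∞ :=
  ∑ j ∈ Finset.range (m + 1), eLpNorm (iteratedFDeriv ℝ j u) s volume

theorem lintegral_rpow_le_measure_univ_mul {Z : Type*} [MeasurableSpace Z] {μ : Measure Z}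
    {p : ℝ} (hp : 1 < p) {F : Z → ℝ≥0∞} (hF : AEMeasurable F μ) :
    (∫⁻ z, F z ∂μ) ^ p ≤ μ Set.univ ^ (p - 1) * ∫⁻ z, F z ^ p ∂μ := by
  have hc := Real.HolderConjugate.conjExponent hp
  have h := ENNReal.lintegral_mul_le_Lp_mul_Lq μ hc hF (aemeasurable_const (b := 1))
  simp only [Pi.mul_apply, mul_one, ENNReal.one_rpow, lintegral_const, one_mul] at h
  have hp0 : 0 < p := by linarith
  calc (∫⁻ z, F z ∂μ) ^ p
      ≤ ((∫⁻ z, F z ^ p ∂μ) ^ (1 / p) * μ Set.univ ^ (1 / p.conjExponent)) ^ p := by gcongr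
    _ = μ Set.univ ^ (p - 1) * ∫⁻ z, F z ^ p ∂μ := by
      rw [ENNReal.mul_rpow_of_nonneg _ _ hp0.le, ← ENNReal.rpow_mul, ← ENNReal.rpow_mul, mul_comm]
      have h1 : 1 / p * p = 1 := by field_simp
      have h2 : 1 / p.conjExponent * p = p - 1 := by
        have : (p - 1) ≠ 0 := by linarith
        rw [Real.conjExponent]; field_simp
      rw [h1, h2, ENNReal.rpow_one]

theorem lintegral_rpow_lintegral_le {X Z : Type*} [MeasurableSpace Z] [MeasurableSpace X]
    {μ : Measure Z} {ν : Measure X} [SFinite μ] [SFinite ν]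
    {p : ℝ} (hp : 1 < p) {F : Z → X → ℝ≥0∞} (hF : Measurable (Function.uncurry F)) {A : ℝ≥0∞}
    (hA : ∀ z, ∫⁻ x, F z x ^ p ∂ν ≤ A) :
    ∫⁻ x, (∫⁻ z, F z x ∂μ) ^ p ∂ν ≤ μ Set.univ ^ p * A := by
  calc ∫⁻ x, (∫⁻ z, F z x ∂μ) ^ p ∂ν
      ≤ ∫⁻ x, μ Set.univ ^ (p - 1) * ∫⁻ z, F z x ^ p ∂μ ∂ν :=
        lintegral_mono fun x ↦ lintegral_rpow_le_measure_univ_mul hp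
          (hF.comp (measurable_id.prodMk measurable_const)).aemeasurable
    _ = μ Set.univ ^ (p - 1) * ∫⁻ x, ∫⁻ z, F z x ^ p ∂μ ∂ν := by
        refine lintegral_const_mul _ ?_
        exact Measurable.lintegral_prod_left' (f := fun q : Z × X ↦ F q.1 q.2 ^ p) (hF.pow_const p)
    _ = μ Set.univ ^ (p - 1) * ∫⁻ z, ∫⁻ x, F z x ^ p ∂ν ∂μ := by
        rw [lintegral_lintegral_swap]
        exact ((hF.comp measurable_swap).pow_const p).aemeasurable
    _ ≤ μ Set.univ ^ (p - 1) * (A * μ Set.univ) := by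
        gcongr
        exact (lintegral_mono hA).trans (by simp)
    _ = μ Set.univ ^ p * A := by
        rw [mul_comm A, ← mul_assoc]
        congr 1
        nth_rewrite 2 [← ENNReal.rpow_one (μ Set.univ)]
        rw [← ENNReal.rpow_add_of_nonneg _ _ (by linarith) zero_le_one]
        congr 1; ring

theorem lintegral_rpow_convolution_le {E : Type*} [AddCommGroup E] [MeasurableSpace E]
    [MeasurableAdd₂ E] [MeasurableNeg E] {μ : Measure E} [SFinite μ] [μ.IsAddLeftInvariant]
    {p : ℝ} (hp : 1 < p) {F w : E → ℝ≥0∞} (hF : Measurable F) (hw : Measurable w) :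
    ∫⁻ x, (∫⁻ z, F (x - z) * w z ∂μ) ^ p ∂μ ≤ (∫⁻ z, w z ∂μ) ^ p * ∫⁻ x, F x ^ p ∂μ := by
  have hF' : Measurable (Function.uncurry fun z x : E ↦ F (x - z)) :=
    hF.comp (measurable_snd.sub measurable_fst)
  have h := lintegral_rpow_lintegral_le (μ := μ.withDensity w) (ν := μ) hp hF'
    (A := ∫⁻ x, F x ^ p ∂μ) (fun z ↦ by
      simp only [sub_eq_add_neg]
      exact (lintegral_add_right_eq_self (fun x ↦ F x ^ p) (-z)).le)
  have e : ∀ x, ∫⁻ z, F (x - z) ∂(μ.withDensity w) = ∫⁻ z, F (x - z) * w z ∂μ := fun x ↦ by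
    rw [lintegral_withDensity_eq_lintegral_mul _ hw
      (show Measurable fun z ↦ F (x - z) by fun_prop)]
    simp [mul_comm]
  simpa [e, withDensity_apply _ MeasurableSet.univ] using h

theorem exists_rpow_abs_im_le {p : ℝ} (hp : 1 < p) (hp2 : p ≤ 2) :
    ∃ A B : ℝ, 0 ≤ A ∧ ∀ w : ℂ, 0 < w.re →
      |w.im| ^ p ≤ A * w.re ^ p - B * (w ^ (p : ℂ)).re := by
  have hpi := Real.pi_pos
  set φ := (Real.pi / 2 / p + Real.pi / 2) / 2 with hφ
  have h1 : Real.pi / 2 / p < Real.pi / 2 := div_lt_self (by positivity) hp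
  have h0 : 0 < Real.pi / 2 / p := by positivity
  have hφ2 : φ < Real.pi / 2 := by linarith
  have hφ0 : 0 < φ := by linarith
  have hpφ : Real.pi / 2 < p * φ := by
    have : p * (Real.pi / 2 / p) = Real.pi / 2 := by field_simp
    rw [hφ]; nlinarith
  have hpφ' : p * φ ≤ Real.pi := by nlinarith
  have hc : 0 < -Real.cos (p * φ) := by
    have := Real.cos_neg_of_pi_div_two_lt_of_lt hpφ (by linarith); linarith
  have hcφ : 0 < Real.cos φ := Real.cos_pos_of_mem_Ioo ⟨by linarith, hφ2⟩
  set c := -Real.cos (p * φ) with hcdef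
  have hB : 0 < 1 / c := by positivity
  have hcp : 0 < Real.cos φ ^ p := by positivity
  refine ⟨(1 + 1 / c) / Real.cos φ ^ p, 1 / c, by positivity, fun w hw ↦ ?_⟩
  have harg : |w.arg| < Real.pi / 2 := Complex.abs_arg_lt_pi_div_two_iff.2 (Or.inl hw)
  rw [Complex.cpow_ofReal_re]
  have him : |w.im| ^ p ≤ ‖w‖ ^ p := by
    gcongr; exact Complex.abs_im_le_norm w
  have hre : w.re = ‖w‖ * Real.cos |w.arg| := by rw [Real.cos_abs, Complex.norm_mul_cos_arg]
  have hcos : Real.cos (w.arg * p) = Real.cos (p * |w.arg|) := by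
    rw [← Real.cos_abs, abs_mul, abs_of_pos (by linarith : 0 < p), mul_comm]
  have hn : 0 ≤ ‖w‖ ^ p := by positivity
  rw [hcos]
  rcases le_total φ |w.arg| with h | h
  · have hle : Real.cos (p * |w.arg|) ≤ -c := by
      rw [hcdef, neg_neg]
      exact Real.cos_le_cos_of_nonneg_of_le_pi (by positivity) (by nlinarith) (by gcongr)
    have h2 : ‖w‖ ^ p ≤ -(1 / c * (‖w‖ ^ p * Real.cos (p * |w.arg|))) := by
      have : 1 / c * (‖w‖ ^ p * c) = ‖w‖ ^ p := by field_simp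
      nlinarith [mul_le_mul_of_nonneg_left hle (mul_nonneg hB.le hn)]
    have h3 : 0 ≤ (1 + 1 / c) / Real.cos φ ^ p * w.re ^ p := by positivity
    linarith
  · have h2 : ‖w‖ ^ p * Real.cos φ ^ p ≤ w.re ^ p := by
      rw [← Real.mul_rpow (norm_nonneg _) hcφ.le, hre]
      gcongr
      exact Real.cos_le_cos_of_nonneg_of_le_pi (abs_nonneg _) (by linarith) h
    have h3 : (1 + 1 / c) * ‖w‖ ^ p ≤ (1 + 1 / c) / Real.cos φ ^ p * w.re ^ p := by
      rw [div_mul_eq_mul_div, le_div_iff₀ hcp]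
      nlinarith
    have h4 := Real.cos_le_one (p * |w.arg|)
    have h5 : 1 / c * (‖w‖ ^ p * Real.cos (p * |w.arg|)) ≤ 1 / c * ‖w‖ ^ p := by
      gcongr; nlinarith
    linarith

/-- Bounded measurable functions supported in `[-R, R]`. -/
structure BddOnInterval (f : ℝ → ℝ) (M R : ℝ) : Prop where
  meas : Measurable f
  bound : ∀ s, |f s| ≤ M
  supp : ∀ s, R < |s| → f s = 0

theorem BddOnInterval.integrable_mul {f : ℝ → ℝ} {M R : ℝ} (hf : BddOnInterval f M R)
    {F : Type*} [NormedAddCommGroup F] [NormedSpace ℝ F] {g : ℝ → F} (hg : Continuous g) :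
    Integrable fun s ↦ f s • g s := by
  have h : IntegrableOn (fun s ↦ f s • g s) (Set.Icc (-R) R) := by
    refine hg.integrableOn_Icc.bdd_smul M hf.meas.aestronglyMeasurable ?_
    exact Filter.Eventually.of_forall hf.bound
  refine (integrableOn_iff_integrable_of_support_subset fun s hs ↦ ?_).1 h
  by_contra hR
  refine hs ?_
  simp only [Set.mem_Icc, ← abs_le, not_le] at hR
  simp [hf.supp s hR]

/-- The Cauchy-type transform whose real and imaginary parts are the Poisson and conjugate
Poisson integrals (up to normalisation). -/
def cauchyInt (f : ℝ → ℝ) (w : ℂ) : ℂ := ∫ s, f s • (Complex.I / (w - s))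

/-- The conjugate Poisson integral at height `y` (unnormalised). -/
def conjInt (y : ℝ) (f : ℝ → ℝ) (t : ℝ) : ℝ := ∫ s, f s * ((t - s) / ((t - s) ^ 2 + y ^ 2))

/-- The Poisson integral at height `y` (unnormalised). -/
def poisInt (y : ℝ) (f : ℝ → ℝ) (t : ℝ) : ℝ := ∫ s, f s * (y / ((t - s) ^ 2 + y ^ 2))

theorem sub_ofReal_ne_zero {w : ℂ} (hw : 0 < w.im) (s : ℝ) : w - s ≠ 0 := by
  intro h
  have := congrArg Complex.im h
  simp at this; linarith

theorem im_le_norm_sub_ofReal {w : ℂ} (s : ℝ) : w.im ≤ ‖w - s‖ := by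
  have := Complex.abs_im_le_norm (w - s)
  simp at this
  exact (le_abs_self _).trans this

theorem continuous_I_div {w : ℂ} (hw : 0 < w.im) :
    Continuous fun s : ℝ ↦ Complex.I / (w - s) :=
  continuous_const.div (by fun_prop) (sub_ofReal_ne_zero hw)

theorem I_div_eq {y : ℝ} (hy : 0 < y) (t s : ℝ) :
    Complex.I / ((t : ℂ) + y * Complex.I - s) =
      ((y / ((t - s) ^ 2 + y ^ 2) : ℝ) : ℂ) + ((t - s) / ((t - s) ^ 2 + y ^ 2) : ℝ) * Complex.I := by
  have h : (0:ℝ) < (t - s) ^ 2 + y ^ 2 := by positivity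
  have hne : (t : ℂ) + y * Complex.I - s ≠ 0 := sub_ofReal_ne_zero (by simpa using hy) s
  have h' : ((t:ℂ) - s) ^ 2 + y ^ 2 ≠ 0 := by
    have := Complex.ofReal_ne_zero.2 h.ne'; push_cast at this; exact this
  have e : ((y / ((t - s) ^ 2 + y ^ 2) : ℝ) : ℂ) + ((t - s) / ((t - s) ^ 2 + y ^ 2) : ℝ) * Complex.I
      = (y + (t - s) * Complex.I) / ((t - s) ^ 2 + y ^ 2) := by
    push_cast; ring
  rw [e, div_eq_div_iff hne h']
  linear_combination (-(t - s) * y : ℂ) * Complex.I_sq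

theorem BddOnInterval.cauchyInt_eq {f : ℝ → ℝ} {M R : ℝ} (hf : BddOnInterval f M R) {y : ℝ}
    (hy : 0 < y) (t : ℝ) :
    cauchyInt f (t + y * Complex.I) = (poisInt y f t : ℂ) + conjInt y f t * Complex.I := by
  have hd : ∀ s, (t - s) ^ 2 + y ^ 2 ≠ 0 := fun s ↦ by positivity
  have h1 : Integrable fun s ↦ f s • (y / ((t - s) ^ 2 + y ^ 2)) :=
    hf.integrable_mul (continuous_const.div (by fun_prop) hd)
  have h2 : Integrable fun s ↦ f s • ((t - s) / ((t - s) ^ 2 + y ^ 2)) :=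
    hf.integrable_mul (Continuous.div (by fun_prop) (by fun_prop) hd)
  simp only [smul_eq_mul] at h1 h2
  rw [poisInt, conjInt, ← integral_complex_ofReal, ← integral_complex_ofReal,
    ← integral_mul_const, ← integral_add h1.ofReal (h2.ofReal.mul_const _), cauchyInt]
  congr 1; ext s
  rw [I_div_eq hy, Complex.real_smul]
  push_cast; ring

theorem BddOnInterval.differentiableAt_cauchyInt {f : ℝ → ℝ} {M R : ℝ} (hf : BddOnInterval f M R)
    {w : ℂ} (hw : 0 < w.im) : DifferentiableAt ℂ (cauchyInt f) w := by
  have him : ∀ x ∈ Metric.ball w (w.im / 2), w.im / 2 ≤ x.im := fun x hx ↦ by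
    have h1 := (Complex.abs_im_le_norm (x - w)).trans (mem_ball_iff_norm.1 hx).le
    have := (abs_le.1 h1).1
    simp at this; linarith
  have h_int : Integrable fun s ↦ |f s| * (1 / (w.im / 2) ^ 2) := by
    have := (hf.integrable_mul (continuous_const (y := (1:ℝ)))).abs.mul_const (1 / (w.im / 2) ^ 2)
    simpa using this
  refine (hasDerivAt_integral_of_dominated_loc_of_deriv_le
    (F := fun (w : ℂ) (s : ℝ) ↦ f s • (Complex.I / (w - s)))
    (F' := fun (w : ℂ) (s : ℝ) ↦ f s • (-Complex.I / (w - s) ^ 2))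
    (Metric.ball_mem_nhds w (half_pos hw)) ?_ (hf.integrable_mul (continuous_I_div hw)) ?_ ?_
    h_int ?_).2.differentiableAt
  · filter_upwards [Metric.ball_mem_nhds w (half_pos hw)] with x hx
    exact (hf.integrable_mul (continuous_I_div (by linarith [him x hx]))).aestronglyMeasurable
  · refine (hf.integrable_mul ?_).aestronglyMeasurable
    exact continuous_const.div (by fun_prop) fun s ↦ pow_ne_zero _ (sub_ofReal_ne_zero hw s)
  · refine Filter.Eventually.of_forall fun s x hx ↦ ?_
    rw [norm_smul, Real.norm_eq_abs, norm_div, norm_neg, Complex.norm_I, norm_pow]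
    gcongr
    exact (him x hx).trans (im_le_norm_sub_ofReal s)
  · refine Filter.Eventually.of_forall fun s x hx ↦ ?_
    have hne := sub_ofReal_ne_zero (by linarith [him x hx] : 0 < x.im) s
    have h := ((hasDerivAt_const x Complex.I).div ((hasDerivAt_id x).sub_const (s:ℂ)) hne)
    have e : -Complex.I / (x - s) ^ 2
        = (0 * (id x - (s:ℂ)) - Complex.I * 1) / (id x - (s:ℂ)) ^ 2 := by simp
    rw [e]
    exact h.const_smul (f s)

theorem BddOnInterval.norm_mul_norm_cauchyInt_le {f : ℝ → ℝ} {M R : ℝ} (hf : BddOnInterval f M R)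
    {y : ℝ} (hy : 0 < y) (hR : 0 ≤ R) {w : ℂ} (hw : y ≤ w.im) :
    ‖w‖ * ‖cauchyInt f w‖ ≤ (1 + R / y) * ∫ s, |f s| := by
  rw [← Real.norm_of_nonneg (norm_nonneg w), ← norm_smul, cauchyInt, ← integral_smul,
    ← integral_const_mul]
  refine norm_integral_le_of_norm_le ?_ (Filter.Eventually.of_forall fun s ↦ ?_)
  · simpa using (hf.integrable_mul (continuous_const (y := (1:ℝ)))).abs.const_mul (1 + R / y)
  rw [norm_smul, norm_smul, norm_div, Complex.norm_I, norm_norm, Real.norm_eq_abs]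
  rcases le_or_gt |s| R with h | h
  · have h1 : 0 < ‖w - s‖ := hy.trans_le (hw.trans (im_le_norm_sub_ofReal s))
    have h2 : ‖w‖ ≤ ‖w - s‖ + R := by
      have := norm_add_le (w - s) s
      simp at this; linarith
    have h3 : ‖w‖ * (1 / ‖w - s‖) ≤ 1 + R / y := by
      have : R ≤ R / y * ‖w - s‖ := by
        rw [div_mul_eq_mul_div, le_div_iff₀ hy]
        exact mul_le_mul_of_nonneg_left (hw.trans (im_le_norm_sub_ofReal s)) hR
      rw [mul_one_div, div_le_iff₀ h1]; linarith
    calc _ = ‖w‖ * (1 / ‖w - s‖) * |f s| := by ring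
      _ ≤ _ := by gcongr
  · simp [hf.supp s h]

theorem integral_horizontal_eq_zero {G : ℂ → ℂ} {y C p : ℝ} (hy : 0 < y) (hp : 1 < p)
    (hG : ∀ w : ℂ, y ≤ w.im → DifferentiableAt ℂ G w)
    (hC : ∀ w : ℂ, y ≤ w.im → ‖G w‖ ≤ C * ‖w‖ ^ (-p)) :
    Integrable (fun x : ℝ ↦ G (x + y * Complex.I)) ∧ ∫ x : ℝ, G (x + y * Complex.I) = 0 := by
  have him : ∀ x t : ℝ, ((x : ℂ) + t * Complex.I).im = t := fun x t ↦ by simp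
  have hre : ∀ x t : ℝ, ((x : ℂ) + t * Complex.I).re = x := fun x t ↦ by simp
  have hC0 : 0 ≤ C := by
    have h := (norm_nonneg _).trans (hC ((0:ℝ) + y * Complex.I) (by rw [him]))
    refine nonneg_of_mul_nonneg_left h ?_
    have : (0:ℝ) < ‖((0:ℝ):ℂ) + y * Complex.I‖ := by simpa using hy.ne'
    positivity
  have hcont : Continuous fun x : ℝ ↦ G (x + y * Complex.I) := by
    refine continuous_iff_continuousAt.2 fun x ↦ ?_
    exact ContinuousAt.comp (g := G) (hG _ (by rw [him])).continuousAt
      (by fun_prop : Continuous fun x : ℝ ↦ (x : ℂ) + y * Complex.I).continuousAt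
  have h_int : Integrable fun x : ℝ ↦ G (x + y * Complex.I) := by
    have h1 : Integrable fun x : ℝ ↦ C * (min 1 y / 2) ^ (-p) * (1 + ‖x‖) ^ (-p) :=
      (integrable_one_add_norm (by simpa using hp)).const_mul _
    refine h1.mono' hcont.aestronglyMeasurable (Filter.Eventually.of_forall fun x ↦ ?_)
    refine (hC _ (by rw [him])).trans ?_
    rw [mul_assoc, ← Real.mul_rpow (by positivity) (by positivity)]
    refine mul_le_mul_of_nonneg_left ?_ hC0
    refine Real.rpow_le_rpow_of_nonpos (by positivity) ?_ (by linarith)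
    have h2 := Complex.abs_im_le_norm ((x : ℂ) + y * Complex.I)
    have h3 := Complex.abs_re_le_norm ((x : ℂ) + y * Complex.I)
    rw [him, abs_of_pos hy] at h2
    rw [hre] at h3
    rw [Real.norm_eq_abs]
    have h4 := min_le_left 1 y
    have h5 := min_le_right 1 y
    have h6 : min 1 y * |x| ≤ 1 * |x| := by gcongr
    linarith
  refine ⟨h_int, ?_⟩
  have hlim : Filter.Tendsto (fun T : ℝ ↦ ∫ x in (-T)..T, G (x + y * Complex.I)) Filter.atTop
      (nhds (∫ x : ℝ, G (x + y * Complex.I))) :=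
    intervalIntegral_tendsto_integral h_int Filter.tendsto_neg_atTop_atBot Filter.tendsto_id
  refine tendsto_nhds_unique hlim ?_
  have hz : Filter.Tendsto (fun T : ℝ ↦ C * 4 * T ^ (-(p - 1))) Filter.atTop (nhds 0) := by
    simpa using (tendsto_rpow_neg_atTop (by linarith : 0 < p - 1)).const_mul (C * 4)
  refine squeeze_zero_norm' ?_ hz
  filter_upwards [Filter.eventually_gt_atTop 0] with T hT
  have hrect := Complex.integral_boundary_rect_eq_zero_of_differentiableOn G
    (((-T : ℝ) : ℂ) + y * Complex.I) ((T : ℂ) + ((y + T : ℝ) : ℂ) * Complex.I) (by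
      intro w hw
      rw [Complex.mem_reProdIm, him, him, Set.uIcc_of_le (by linarith : y ≤ y + T)] at hw
      exact (hG w hw.2.1).differentiableWithinAt)
  simp only [him, hre] at hrect
  have hb : ∀ w : ℂ, y ≤ w.im → T ≤ ‖w‖ → ‖G w‖ ≤ C * T ^ (-p) := fun w h1 h2 ↦
    (hC w h1).trans (mul_le_mul_of_nonneg_left
      (Real.rpow_le_rpow_of_nonpos hT h2 (by linarith)) hC0)
  have top : ‖∫ x in (-T)..T, G (x + ((y + T : ℝ) : ℂ) * Complex.I)‖ ≤ C * T ^ (-p) * |T - -T| := by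
    refine intervalIntegral.norm_integral_le_of_norm_le_const fun x _ ↦ hb _ ?_ ?_
    · rw [him]; linarith
    · have := Complex.abs_im_le_norm ((x : ℂ) + ((y + T : ℝ) : ℂ) * Complex.I)
      rw [him] at this
      linarith [le_abs_self (y + T)]
  have side : ∀ a : ℝ, |a| = T →
      ‖Complex.I • ∫ t in y..(y + T), G ((a : ℂ) + t * Complex.I)‖ ≤ C * T ^ (-p) * |y + T - y| := by
    intro a ha
    rw [norm_smul, Complex.norm_I, one_mul]
    refine intervalIntegral.norm_integral_le_of_norm_le_const fun t ht ↦ hb _ ?_ ?_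
    · rw [him]
      rw [Set.uIoc_of_le (by linarith)] at ht
      exact ht.1.le
    · have := Complex.abs_re_le_norm ((a : ℂ) + t * Complex.I)
      rwa [hre, ha] at this
  have s1 := side T (abs_of_pos hT)
  have s2 := side (-T) (by rw [abs_neg, abs_of_pos hT])
  have e : T ^ (-(p - 1)) = T ^ (-p) * T := by
    rw [← Real.rpow_add_one hT.ne']; congr 1; ring
  rw [show T - -T = 2 * T by ring, abs_of_pos (by linarith)] at top
  rw [show y + T - y = T by ring, abs_of_pos hT] at s1 s2
  have key : ∫ x in (-T)..T, G (x + y * Complex.I) =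
      (∫ x in (-T)..T, G (x + ((y + T : ℝ) : ℂ) * Complex.I))
      - Complex.I • (∫ t in y..(y + T), G ((T : ℂ) + t * Complex.I))
      + Complex.I • (∫ t in y..(y + T), G (((-T : ℝ) : ℂ) + t * Complex.I)) := by
    linear_combination hrect
  rw [key, e]
  refine (norm_add_le _ _).trans ?_
  have := norm_sub_le (∫ x in (-T)..T, G (x + ((y + T : ℝ) : ℂ) * Complex.I))
    (Complex.I • (∫ t in y..(y + T), G ((T : ℂ) + t * Complex.I)))
  nlinarith

theorem BddOnInterval.poisInt_pos {f : ℝ → ℝ} {M R : ℝ} (hf : BddOnInterval f M R)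
    (h0 : ∀ s, 0 ≤ f s) (hne : ¬ f =ᵐ[volume] 0) {y : ℝ} (hy : 0 < y) (t : ℝ) :
    0 < poisInt y f t := by
  have hd : ∀ s, (t - s) ^ 2 + y ^ 2 ≠ 0 := fun s ↦ by positivity
  have h1 : Integrable fun s ↦ f s * (y / ((t - s) ^ 2 + y ^ 2)) :=
    hf.integrable_mul (continuous_const.div (by fun_prop) hd)
  have hnn : ∀ s, 0 ≤ f s * (y / ((t - s) ^ 2 + y ^ 2)) := fun s ↦
    mul_nonneg (h0 s) (by positivity)
  refine lt_of_le_of_ne (integral_nonneg hnn) fun h ↦ hne ?_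
  rw [eq_comm, poisInt, integral_eq_zero_iff_of_nonneg hnn h1] at h
  filter_upwards [h] with s hs
  have hs' : f s * (y / ((t - s) ^ 2 + y ^ 2)) = 0 := hs
  have : y / ((t - s) ^ 2 + y ^ 2) ≠ 0 := by positivity
  simpa [this] using hs'

theorem BddOnInterval.integral_abs_conjInt_rpow_le {f : ℝ → ℝ} {M R : ℝ}
    (hf : BddOnInterval f M R) (hR : 0 ≤ R) (h0 : ∀ s, 0 ≤ f s) {p A B : ℝ} (hp : 1 < p)
    (hA : 0 ≤ A)
    (hAB : ∀ w : ℂ, 0 < w.re → |w.im| ^ p ≤ A * w.re ^ p - B * (w ^ (p : ℂ)).re)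
    {y : ℝ} (hy : 0 < y) :
    ∫⁻ t, ‖conjInt y f t‖ₑ ^ p ≤ ENNReal.ofReal A * ∫⁻ t, ‖poisInt y f t‖ₑ ^ p := by
  by_cases hne : f =ᵐ[volume] 0
  · have : ∀ t, conjInt y f t = 0 := fun t ↦ by
      rw [conjInt]
      refine integral_eq_zero_of_ae ?_
      filter_upwards [hne] with s hs
      simp [hs]
    simp [this, ENNReal.zero_rpow_of_pos (by linarith : 0 < p)]
  have hp0 : 0 < p := by linarith
  set L := (1 + R / y) * ∫ s, |f s| with hL
  have hpos : ∀ w : ℂ, 0 < w.im → 0 < (cauchyInt f w).re := fun w hw ↦ by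
    have := hf.cauchyInt_eq hw w.re
    rw [Complex.re_add_im] at this
    rw [this]
    simpa using hf.poisInt_pos h0 hne hw w.re
  have hn : ∀ w : ℂ, y ≤ w.im → ‖cauchyInt f w‖ ^ p ≤ L ^ p * ‖w‖ ^ (-p) := fun w hw ↦ by
    have h1 := hf.norm_mul_norm_cauchyInt_le hy hR hw
    have h2 : 0 < ‖w‖ := norm_pos_iff.2 fun h ↦ by simp [h] at hw; linarith
    rw [Real.rpow_neg h2.le, ← div_eq_mul_inv, le_div_iff₀ (by positivity),
      ← Real.mul_rpow (by positivity) (by positivity), mul_comm]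
    gcongr
  obtain ⟨hi, hz⟩ := integral_horizontal_eq_zero (G := fun w ↦ cauchyInt f w ^ (p : ℂ))
    (y := y) (C := L ^ p) hy hp
    (fun w hw ↦ (hf.differentiableAt_cauchyInt (hy.trans_le hw)).cpow_const
      (Or.inl (hpos w (hy.trans_le hw))))
    (fun w hw ↦ by rw [Complex.norm_cpow_real]; exact hn w hw)
  have hcont : Continuous fun t : ℝ ↦ cauchyInt f (t + y * Complex.I) := by
    refine continuous_iff_continuousAt.2 fun x ↦ ?_
    exact ContinuousAt.comp (g := cauchyInt f)
      (hf.differentiableAt_cauchyInt (by simpa using hy)).continuousAt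
      (by fun_prop : Continuous fun x : ℝ ↦ (x : ℂ) + y * Complex.I).continuousAt
  have ere : ∀ t : ℝ, (cauchyInt f (t + y * Complex.I)).re = poisInt y f t := fun t ↦ by
    simp [hf.cauchyInt_eq hy t]
  have eim : ∀ t : ℝ, (cauchyInt f (t + y * Complex.I)).im = conjInt y f t := fun t ↦ by
    simp [hf.cauchyInt_eq hy t]
  have hP : Integrable fun t ↦ |poisInt y f t| ^ p := by
    refine hi.norm.mono' ?_ (Filter.Eventually.of_forall fun t ↦ ?_)
    · simp only [← ere]
      exact ((Complex.continuous_re.comp hcont).abs.rpow_const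
        fun _ ↦ Or.inr hp0.le).aestronglyMeasurable
    · rw [Complex.norm_cpow_real, Real.norm_of_nonneg (by positivity), ← ere]
      gcongr; exact Complex.abs_re_le_norm _
  have hQ : Integrable fun t ↦ |conjInt y f t| ^ p := by
    refine hi.norm.mono' ?_ (Filter.Eventually.of_forall fun t ↦ ?_)
    · simp only [← eim]
      exact ((Complex.continuous_im.comp hcont).abs.rpow_const
        fun _ ↦ Or.inr hp0.le).aestronglyMeasurable
    · rw [Complex.norm_cpow_real, Real.norm_of_nonneg (by positivity), ← eim]
      gcongr; exact Complex.abs_im_le_norm _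
  have hre : ∫ t : ℝ, (cauchyInt f (t + y * Complex.I) ^ (p : ℂ)).re = 0 := by
    have := integral_re hi
    simp only [RCLike.re_eq_complex_re] at this
    rw [this, hz]; simp
  have hir : Integrable fun t : ℝ ↦ (cauchyInt f (t + y * Complex.I) ^ (p : ℂ)).re := hi.re
  have hmain : ∫ t, |conjInt y f t| ^ p ≤ A * ∫ t, |poisInt y f t| ^ p := by
    calc ∫ t, |conjInt y f t| ^ p
        ≤ ∫ t, (A * |poisInt y f t| ^ p
            - B * (cauchyInt f (t + y * Complex.I) ^ (p : ℂ)).re) := by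
          refine integral_mono hQ ((hP.const_mul A).sub (hir.const_mul B)) fun t ↦ ?_
          have ht : 0 < ((t : ℂ) + y * Complex.I).im := by simpa using hy
          have := hAB _ (hpos _ ht)
          rw [ere, eim] at this
          simpa [abs_of_pos (hf.poisInt_pos h0 hne hy t)] using this
      _ = A * ∫ t, |poisInt y f t| ^ p := by
          rw [integral_sub (hP.const_mul A) (hir.const_mul B), integral_const_mul,
            integral_const_mul, hre]
          ring
  have conv : ∀ u : ℝ → ℝ, Integrable (fun t ↦ |u t| ^ p) →
      ∫⁻ t, ‖u t‖ₑ ^ p = ENNReal.ofReal (∫ t, |u t| ^ p) := fun u hu ↦ by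
    rw [ofReal_integral_eq_lintegral_ofReal hu
      (Filter.Eventually.of_forall fun t ↦ by positivity)]
    congr 1; ext t
    rw [Real.enorm_eq_ofReal_abs, ENNReal.ofReal_rpow_of_nonneg (abs_nonneg _) hp0.le]
  rw [conv _ hQ, conv _ hP, ← ENNReal.ofReal_mul hA]
  exact ENNReal.ofReal_le_ofReal hmain

theorem lintegral_poisson_kernel {y : ℝ} (hy : 0 < y) :
    ∫⁻ z : ℝ, ENNReal.ofReal (y / (z ^ 2 + y ^ 2)) = ENNReal.ofReal Real.pi := by
  have e : (fun z : ℝ ↦ y / (z ^ 2 + y ^ 2)) = fun z ↦ y⁻¹ * (1 + (z / y) ^ 2)⁻¹ := by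
    ext z; field_simp; ring
  have hi : Integrable fun z : ℝ ↦ y / (z ^ 2 + y ^ 2) := by
    rw [e]; exact (integrable_inv_one_add_sq.comp_div hy.ne').const_mul _
  rw [← ofReal_integral_eq_lintegral_ofReal hi (Filter.Eventually.of_forall fun z ↦ by positivity),
    e, integral_const_mul, Measure.integral_comp_div (fun u : ℝ ↦ (1 + u ^ 2)⁻¹),
    integral_univ_inv_one_add_sq, abs_of_pos hy, smul_eq_mul]
  congr 1; field_simp

theorem BddOnInterval.lintegral_poisInt_rpow_le {f : ℝ → ℝ} {M R : ℝ}
    (hf : BddOnInterval f M R) {p : ℝ} (hp : 1 < p) {y : ℝ} (hy : 0 < y) :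
    ∫⁻ t, ‖poisInt y f t‖ₑ ^ p ≤ ENNReal.ofReal Real.pi ^ p * ∫⁻ t, ‖f t‖ₑ ^ p := by
  rw [← lintegral_poisson_kernel hy]
  refine le_trans (lintegral_mono fun t ↦ ?_) (lintegral_rpow_convolution_le hp
    (F := fun t ↦ ‖f t‖ₑ) hf.meas.enorm (by fun_prop))
  gcongr
  refine (enorm_integral_le_lintegral_enorm _).trans (le_of_eq ?_)
  rw [← lintegral_sub_left_eq_self _ t]
  congr 1; ext s
  rw [enorm_mul, sub_sub_cancel, Real.enorm_of_nonneg (r := y / _) (by positivity)]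

theorem BddOnInterval.integrable_conj {f : ℝ → ℝ} {M R : ℝ} (hf : BddOnInterval f M R)
    {y : ℝ} (hy : 0 < y) (t : ℝ) :
    Integrable fun s ↦ f s * ((t - s) / ((t - s) ^ 2 + y ^ 2)) := by
  have hd : ∀ s, (t - s) ^ 2 + y ^ 2 ≠ 0 := fun s ↦ by positivity
  exact hf.integrable_mul (Continuous.div (by fun_prop) (by fun_prop) hd)

/-- The conjugate Poisson integrals are bounded on `L^p`, uniformly in the height. -/
def ConjBound (p : ℝ) (C : ℝ≥0∞) : Prop :=
  ∀ (f : ℝ → ℝ) (M R : ℝ), BddOnInterval f M R → ∀ y : ℝ, 0 < y →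
    ∫⁻ t, ‖conjInt y f t‖ₑ ^ p ≤ C * ∫⁻ t, ‖f t‖ₑ ^ p

theorem measurable_conjInt {f : ℝ → ℝ} (hf : Measurable f) (y : ℝ) : Measurable (conjInt y f) := by
  refine (StronglyMeasurable.integral_prod_right (f := fun t s : ℝ ↦
    f s * ((t - s) / ((t - s) ^ 2 + y ^ 2))) ?_).measurable
  exact Measurable.stronglyMeasurable (by fun_prop)

theorem exists_conjBound_of_le_two {p : ℝ} (hp : 1 < p) (hp2 : p ≤ 2) :
    ∃ C : ℝ≥0∞, C ≠ ⊤ ∧ ConjBound p C := by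
  obtain ⟨A, B, hA, hAB⟩ := exists_rpow_abs_im_le hp hp2
  have hp0 : 0 < p := by linarith
  set D := ENNReal.ofReal A * ENNReal.ofReal Real.pi ^ p with hD
  have hDt : D ≠ ⊤ := ENNReal.mul_ne_top ENNReal.ofReal_ne_top
    (ENNReal.rpow_ne_top_of_nonneg hp0.le ENNReal.ofReal_ne_top)
  refine ⟨2 ^ (p - 1) * (D + D), ENNReal.mul_ne_top
    (ENNReal.rpow_ne_top_of_nonneg (by linarith) (by simp)) (ENNReal.add_ne_top.2 ⟨hDt, hDt⟩), ?_⟩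
  intro f M R hf y hy
  have key : ∀ u : ℝ → ℝ, BddOnInterval u M (max R 0) → (∀ s, 0 ≤ u s) →
      (∀ s, |u s| ≤ |f s|) → ∫⁻ t, ‖conjInt y u t‖ₑ ^ p ≤ D * ∫⁻ t, ‖f t‖ₑ ^ p := by
    intro u hu hu0 huf
    calc ∫⁻ t, ‖conjInt y u t‖ₑ ^ p ≤ ENNReal.ofReal A * ∫⁻ t, ‖poisInt y u t‖ₑ ^ p :=
          hu.integral_abs_conjInt_rpow_le (le_max_right _ _) hu0 hp hA hAB hy
      _ ≤ ENNReal.ofReal A * (ENNReal.ofReal Real.pi ^ p * ∫⁻ t, ‖u t‖ₑ ^ p) := by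
          gcongr; exact hu.lintegral_poisInt_rpow_le hp hy
      _ ≤ D * ∫⁻ t, ‖f t‖ₑ ^ p := by
          rw [hD, mul_assoc]
          gcongr with t
          rw [Real.enorm_eq_ofReal_abs, Real.enorm_eq_ofReal_abs]
          exact ENNReal.ofReal_le_ofReal (huf t)
  have hpos : BddOnInterval (fun s ↦ max (f s) 0) M (max R 0) :=
    ⟨hf.meas.max measurable_const, fun s ↦ by
      rw [abs_of_nonneg (le_max_right _ _)]
      exact max_le ((le_abs_self _).trans (hf.bound s)) ((abs_nonneg _).trans (hf.bound s)),
      fun s hs ↦ by simp [hf.supp s ((le_max_left _ _).trans_lt hs)]⟩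
  have hneg : BddOnInterval (fun s ↦ max (-f s) 0) M (max R 0) :=
    ⟨hf.meas.neg.max measurable_const, fun s ↦ by
      rw [abs_of_nonneg (le_max_right _ _)]
      exact max_le ((neg_le_abs _).trans (hf.bound s)) ((abs_nonneg _).trans (hf.bound s)),
      fun s hs ↦ by simp [hf.supp s ((le_max_left _ _).trans_lt hs)]⟩
  have e : ∀ t, conjInt y f t
      = conjInt y (fun s ↦ max (f s) 0) t - conjInt y (fun s ↦ max (-f s) 0) t := fun t ↦ by
    rw [conjInt, conjInt, conjInt, ← integral_sub (hpos.integrable_conj hy t)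
      (hneg.integrable_conj hy t)]
    congr 1; ext s
    rw [← sub_mul]
    congr 1
    rcases le_total (f s) 0 with h | h
    · rw [max_eq_right h, max_eq_left (by linarith)]; ring
    · rw [max_eq_left h, max_eq_right (by linarith)]; ring
  calc ∫⁻ t, ‖conjInt y f t‖ₑ ^ p
      ≤ ∫⁻ t, 2 ^ (p - 1) * (‖conjInt y (fun s ↦ max (f s) 0) t‖ₑ ^ p
          + ‖conjInt y (fun s ↦ max (-f s) 0) t‖ₑ ^ p) := by
        refine lintegral_mono fun t ↦ le_trans ?_ (ENNReal.rpow_add_le_mul_rpow_add_rpow _ _ hp.le)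
        rw [e]
        gcongr
        exact enorm_sub_le
    _ = 2 ^ (p - 1) * ((∫⁻ t, ‖conjInt y (fun s ↦ max (f s) 0) t‖ₑ ^ p)
          + ∫⁻ t, ‖conjInt y (fun s ↦ max (-f s) 0) t‖ₑ ^ p) := by
        rw [lintegral_const_mul, lintegral_add_left]
        · exact (measurable_conjInt hpos.meas y).enorm.pow_const p
        · exact ((measurable_conjInt hpos.meas y).enorm.pow_const p).add
            ((measurable_conjInt hneg.meas y).enorm.pow_const p)
    _ ≤ 2 ^ (p - 1) * ((D * ∫⁻ t, ‖f t‖ₑ ^ p) + D * ∫⁻ t, ‖f t‖ₑ ^ p) := by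
        gcongr
        · refine key _ hpos (fun s ↦ le_max_right _ _) fun s ↦ ?_
          rw [abs_of_nonneg (le_max_right _ _)]
          exact max_le (le_abs_self _) (abs_nonneg _)
        · refine key _ hneg (fun s ↦ le_max_right _ _) fun s ↦ ?_
          rw [abs_of_nonneg (le_max_right _ _)]
          exact max_le (neg_le_abs _) (abs_nonneg _)
    _ = _ := by ring

theorem abs_conj_kernel_le {y : ℝ} (hy : 0 < y) (z : ℝ) : |z / (z ^ 2 + y ^ 2)| ≤ 1 / y := by
  have h : 0 < z ^ 2 + y ^ 2 := by positivity
  rw [abs_div, abs_of_pos h, div_le_div_iff₀ h hy, ← sq_abs z]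
  nlinarith [sq_nonneg (|z| - y), abs_nonneg z]

theorem BddOnInterval.integral_mul_conjInt {f g : ℝ → ℝ} {M R M' R' : ℝ}
    (hf : BddOnInterval f M R) (hg : BddOnInterval g M' R') {y : ℝ} (hy : 0 < y) :
    ∫ t, g t * conjInt y f t = -∫ s, f s * conjInt y g s := by
  have hfi : Integrable f := by simpa using hf.integrable_mul (continuous_const (y := (1:ℝ)))
  have hgi : Integrable g := by simpa using hg.integrable_mul (continuous_const (y := (1:ℝ)))
  have hprod : Integrable (Function.uncurry fun t s : ℝ ↦
      g t * f s * ((t - s) / ((t - s) ^ 2 + y ^ 2))) (volume.prod volume) := by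
    refine (hgi.mul_prod hfi).mul_bdd (c := 1 / y) ?_ ?_
    · exact Measurable.aestronglyMeasurable (by fun_prop)
    · exact Filter.Eventually.of_forall fun z ↦ abs_conj_kernel_le hy _
  calc ∫ t, g t * conjInt y f t
      = ∫ t, ∫ s, g t * f s * ((t - s) / ((t - s) ^ 2 + y ^ 2)) := by
        congr 1; ext t
        rw [conjInt, ← integral_const_mul]
        congr 1; ext s; ring
    _ = ∫ s, ∫ t, g t * f s * ((t - s) / ((t - s) ^ 2 + y ^ 2)) := integral_integral_swap hprod
    _ = ∫ s, -(f s * conjInt y g s) := by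
        congr 1; ext s
        rw [conjInt, ← integral_const_mul, ← integral_neg]
        congr 1; ext t
        rw [show (s - t) ^ 2 = (t - s) ^ 2 by ring]
        ring
    _ = _ := integral_neg _

theorem BddOnInterval.abs_conjInt_le {f : ℝ → ℝ} {M R : ℝ} (hf : BddOnInterval f M R)
    {y : ℝ} (hy : 0 < y) (t : ℝ) : |conjInt y f t| ≤ (∫ s, |f s|) * (1 / y) := by
  have hfi : Integrable f := by simpa using hf.integrable_mul (continuous_const (y := (1:ℝ)))
  rw [← Real.norm_eq_abs, conjInt, ← integral_mul_const]
  refine norm_integral_le_of_norm_le (hfi.abs.mul_const _) (Filter.Eventually.of_forall fun s ↦ ?_)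
  rw [norm_mul, Real.norm_eq_abs, Real.norm_eq_abs]
  gcongr
  exact abs_conj_kernel_le hy _

theorem ENNReal.le_mul_rpow_of_le_mul_rpow {X F C : ℝ≥0∞} {p q : ℝ} (hpq : p.HolderConjugate q)
    (hX : X ≠ ⊤) (h : X ≤ F ^ (1 / p) * (C * X) ^ (1 / q)) : X ≤ C ^ (p / q) * F := by
  have hp := hpq.pos
  have hq := hpq.symm.pos
  rcases eq_or_ne X 0 with rfl | h0
  · exact zero_le
  have e : X = X ^ (1 / p) * X ^ (1 / q) := by
    rw [← ENNReal.rpow_add _ _ h0 hX, one_div, one_div, hpq.inv_add_inv_eq_one, ENNReal.rpow_one]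
  rw [ENNReal.mul_rpow_of_nonneg _ _ (by positivity), ← mul_assoc] at h
  have h2 : X ^ (1 / p) ≤ F ^ (1 / p) * C ^ (1 / q) := by
    refine (ENNReal.mul_le_mul_iff_left (c := X ^ (1 / q)) ?_ ?_).1 (e.symm.le.trans h)
    · simp [ENNReal.rpow_eq_zero_iff, h0, hX]
    · exact ENNReal.rpow_ne_top_of_nonneg (by positivity) hX
  have h3 := ENNReal.rpow_le_rpow h2 hp.le
  rw [ENNReal.mul_rpow_of_nonneg _ _ hp.le, ← ENNReal.rpow_mul, ← ENNReal.rpow_mul,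
    ← ENNReal.rpow_mul, one_div_mul_cancel hp.ne', ENNReal.rpow_one, ENNReal.rpow_one] at h3
  rw [mul_comm]
  convert h3 using 3
  ring

theorem ConjBound.dual {p q : ℝ} (hpq : p.HolderConjugate q) {C : ℝ≥0∞} (hC : ConjBound q C) :
    ConjBound p (C ^ (p / q)) := by
  intro f M R hf y hy
  have hp := hpq.pos
  have hq := hpq.symm.pos
  set u := conjInt y f with hu
  set M1 := (∫ s, |f s|) * (1 / y) with hM1
  have hum : Measurable u := measurable_conjInt hf.meas y
  have hub : ∀ t, |u t| ≤ M1 := hf.abs_conjInt_le hy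
  have key : ∀ N : ℕ, ∫⁻ t in Set.Icc (-(N:ℝ)) N, ‖u t‖ₑ ^ p ≤ C ^ (p / q) * ∫⁻ t, ‖f t‖ₑ ^ p := by
    intro N
    set g : ℝ → ℝ := (Set.Icc (-(N:ℝ)) N).indicator fun t ↦ (SignType.sign (u t) : ℝ) *
      |u t| ^ (p - 1) with hg
    have hsm : Measurable fun t ↦ ((SignType.sign (u t) : SignType) : ℝ) := by
      have : (fun t ↦ ((SignType.sign (u t) : SignType) : ℝ))
          = fun t ↦ if 0 < u t then 1 else if u t < 0 then -1 else 0 := by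
        ext t; simp only [sign_apply]; split_ifs <;> simp
      rw [this]
      exact Measurable.ite (measurableSet_lt measurable_const hum) measurable_const
        (Measurable.ite (measurableSet_lt hum measurable_const) measurable_const measurable_const)
    have hga : ∀ t ∈ Set.Icc (-(N:ℝ)) N, |g t| = |u t| ^ (p - 1) := fun t ht ↦ by
      rw [hg, Set.indicator_of_mem ht, abs_mul, abs_of_nonneg (Real.rpow_nonneg (abs_nonneg _) _)]
      rcases lt_trichotomy (u t) 0 with h | h | h
      · simp [h]
      · simp [h, Real.zero_rpow hpq.sub_one_ne_zero]
      · simp [h]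
    have hgB : BddOnInterval g (M1 ^ (p - 1)) N := by
      refine ⟨(hsm.mul (hum.abs.pow_const _)).indicator measurableSet_Icc, fun s ↦ ?_, fun s hs ↦ ?_⟩
      · by_cases hs : s ∈ Set.Icc (-(N:ℝ)) N
        · rw [hga s hs]
          exact Real.rpow_le_rpow (abs_nonneg _) (hub s) hpq.sub_one_pos.le
        · rw [hg, Set.indicator_of_notMem hs, abs_zero]
          exact Real.rpow_nonneg ((abs_nonneg _).trans (hub s)) _
      · refine Set.indicator_of_notMem (fun h ↦ ?_) _
        exact absurd (abs_le.2 h) (not_le.2 hs)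
    set X := ∫⁻ t in Set.Icc (-(N:ℝ)) N, ‖u t‖ₑ ^ p with hX
    have hXt : X ≠ ⊤ := by
      refine (setLIntegral_lt_top_of_le_nnreal (s := Set.Icc (-(N:ℝ)) N) (by simp)
        ⟨(M1.toNNReal ^ p), fun t _ ↦ ?_⟩).ne
      rw [ENNReal.coe_rpow_of_nonneg _ hp.le]
      gcongr
      rw [Real.enorm_eq_ofReal_abs]
      exact ENNReal.ofReal_le_ofReal (hub t)
    have hgu : ∀ t, ENNReal.ofReal (g t * u t)
        = (Set.Icc (-(N:ℝ)) N).indicator (fun t ↦ ‖u t‖ₑ ^ p) t := fun t ↦ by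
      by_cases ht : t ∈ Set.Icc (-(N:ℝ)) N
      · rw [hg, Set.indicator_of_mem ht, Set.indicator_of_mem ht, mul_right_comm, sign_mul_self,
          Real.enorm_eq_ofReal_abs, ENNReal.ofReal_rpow_of_nonneg (abs_nonneg _) hp.le]
        congr 1
        conv_lhs => rw [← Real.rpow_one (|u t|)]
        rcases eq_or_ne (u t) 0 with h | h
        · simp [h, Real.zero_rpow hp.ne']
        · rw [Real.rpow_one, mul_comm, ← Real.rpow_add_one (abs_ne_zero.2 h)]
          congr 1; ring
      · rw [hg, Set.indicator_of_notMem ht, Set.indicator_of_notMem ht]; simp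
    have hgu0 : ∀ t, 0 ≤ g t * u t := fun t ↦ by
      by_cases ht : t ∈ Set.Icc (-(N:ℝ)) N
      · rw [hg, Set.indicator_of_mem ht, mul_right_comm, sign_mul_self]; positivity
      · rw [hg, Set.indicator_of_notMem ht]; simp
    have hgi : Integrable g := by simpa using hgB.integrable_mul (continuous_const (y := (1:ℝ)))
    have hgui : Integrable fun t ↦ g t * u t :=
      hgi.mul_bdd (c := M1) hum.aestronglyMeasurable (Filter.Eventually.of_forall hub)
    have e1 : X = ENNReal.ofReal (∫ t, g t * u t) := by
      rw [ofReal_integral_eq_lintegral_ofReal hgui (Filter.Eventually.of_forall hgu0),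
        lintegral_congr hgu, lintegral_indicator measurableSet_Icc]
    have e2 : ∫⁻ t, ‖g t‖ₑ ^ q = X := by
      rw [hX, ← lintegral_indicator measurableSet_Icc]
      refine lintegral_congr fun t ↦ ?_
      by_cases ht : t ∈ Set.Icc (-(N:ℝ)) N
      · rw [Set.indicator_of_mem ht, Real.enorm_eq_ofReal_abs, hga t ht, Real.enorm_eq_ofReal_abs,
          ← ENNReal.ofReal_rpow_of_nonneg (abs_nonneg _) hpq.sub_one_pos.le, ← ENNReal.rpow_mul,
          hpq.sub_one_mul_conj]
      · rw [Set.indicator_of_notMem ht, hg, Set.indicator_of_notMem ht]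
        simp [hq]
    refine ENNReal.le_mul_rpow_of_le_mul_rpow hpq hXt ?_
    calc X = ENNReal.ofReal (∫ t, g t * u t) := e1
      _ ≤ ‖∫ t, g t * u t‖ₑ := by
          rw [Real.enorm_eq_ofReal_abs]; exact ENNReal.ofReal_le_ofReal (le_abs_self _)
      _ = ‖∫ s, f s * conjInt y g s‖ₑ := by rw [hf.integral_mul_conjInt hgB hy, enorm_neg]
      _ ≤ ∫⁻ s, ‖f s‖ₑ * ‖conjInt y g s‖ₑ := by
          refine (enorm_integral_le_lintegral_enorm _).trans (le_of_eq ?_)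
          simp only [enorm_mul]
      _ ≤ (∫⁻ s, ‖f s‖ₑ ^ p) ^ (1 / p) * (∫⁻ s, ‖conjInt y g s‖ₑ ^ q) ^ (1 / q) :=
          ENNReal.lintegral_mul_le_Lp_mul_Lq _ hpq hf.meas.enorm.aemeasurable
            (measurable_conjInt hgB.meas y).enorm.aemeasurable
      _ ≤ (∫⁻ s, ‖f s‖ₑ ^ p) ^ (1 / p) * (C * X) ^ (1 / q) := by
          gcongr
          rw [← e2]
          exact hC g _ _ hgB y hy
  have hlim : ∫⁻ t, ‖u t‖ₑ ^ p = ⨆ N : ℕ, ∫⁻ t in Set.Icc (-(N:ℝ)) N, ‖u t‖ₑ ^ p := by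
    have hU : ⋃ N : ℕ, Set.Icc (-(N:ℝ)) N = Set.univ := by
      refine Set.eq_univ_of_forall fun t ↦ Set.mem_iUnion.2 ?_
      obtain ⟨N, hN⟩ := exists_nat_ge |t|
      exact ⟨N, abs_le.1 hN⟩
    rw [← setLIntegral_univ, ← hU]
    refine setLIntegral_iUnion_of_directed _ (Monotone.directed_le fun a b hab ↦ ?_)
    have : (a:ℝ) ≤ b := by exact_mod_cast hab
    exact Set.Icc_subset_Icc (by linarith) this
  rw [hlim]
  exact iSup_le key

theorem exists_conjBound {p : ℝ} (hp : 1 < p) : ∃ C : ℝ≥0∞, C ≠ ⊤ ∧ ConjBound p C := by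
  rcases le_or_gt p 2 with h | h
  · exact exists_conjBound_of_le_two hp h
  have hpq := Real.HolderConjugate.conjExponent hp
  obtain ⟨C, hC, hCB⟩ := exists_conjBound_of_le_two hpq.symm.lt (by
    rw [Real.conjExponent, div_le_iff₀ (by linarith)]; linarith)
  refine ⟨_, ENNReal.rpow_ne_top_of_nonneg ?_ hC, hCB.dual hpq⟩
  exact div_nonneg hpq.nonneg hpq.symm.nonneg

theorem integral_eq_integral_Ioi_add_comp_neg {g : ℝ → ℝ} (hg : Integrable g) :
    ∫ s, g s = ∫ s in Set.Ioi (0:ℝ), (g s + g (-s)) := by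
  rw [integral_add hg.integrableOn hg.comp_neg.integrableOn, integral_comp_neg_Ioi, neg_zero,
    ← integral_add_compl measurableSet_Ioi hg, Set.compl_Ioi]

theorem BddOnInterval.conjInt_eq_integral_Ioi {f : ℝ → ℝ} {M R : ℝ} (hf : BddOnInterval f M R)
    {y : ℝ} (hy : 0 < y) (t : ℝ) :
    IntegrableOn (fun s ↦ (f (t - s) - f (t + s)) * (s / (s ^ 2 + y ^ 2))) (Set.Ioi 0) ∧
    conjInt y f t = ∫ s in Set.Ioi (0:ℝ), (f (t - s) - f (t + s)) * (s / (s ^ 2 + y ^ 2)) := by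
  have hi : Integrable fun s ↦ f (t - s) * (s / (s ^ 2 + y ^ 2)) := by
    have := (hf.integrable_conj hy t).comp_sub_left t
    simpa using this
  have e : (fun s ↦ (f (t - s) - f (t + s)) * (s / (s ^ 2 + y ^ 2)))
      = fun s ↦ f (t - s) * (s / (s ^ 2 + y ^ 2))
        + f (t - (-s)) * ((-s) / ((-s) ^ 2 + y ^ 2)) := by
    ext s; rw [sub_neg_eq_add, neg_sq]; ring
  rw [e]
  refine ⟨hi.integrableOn.add hi.comp_neg.integrableOn, ?_⟩
  rw [← integral_eq_integral_Ioi_add_comp_neg hi, conjInt, ← integral_sub_left_eq_self _ _ t]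
  simp

/-- The truncated Hilbert transform, at scale one, in symmetric form. -/
def truncHilbert (φ : ℝ → ℝ) (t : ℝ) : ℝ := ∫ s in Set.Ioc (0:ℝ) 1, (φ (t - s) - φ (t + s)) / s

/-- A regularisation of the truncated Hilbert transform. -/
def regHilbert (y : ℝ) (φ : ℝ → ℝ) (t : ℝ) : ℝ :=
  ∫ s in Set.Ioc (0:ℝ) 1, (φ (t - s) - φ (t + s)) * (s / (s ^ 2 + y ^ 2))

theorem Continuous.bddOnInterval_indicator {φ : ℝ → ℝ} (hφ : Continuous φ) :
    ∃ M, BddOnInterval ((Set.Icc (-1) 2).indicator φ) M 2 := by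
  obtain ⟨M, hM⟩ := (isCompact_Icc (a := (-1:ℝ)) (b := 2)).exists_bound_of_continuousOn
    hφ.continuousOn
  refine ⟨M, hφ.measurable.indicator measurableSet_Icc, fun s ↦ ?_, fun s hs ↦ ?_⟩
  · by_cases hs : s ∈ Set.Icc (-1:ℝ) 2
    · rw [Set.indicator_of_mem hs]; exact hM s hs
    · rw [Set.indicator_of_notMem hs, abs_zero]
      exact (norm_nonneg _).trans (hM 0 (by norm_num))
  · refine Set.indicator_of_notMem (fun h ↦ ?_) _
    have := abs_le.2 ⟨(by linarith [h.1] : -2 ≤ s), h.2⟩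
    linarith

theorem enorm_regHilbert_le {φ : ℝ → ℝ} (hφ : Continuous φ) {y : ℝ} (hy : 0 < y) {t : ℝ}
    (ht : t ∈ Set.Icc (0:ℝ) 1) :
    ‖regHilbert y φ t‖ₑ ≤ ‖conjInt y ((Set.Icc (-1) 2).indicator φ) t‖ₑ
      + 2 * ∫⁻ s in Set.Icc (-1) 2, ‖φ s‖ₑ := by
  obtain ⟨M, hfB⟩ := hφ.bddOnInterval_indicator
  set f := (Set.Icc (-1) 2).indicator φ with hf
  obtain ⟨hi, he⟩ := hfB.conjInt_eq_integral_Ioi hy t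
  have hu : Set.Ioi (0:ℝ) = Set.Ioc 0 1 ∪ Set.Ioi 1 := (Set.Ioc_union_Ioi_eq_Ioi zero_le_one).symm
  have h1 : regHilbert y φ t
      = ∫ s in Set.Ioc (0:ℝ) 1, (f (t - s) - f (t + s)) * (s / (s ^ 2 + y ^ 2)) := by
    refine setIntegral_congr_fun measurableSet_Ioc fun s hs ↦ ?_
    have h1 : t - s ∈ Set.Icc (-1:ℝ) 2 := ⟨by linarith [ht.1, hs.2], by linarith [ht.2, hs.1]⟩
    have h2 : t + s ∈ Set.Icc (-1:ℝ) 2 := ⟨by linarith [ht.1, hs.1], by linarith [ht.2, hs.2]⟩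
    simp only [hf, Set.indicator_of_mem h1, Set.indicator_of_mem h2]
  have h2 : regHilbert y φ t = conjInt y f t
      - ∫ s in Set.Ioi (1:ℝ), (f (t - s) - f (t + s)) * (s / (s ^ 2 + y ^ 2)) := by
    rw [h1, he, hu, setIntegral_union (Set.Ioc_disjoint_Ioi le_rfl) measurableSet_Ioi
      (hi.mono_set (by rw [hu]; exact Set.subset_union_left))
      (hi.mono_set (by rw [hu]; exact Set.subset_union_right))]
    ring
  have h3 : ∫⁻ s in Set.Icc (-1) 2, ‖φ s‖ₑ = ∫⁻ s, ‖f s‖ₑ := by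
    rw [← lintegral_indicator measurableSet_Icc]
    congr 1; ext s
    rw [hf, enorm_indicator_eq_indicator_enorm]
  rw [h2, h3]
  refine enorm_sub_le.trans (add_le_add_right ((enorm_integral_le_lintegral_enorm _).trans ?_) _)
  calc ∫⁻ s in Set.Ioi (1:ℝ), ‖(f (t - s) - f (t + s)) * (s / (s ^ 2 + y ^ 2))‖ₑ
      ≤ ∫⁻ s in Set.Ioi (1:ℝ), (‖f (t - s)‖ₑ + ‖f (t + s)‖ₑ) := by
        refine setLIntegral_mono' measurableSet_Ioi fun s hs ↦ ?_
        rw [enorm_mul]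
        refine (mul_le_of_le_one_right zero_le ?_).trans enorm_sub_le
        have hs' : 1 < s := hs
        rw [Real.enorm_of_nonneg (by positivity), ENNReal.ofReal_le_one,
          div_le_one (by positivity)]
        nlinarith [sq_nonneg y]
    _ ≤ ∫⁻ s, (‖f (t - s)‖ₑ + ‖f (t + s)‖ₑ) := setLIntegral_le_lintegral _ _
    _ = 2 * ∫⁻ s, ‖f s‖ₑ := by
        have hm := hfB.meas
        rw [lintegral_add_left (by fun_prop), lintegral_sub_left_eq_self (fun s ↦ ‖f s‖ₑ),
          lintegral_add_left_eq_self (fun s ↦ ‖f s‖ₑ), two_mul]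

theorem exists_truncHilbert_bound {p : ℝ} (hp : 1 < p) : ∃ C : ℝ≥0∞, C ≠ ⊤ ∧
    ∀ (L : NNReal) (φ : ℝ → ℝ), LipschitzWith L φ →
      ∫⁻ t in Set.Icc (0:ℝ) 1, ‖truncHilbert φ t‖ₑ ^ p
        ≤ C * ∫⁻ t in Set.Icc (-1:ℝ) 2, ‖φ t‖ₑ ^ p := by
  obtain ⟨C, hC, hCB⟩ := exists_conjBound hp
  have hp0 : 0 < p := by linarith
  refine ⟨2 ^ (p - 1) * (C + 2 ^ p * 3 ^ (p - 1)), ?_, ?_⟩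
  · have h2 : ∀ a : ℝ, 0 ≤ a → (2:ℝ≥0∞) ^ a ≠ ⊤ := fun a ha ↦
      ENNReal.rpow_ne_top_of_nonneg ha (by simp)
    have h3 : ∀ a : ℝ, 0 ≤ a → (3:ℝ≥0∞) ^ a ≠ ⊤ := fun a ha ↦
      ENNReal.rpow_ne_top_of_nonneg ha (by simp)
    have hp1 : 0 ≤ p - 1 := by linarith
    exact ENNReal.mul_ne_top (h2 _ hp1) (ENNReal.add_ne_top.2 ⟨hC,
      ENNReal.mul_ne_top (h2 _ hp0.le) (h3 _ hp1)⟩)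
  intro L φ hφ
  have hφc := hφ.continuous
  set I := ∫⁻ t in Set.Icc (-1:ℝ) 2, ‖φ t‖ₑ ^ p with hI
  set f := (Set.Icc (-1) 2).indicator φ with hf
  have hfI : ∫⁻ s, ‖f s‖ₑ ^ p = I := by
    rw [hI, ← lintegral_indicator measurableSet_Icc]
    congr 1; ext s
    by_cases hs : s ∈ Set.Icc (-1:ℝ) 2
    · simp [hf, hs]
    · simp [hf, hs, hp0]
  obtain ⟨M, hfB⟩ := hφc.bddOnInterval_indicator
  have hreg : ∀ y : ℝ, 0 < y → ∫⁻ t in Set.Icc (0:ℝ) 1, ‖regHilbert y φ t‖ₑ ^ p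
      ≤ 2 ^ (p - 1) * (C + 2 ^ p * 3 ^ (p - 1)) * I := by
    intro y hy
    set J := ∫⁻ s in Set.Icc (-1:ℝ) 2, ‖φ s‖ₑ with hJ
    have hJI : J ^ p ≤ 3 ^ (p - 1) * I := by
      have := lintegral_rpow_le_measure_univ_mul (μ := volume.restrict (Set.Icc (-1:ℝ) 2)) hp
        (F := fun s ↦ ‖φ s‖ₑ) (by fun_prop)
      simpa [show (2:ℝ) + 1 = 3 by norm_num] using this
    calc ∫⁻ t in Set.Icc (0:ℝ) 1, ‖regHilbert y φ t‖ₑ ^ p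
        ≤ ∫⁻ t in Set.Icc (0:ℝ) 1, 2 ^ (p - 1) * (‖conjInt y f t‖ₑ ^ p + (2 * J) ^ p) := by
          refine setLIntegral_mono' measurableSet_Icc fun t ht ↦ ?_
          refine le_trans ?_ (ENNReal.rpow_add_le_mul_rpow_add_rpow _ _ hp.le)
          gcongr
          exact enorm_regHilbert_le hφc hy ht
      _ = 2 ^ (p - 1) * ((∫⁻ t in Set.Icc (0:ℝ) 1, ‖conjInt y f t‖ₑ ^ p) + (2 * J) ^ p) := by
          have := measurable_conjInt hfB.meas y
          rw [lintegral_const_mul _ (by fun_prop), lintegral_add_left (by fun_prop)]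
          simp
      _ ≤ 2 ^ (p - 1) * (C * I + 2 ^ p * (3 ^ (p - 1) * I)) := by
          rw [ENNReal.mul_rpow_of_nonneg _ _ hp0.le]
          gcongr
          rw [← hfI]
          exact (setLIntegral_le_lintegral _ _).trans (hCB f _ _ hfB y hy)
      _ = _ := by ring
  have hlim : ∀ t, Filter.Tendsto (fun n : ℕ ↦ regHilbert (1 / ((n:ℝ) + 1)) φ t) Filter.atTop
      (nhds (truncHilbert φ t)) := by
    intro t
    refine tendsto_integral_of_dominated_convergence (fun _ ↦ 2 * (L:ℝ)) ?_ ?_ ?_ ?_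
    · intro n
      exact Measurable.aestronglyMeasurable (by fun_prop)
    · exact integrableOn_const (by simp)
    · intro n
      refine (ae_restrict_iff' measurableSet_Ioc).2 (Filter.Eventually.of_forall fun s hs ↦ ?_)
      have h := hφ.dist_le_mul (t - s) (t + s)
      rw [Real.dist_eq, Real.dist_eq, show t - s - (t + s) = -(2 * s) by ring, abs_neg,
        abs_of_pos (by linarith [hs.1] : 0 < 2 * s)] at h
      have hs0 := hs.1
      rw [Real.norm_eq_abs, abs_mul, abs_of_nonneg (a := s / _) (by positivity)]
      calc |φ (t - s) - φ (t + s)| * (s / (s ^ 2 + (1 / ((n:ℝ) + 1)) ^ 2))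
          ≤ ((L:ℝ) * (2 * s)) * (s / (s ^ 2 + 0)) := by gcongr; positivity
        _ = 2 * (L:ℝ) := by field_simp; simp
    · refine (ae_restrict_iff' measurableSet_Ioc).2 (Filter.Eventually.of_forall fun s hs ↦ ?_)
      have hs0 := hs.1
      have e : (φ (t - s) - φ (t + s)) / s
          = (φ (t - s) - φ (t + s)) * (s / (s ^ 2 + 0 ^ 2)) := by
        rw [zero_pow two_ne_zero, add_zero]; field_simp
      rw [e]
      refine Filter.Tendsto.const_mul _ (Filter.Tendsto.div tendsto_const_nhds
        (tendsto_const_nhds.add (tendsto_one_div_add_atTop_nhds_zero_nat.pow 2)) (by positivity))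
  have hmeas : ∀ y, Measurable (regHilbert y φ) := fun y ↦ by
    refine (StronglyMeasurable.integral_prod_right (f := fun t s : ℝ ↦
      (φ (t - s) - φ (t + s)) * (s / (s ^ 2 + y ^ 2))) ?_).measurable
    exact Measurable.stronglyMeasurable (by fun_prop)
  calc ∫⁻ t in Set.Icc (0:ℝ) 1, ‖truncHilbert φ t‖ₑ ^ p
      = ∫⁻ t in Set.Icc (0:ℝ) 1, Filter.liminf
          (fun n : ℕ ↦ ‖regHilbert (1 / ((n:ℝ) + 1)) φ t‖ₑ ^ p) Filter.atTop := by
        refine lintegral_congr fun t ↦ (Filter.Tendsto.liminf_eq ?_).symm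
        exact ((ENNReal.continuous_rpow_const.tendsto _).comp
          ((continuous_enorm.tendsto _).comp (hlim t)))
    _ ≤ Filter.liminf (fun n : ℕ ↦ ∫⁻ t in Set.Icc (0:ℝ) 1,
          ‖regHilbert (1 / ((n:ℝ) + 1)) φ t‖ₑ ^ p) Filter.atTop :=
        lintegral_liminf_le fun n ↦ ((hmeas _).enorm.pow_const p)
    _ ≤ _ := by
        refine (Filter.liminf_le_liminf (Filter.Eventually.of_forall fun n ↦
          hreg _ Nat.one_div_pos_of_nat)).trans ?_
        simp

/-- The Euclidean plane. -/
abbrev Plane := EuclideanSpace ℝ (Fin 2)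

/-- The truncated Hilbert transform in the direction `ω`. -/
def dirHilbert (f : Plane → ℝ) (ω x : Plane) : ℝ :=
  ∫ s in Set.Ioc (0:ℝ) 1, (f (x - s • ω) - f (x + s • ω)) / s

theorem measurable_dirHilbert {f : Plane → ℝ} (hf : Measurable f) :
    Measurable fun q : Plane × Plane ↦ dirHilbert f q.1 q.2 := by
  refine (StronglyMeasurable.integral_prod_right (f := fun (q : Plane × Plane) (s : ℝ) ↦
    (f (q.2 - s • q.1) - f (q.2 + s • q.1)) / s) ?_).measurable
  exact Measurable.stronglyMeasurable (by fun_prop)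

theorem truncHilbert_comp_line (f : Plane → ℝ) (ω x : Plane) (t : ℝ) :
    truncHilbert (fun t ↦ f (x + t • ω)) t = dirHilbert f ω (x + t • ω) := by
  rw [truncHilbert, dirHilbert]
  congr 1; ext s
  simp only [sub_smul, add_smul, add_sub_assoc, add_assoc]

theorem exists_dirHilbert_bound {p : ℝ} (hp : 1 < p) : ∃ C : ℝ≥0∞, C ≠ ⊤ ∧
    ∀ (L : NNReal) (f : Plane → ℝ), LipschitzWith L f → ∀ ω : Plane, ‖ω‖ = 1 →
      ∫⁻ x, ‖dirHilbert f ω x‖ₑ ^ p ≤ C * ∫⁻ x, ‖f x‖ₑ ^ p := by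
  obtain ⟨C, hC, hCB⟩ := exists_truncHilbert_bound hp
  refine ⟨C * 3, ENNReal.mul_ne_top hC (by simp), fun L f hf ω hω ↦ ?_⟩
  have hm : Measurable f := hf.continuous.measurable
  have hH : Measurable (dirHilbert f ω) := (measurable_dirHilbert hm).comp measurable_prodMk_left
  have hline : ∀ x, LipschitzWith L fun t : ℝ ↦ f (x + t • ω) := fun x ↦ by
    refine LipschitzWith.of_dist_le_mul fun a b ↦ (hf.dist_le_mul _ _).trans ?_
    rw [dist_add_left, dist_eq_norm, ← sub_smul, norm_smul, hω, mul_one, Real.dist_eq,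
      Real.norm_eq_abs]
  calc ∫⁻ x, ‖dirHilbert f ω x‖ₑ ^ p
      = ∫⁻ t in Set.Icc (0:ℝ) 1, ∫⁻ x, ‖dirHilbert f ω (x + t • ω)‖ₑ ^ p := by
        simp_rw [lintegral_add_right_eq_self (fun x ↦ ‖dirHilbert f ω x‖ₑ ^ p)]
        simp
    _ = ∫⁻ x, ∫⁻ t in Set.Icc (0:ℝ) 1, ‖dirHilbert f ω (x + t • ω)‖ₑ ^ p := by
        refine lintegral_lintegral_swap (Measurable.aemeasurable ?_)
        exact (hH.comp (show Measurable fun q : ℝ × Plane ↦ q.2 + q.1 • ω by fun_prop)).enorm.pow_const p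
    _ ≤ ∫⁻ x, C * ∫⁻ t in Set.Icc (-1:ℝ) 2, ‖f (x + t • ω)‖ₑ ^ p := by
        refine lintegral_mono fun x ↦ ?_
        simp_rw [← truncHilbert_comp_line]
        exact hCB L _ (hline x)
    _ = C * ∫⁻ x, ∫⁻ t in Set.Icc (-1:ℝ) 2, ‖f (x + t • ω)‖ₑ ^ p := by
        refine lintegral_const_mul _ ?_
        exact Measurable.lintegral_prod_right' (f := fun q : Plane × ℝ ↦ ‖f (q.1 + q.2 • ω)‖ₑ ^ p)
          (by fun_prop)
    _ = C * ∫⁻ t in Set.Icc (-1:ℝ) 2, ∫⁻ x, ‖f (x + t • ω)‖ₑ ^ p := by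
        rw [lintegral_lintegral_swap]
        exact Measurable.aemeasurable (f := fun q : Plane × ℝ ↦ ‖f (q.1 + q.2 • ω)‖ₑ ^ p)
          (by fun_prop)
    _ = C * 3 * ∫⁻ x, ‖f x‖ₑ ^ p := by
        simp_rw [lintegral_add_right_eq_self (fun x ↦ ‖f x‖ₑ ^ p)]
        rw [setLIntegral_const, Real.volume_Icc, mul_assoc]
        congr 1
        rw [mul_comm]; norm_num

/-- A truncated, weakly singular weight. -/
def wt (α : ℝ) (z : Plane) : ℝ := (Metric.closedBall (0 : Plane) 2).indicator (fun z ↦ ‖z‖ ^ (α - 2)) z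

theorem wt_nonneg (α : ℝ) (z : Plane) : 0 ≤ wt α z :=
  Set.indicator_nonneg (fun _ _ ↦ by positivity) _

theorem measurable_wt (α : ℝ) : Measurable (wt α) :=
  (by fun_prop : Measurable fun z : Plane ↦ ‖z‖ ^ (α - 2)).indicator measurableSet_closedBall

theorem integrable_wt {α : ℝ} (hα : 0 < α) : Integrable (wt α) := by
  have e : wt α = fun z : Plane ↦ (Set.Iic (2:ℝ)).indicator (fun r ↦ r ^ (α - 2)) ‖z‖ := by
    ext z
    by_cases hz : ‖z‖ ≤ 2 <;> simp [wt, Set.indicator, hz]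
  rw [e, integrable_fun_norm_addHaar volume (f := (Set.Iic (2:ℝ)).indicator fun r ↦ r ^ (α - 2))]
  have h : IntegrableOn (fun r : ℝ ↦ r ^ (α - 1)) (Set.Ioc 0 2) :=
    (intervalIntegrable_iff_integrableOn_Ioc_of_le (by norm_num)).1
      (intervalIntegral.intervalIntegrable_rpow' (by linarith))
  rw [← integrable_indicator_iff measurableSet_Ioc] at h
  rw [← integrable_indicator_iff measurableSet_Ioi]
  convert h using 1
  ext r
  by_cases h0 : 0 < r
  · by_cases h2 : r ≤ 2
    · simp only [Set.indicator, Set.mem_Ioi, h0, Set.mem_Iic, h2, Set.mem_Ioc, and_self, if_true]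
      simp only [finrank_euclideanSpace, Fintype.card_fin, smul_eq_mul]
      rw [show α - 1 = α - 2 + 1 by ring, Real.rpow_add_one h0.ne']
      ring
    · simp [Set.indicator, h0, h2]
  · simp [Set.indicator, h0]

/-- The majorant of the directional derivatives of the rough singular integrals. -/
def majorant (α : ℝ) (f : Plane → ℝ) (x : Plane) : ℝ≥0∞ :=
  (∫⁻ ω : Metric.sphere (0 : Plane) 1, ‖dirHilbert f ω x‖ₑ ∂(volume : Measure Plane).toSphere)
    + (∫⁻ z, ‖f (x - z)‖ₑ * ‖wt α z‖ₑ) + ‖f x‖ₑ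

theorem measurable_majorant {α : ℝ} {f : Plane → ℝ} (hf : Measurable f) :
    Measurable (majorant α f) := by
  have hw := measurable_wt α
  refine Measurable.add (Measurable.add ?_ ?_) (by fun_prop)
  · refine Measurable.lintegral_prod_right'
      (f := fun q : Plane × Metric.sphere (0 : Plane) 1 ↦ ‖dirHilbert f q.2 q.1‖ₑ) ?_
    exact ((measurable_dirHilbert hf).comp (show Measurable fun q : Plane × Metric.sphere (0 : Plane) 1 ↦ ((q.2 : Plane), q.1) by fun_prop)).enorm
  · exact Measurable.lintegral_prod_right'
      (f := fun q : Plane × Plane ↦ ‖f (q.1 - q.2)‖ₑ * ‖wt α q.2‖ₑ) (by fun_prop)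

theorem exists_majorant_bound {p α : ℝ} (hp : 1 < p) (hα : 0 < α) : ∃ C : ℝ≥0∞, C ≠ ⊤ ∧
    ∀ (L : NNReal) (f : Plane → ℝ), LipschitzWith L f →
      ∫⁻ x, majorant α f x ^ p ≤ C * ∫⁻ x, ‖f x‖ₑ ^ p := by
  obtain ⟨C, hC, hCB⟩ := exists_dirHilbert_bound hp
  have hp0 : 0 < p := by linarith
  set S := (volume : Measure Plane).toSphere Set.univ with hS
  set W := ∫⁻ z, ‖wt α z‖ₑ with hW
  have hWt : W ≠ ⊤ := (integrable_wt hα).hasFiniteIntegral.ne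
  have hSt : S ≠ ⊤ := measure_ne_top _ _
  refine ⟨2 ^ (p - 1) * (2 ^ (p - 1) * (S ^ p * C + W ^ p) + 1), ?_, fun L f hf ↦ ?_⟩
  · have h2 : (2:ℝ≥0∞) ^ (p - 1) ≠ ⊤ := ENNReal.rpow_ne_top_of_nonneg (by linarith) (by simp)
    refine ENNReal.mul_ne_top h2 (ENNReal.add_ne_top.2 ⟨ENNReal.mul_ne_top h2
      (ENNReal.add_ne_top.2 ⟨ENNReal.mul_ne_top ?_ hC, ?_⟩), by simp⟩) <;>
    exact ENNReal.rpow_ne_top_of_nonneg hp0.le ‹_›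
  have hm : Measurable f := hf.continuous.measurable
  set I := ∫⁻ x, ‖f x‖ₑ ^ p with hI
  have hw := measurable_wt α
  have m1 : Measurable fun x ↦ ∫⁻ ω : Metric.sphere (0 : Plane) 1, ‖dirHilbert f ω x‖ₑ
      ∂(volume : Measure Plane).toSphere := by
    refine Measurable.lintegral_prod_right'
      (f := fun q : Plane × Metric.sphere (0 : Plane) 1 ↦ ‖dirHilbert f q.2 q.1‖ₑ) ?_
    exact ((measurable_dirHilbert hm).comp (show Measurable fun q : Plane × Metric.sphere (0 : Plane) 1 ↦ ((q.2 : Plane), q.1) by fun_prop)).enorm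
  have b1 : ∫⁻ x, (∫⁻ ω : Metric.sphere (0 : Plane) 1, ‖dirHilbert f ω x‖ₑ
      ∂(volume : Measure Plane).toSphere) ^ p ≤ S ^ p * (C * I) := by
    refine lintegral_rpow_lintegral_le hp
      (F := fun (ω : Metric.sphere (0 : Plane) 1) x ↦ ‖dirHilbert f ω x‖ₑ) ?_ fun ω ↦
        hCB L f hf ω (by simp)
    exact ((measurable_dirHilbert hm).comp
      (show Measurable fun q : Metric.sphere (0 : Plane) 1 × Plane ↦ ((q.1 : Plane), q.2) by
        fun_prop)).enorm
  have b2 : ∫⁻ x, (∫⁻ z, ‖f (x - z)‖ₑ * ‖wt α z‖ₑ) ^ p ≤ W ^ p * I :=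
    lintegral_rpow_convolution_le hp (F := fun x ↦ ‖f x‖ₑ) hm.enorm hw.enorm
  calc ∫⁻ x, majorant α f x ^ p
      ≤ ∫⁻ x, 2 ^ (p - 1) * (2 ^ (p - 1) * ((∫⁻ ω : Metric.sphere (0 : Plane) 1,
          ‖dirHilbert f ω x‖ₑ ∂(volume : Measure Plane).toSphere) ^ p
          + (∫⁻ z, ‖f (x - z)‖ₑ * ‖wt α z‖ₑ) ^ p) + ‖f x‖ₑ ^ p) := by
        refine lintegral_mono fun x ↦ (ENNReal.rpow_add_le_mul_rpow_add_rpow _ _ hp.le).trans ?_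
        gcongr
        exact ENNReal.rpow_add_le_mul_rpow_add_rpow _ _ hp.le
    _ = 2 ^ (p - 1) * (2 ^ (p - 1) * ((∫⁻ x, (∫⁻ ω : Metric.sphere (0 : Plane) 1,
          ‖dirHilbert f ω x‖ₑ ∂(volume : Measure Plane).toSphere) ^ p)
          + ∫⁻ x, (∫⁻ z, ‖f (x - z)‖ₑ * ‖wt α z‖ₑ) ^ p) + ∫⁻ x, ‖f x‖ₑ ^ p) := by
        rw [lintegral_const_mul' _ _ (ENNReal.rpow_ne_top_of_nonneg (by linarith) (by simp)),
          lintegral_add_right _ (by fun_prop),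
          lintegral_const_mul' _ _ (ENNReal.rpow_ne_top_of_nonneg (by linarith) (by simp)),
          lintegral_add_left (by fun_prop)]
    _ ≤ 2 ^ (p - 1) * (2 ^ (p - 1) * (S ^ p * (C * I) + W ^ p * I) + I) := by gcongr
    _ = _ := by ring

theorem integral_plane_polar {F : Plane → ℝ} (hF : Integrable F) :
    ∫ z, F z = ∫ ω : Metric.sphere (0 : Plane) 1, (∫ r in Set.Ioi (0:ℝ), r * F (r • (ω : Plane)))
      ∂(volume : Measure Plane).toSphere := by
  have hdim : Module.finrank ℝ Plane - 1 = 1 := by simp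
  have hmp := (volume : Measure Plane).measurePreserving_homeomorphUnitSphereProd
  have hemb := (homeomorphUnitSphereProd Plane).measurableEmbedding
  set G : Metric.sphere (0 : Plane) 1 × Set.Ioi (0:ℝ) → ℝ :=
    fun q ↦ F ((q.2 : ℝ) • (q.1 : Plane)) with hG
  have hGF : ∀ z : ({(0)}ᶜ : Set Plane), G (homeomorphUnitSphereProd Plane z) = F z := fun z ↦ by
    have hz : ‖(z : Plane)‖ ≠ 0 := norm_ne_zero_iff.2 z.2
    simp only [hG, homeomorphUnitSphereProd_apply_snd_coe, homeomorphUnitSphereProd_apply_fst_coe]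
    rw [smul_smul, mul_inv_cancel₀ hz, one_smul]
  have hFi : Integrable (fun z : ({(0)}ᶜ : Set Plane) ↦ F z)
      ((volume : Measure Plane).comap (Subtype.val : ({(0)}ᶜ : Set Plane) → Plane)) := by
    have := hF.integrableOn (s := ({(0)}ᶜ : Set Plane))
    rwa [integrableOn_iff_comap_subtypeVal (measurableSet_singleton _).compl] at this
  have hGi : Integrable G ((volume : Measure Plane).toSphere.prod
      (Measure.volumeIoiPow (Module.finrank ℝ Plane - 1))) := by
    rw [← hmp.integrable_comp_emb hemb]
    exact hFi.congr (Filter.Eventually.of_forall fun z ↦ (hGF z).symm)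
  calc ∫ z, F z = ∫ z : ({(0)}ᶜ : Set Plane), F z ∂((volume : Measure Plane).comap Subtype.val) := by
        rw [integral_subtype_comap (measurableSet_singleton _).compl fun x ↦ F x,
          restrict_compl_singleton]
    _ = ∫ z : ({(0)}ᶜ : Set Plane), G (homeomorphUnitSphereProd Plane z) ∂((volume : Measure Plane).comap Subtype.val) := by
        simp_rw [hGF]
    _ = ∫ q, G q ∂((volume : Measure Plane).toSphere.prod
          (Measure.volumeIoiPow (Module.finrank ℝ Plane - 1))) := hmp.integral_comp hemb _
    _ = _ := by
        rw [integral_prod _ hGi]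
        congr 1; ext ω
        simp only [Measure.volumeIoiPow, ENNReal.ofReal, hG]
        rw [integral_withDensity_eq_integral_smul,
          integral_subtype_comap measurableSet_Ioi fun a ↦
            Real.toNNReal (a ^ (Module.finrank ℝ Plane - 1)) • F (a • (ω : Plane)),
          setIntegral_congr_fun measurableSet_Ioi fun x hx ↦ ?_]
        · rw [NNReal.smul_def, Real.coe_toNNReal _ (pow_nonneg hx.out.le _), hdim, pow_one,
            smul_eq_mul]
        · exact (measurable_subtype_coe.pow_const _).real_toNNReal

theorem wt_of_norm_le {α : ℝ} {z : Plane} (hz : ‖z‖ ≤ 2) : wt α z = ‖z‖ ^ (α - 2) := by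
  simp [wt, hz]

/-- A measurable function on the plane bounded by a multiple of a weakly singular weight is
integrable. -/
theorem integrable_of_abs_le_wt {α : ℝ} (hα : 0 < α) {F : Plane → ℝ} (hF : Measurable F) {A : ℝ}
    (h : ∀ z, z ≠ 0 → |F z| ≤ A * wt α z) : Integrable F := by
  refine ((integrable_wt hα).const_mul A).mono' hF.aestronglyMeasurable ?_
  filter_upwards [Measure.ae_ne volume (0 : Plane)] with z hz
  exact h z hz

/-- The truncated singular integral with odd kernel `Θ`, homogeneous of degree `-2`,
is controlled by the directional Hilbert transforms (method of rotations). -/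
theorem enorm_integral_odd_kernel_le {f Θ : Plane → ℝ} {L : NNReal} (hf : LipschitzWith L f)
    (hΘ : Measurable Θ) {A : ℝ} (hodd : ∀ z, Θ (-z) = -Θ z)
    (hhom : ∀ (r : ℝ) (z : Plane), 0 < r → Θ (r • z) = r⁻¹ ^ 2 * Θ z)
    (hA : ∀ z : Plane, ‖z‖ = 1 → |Θ z| ≤ A) (x : Plane) :
    Integrable (fun z ↦ (f (x - z) - f x) * (Metric.closedBall 0 1).indicator Θ z) ∧
    ‖∫ z, (f (x - z) - f x) * (Metric.closedBall 0 1).indicator Θ z‖ₑ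
      ≤ ENNReal.ofReal A * ∫⁻ ω : Metric.sphere (0 : Plane) 1, ‖dirHilbert f ω x‖ₑ
        ∂(volume : Measure Plane).toSphere := by
  have hfm : Measurable f := hf.continuous.measurable
  have hA0 : 0 ≤ A := by
    obtain ⟨z, hz⟩ := exists_norm_eq Plane zero_le_one
    exact (abs_nonneg _).trans (hA z hz)
  set k := (Metric.closedBall (0 : Plane) 1).indicator Θ with hk
  have hkm : Measurable k := hΘ.indicator measurableSet_closedBall
  have hΘb : ∀ z, z ≠ 0 → |Θ z| ≤ A * ‖z‖⁻¹ ^ 2 := fun z hz ↦ by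
    have hz' : 0 < ‖z‖ := norm_pos_iff.2 hz
    have h1 : ‖‖z‖⁻¹ • z‖ = 1 := by
      rw [norm_smul, norm_inv, norm_norm, inv_mul_cancel₀ hz'.ne']
    have h2 : Θ z = ‖z‖⁻¹ ^ 2 * Θ (‖z‖⁻¹ • z) := by
      rw [← hhom _ _ hz', smul_smul, mul_inv_cancel₀ hz'.ne', one_smul]
    rw [h2, abs_mul, abs_of_nonneg (by positivity), mul_comm]
    gcongr
    exact hA _ h1
  have hkb : ∀ z, z ≠ 0 → |k z| ≤ A * ‖z‖⁻¹ ^ 2 ∧ (2 < ‖z‖ → k z = 0) := fun z hz ↦ by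
    by_cases h : z ∈ Metric.closedBall (0 : Plane) 1
    · rw [hk, Set.indicator_of_mem h]
      refine ⟨hΘb z hz, fun h2 ↦ ?_⟩
      have := mem_closedBall_zero_iff.1 h
      linarith
    · rw [hk, Set.indicator_of_notMem h, abs_zero]
      exact ⟨by positivity, fun _ ↦ rfl⟩
  have h_int : ∀ g : Plane → ℝ, Measurable g → (∀ z, |g z| ≤ 2 * L * ‖z‖) →
      Integrable fun z ↦ g z * k z := fun g hg hgb ↦ by
    refine integrable_of_abs_le_wt one_pos (hg.mul hkm) (A := 2 * L * A) fun z hz ↦ ?_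
    have hz' : 0 < ‖z‖ := norm_pos_iff.2 hz
    rcases le_or_gt ‖z‖ 2 with h2 | h2
    · rw [wt_of_norm_le h2, show (1:ℝ) - 2 = -1 by norm_num, Real.rpow_neg_one, abs_mul]
      calc |g z| * |k z| ≤ (2 * L * ‖z‖) * (A * ‖z‖⁻¹ ^ 2) := by
            gcongr
            exacts [hgb z, (hkb z hz).1]
        _ = 2 * L * A * ‖z‖⁻¹ := by field_simp
    · rw [(hkb z hz).2 h2, mul_zero, abs_zero]
      exact mul_nonneg (by positivity) (wt_nonneg _ _)
  have hd : ∀ y z : Plane, |f y - f z| ≤ L * ‖y - z‖ := fun y z ↦ by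
    simpa [Real.dist_eq, dist_eq_norm] using hf.dist_le_mul y z
  have i1 : Integrable fun z ↦ (f (x - z) - f x) * k z := h_int _ (by fun_prop) fun z ↦ by
    refine (hd _ _).trans ?_
    rw [sub_sub_cancel_left, norm_neg]
    linarith [mul_nonneg L.coe_nonneg (norm_nonneg z)]
  have i2 : Integrable fun z ↦ (f (x + z) - f x) * k z := h_int _ (by fun_prop) fun z ↦ by
    refine (hd _ _).trans ?_
    rw [add_sub_cancel_left]
    linarith [mul_nonneg L.coe_nonneg (norm_nonneg z)]
  have i3 : Integrable fun z ↦ (f (x - z) - f (x + z)) * k z := by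
    refine (i1.sub i2).congr (Filter.Eventually.of_forall fun z ↦ ?_)
    simp only [Pi.sub_apply]; ring
  refine ⟨i1, ?_⟩
  have hkodd : ∀ z, k (-z) = -k z := fun z ↦ by
    by_cases h : z ∈ Metric.closedBall (0 : Plane) 1
    · rw [hk, Set.indicator_of_mem h, Set.indicator_of_mem (by simpa using h), hodd]
    · rw [hk, Set.indicator_of_notMem h, Set.indicator_of_notMem (by simpa using h), neg_zero]
  have e1 : ∫ z, (f (x - z) - f x) * k z = 2⁻¹ * ∫ z, (f (x - z) - f (x + z)) * k z := by
    have : ∫ z, (f (x - z) - f x) * k z = -∫ z, (f (x + z) - f x) * k z := by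
      rw [← integral_neg_eq_self, ← integral_neg]
      congr 1; ext z
      rw [sub_neg_eq_add, hkodd]; ring
    have h2 : ∫ z, (f (x - z) - f (x + z)) * k z
        = (∫ z, (f (x - z) - f x) * k z) - ∫ z, (f (x + z) - f x) * k z := by
      rw [← integral_sub i1 i2]
      congr 1; ext z; ring
    rw [h2]; linarith
  have e2 : ∀ ω : Metric.sphere (0 : Plane) 1,
      ∫ r in Set.Ioi (0:ℝ), r * ((f (x - r • (ω : Plane)) - f (x + r • (ω : Plane)))
        * k (r • (ω : Plane))) = Θ ω * dirHilbert f ω x := fun ω ↦ by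
    have hω : ‖(ω : Plane)‖ = 1 := by simp
    rw [dirHilbert, ← integral_const_mul, ← integral_indicator measurableSet_Ioi,
      ← integral_indicator measurableSet_Ioc]
    congr 1; ext r
    by_cases h0 : 0 < r
    · have hn : ‖r • (ω : Plane)‖ = r := by rw [norm_smul, hω, mul_one, Real.norm_of_nonneg h0.le]
      by_cases h1 : r ≤ 1
      · rw [Set.indicator_of_mem (Set.mem_Ioi.2 h0), Set.indicator_of_mem (show r ∈ Set.Ioc (0:ℝ) 1 from ⟨h0, h1⟩),
          hk, Set.indicator_of_mem (by simpa [hn] using h1), hhom _ _ h0]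
        field_simp
      · rw [Set.indicator_of_mem (Set.mem_Ioi.2 h0), Set.indicator_of_notMem (fun h ↦ h1 h.2), hk,
          Set.indicator_of_notMem (by simpa [hn] using h1)]
        ring
    · rw [Set.indicator_of_notMem (by simpa using h0), Set.indicator_of_notMem (fun h ↦ h0 h.1)]
  rw [e1, integral_plane_polar i3]
  simp_rw [e2]
  rw [enorm_mul, ← lintegral_const_mul' _ _ ENNReal.ofReal_ne_top]
  refine (mul_le_of_le_one_left zero_le ?_).trans
    ((enorm_integral_le_lintegral_enorm _).trans (lintegral_mono fun ω ↦ ?_))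
  · rw [Real.enorm_of_nonneg (by norm_num), ENNReal.ofReal_le_one]; norm_num
  · rw [enorm_mul]
    gcongr
    rw [Real.enorm_eq_ofReal_abs]
    exact ENNReal.ofReal_le_ofReal (hA _ (by simp))

/-- A regularising factor vanishing to second order at the origin. -/
def puncture (ε : ℝ) (z : Plane) : ℝ := ‖z‖ ^ 2 / (‖z‖ ^ 2 + ε ^ 2)

theorem exists_hasFDerivAt_puncture {ε : ℝ} (hε : 0 < ε) (z : Plane) :
    ∃ D : Plane →L[ℝ] ℝ, HasFDerivAt (puncture ε) D z ∧
      ∀ v, |D v| ≤ 2 * ‖v‖ * (ε ^ 2 * ‖z‖ / (‖z‖ ^ 2 + ε ^ 2) ^ 2) := by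
  have hd : 0 < ‖z‖ ^ 2 + ε ^ 2 := by positivity
  have h1 : HasFDerivAt (fun z : Plane ↦ ‖z‖ ^ 2) (2 • (innerSL ℝ z)) z :=
    (hasStrictFDerivAt_norm_sq z).hasFDerivAt
  have h2 : HasDerivAt (fun t : ℝ ↦ t / (t + ε ^ 2)) (ε ^ 2 / (‖z‖ ^ 2 + ε ^ 2) ^ 2) (‖z‖ ^ 2) := by
    refine ((hasDerivAt_id _).fun_div ((hasDerivAt_id _).add_const (ε ^ 2)) hd.ne').congr_deriv ?_
    simp
  have h4 := h2.comp_hasFDerivAt z h1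
  refine ⟨_, h4, fun v ↦ ?_⟩
  have h3 : |inner ℝ z v| ≤ ‖z‖ * ‖v‖ := abs_real_inner_le_norm z v
  simp only [smul_apply, innerSL_apply_apply, smul_eq_mul, nsmul_eq_mul, Nat.cast_ofNat]
  rw [abs_mul, abs_mul, abs_two, abs_of_nonneg (a := ε ^ 2 / _) (by positivity)]
  calc ε ^ 2 / (‖z‖ ^ 2 + ε ^ 2) ^ 2 * (2 * |inner ℝ z v|)
      ≤ ε ^ 2 / (‖z‖ ^ 2 + ε ^ 2) ^ 2 * (2 * (‖z‖ * ‖v‖)) := by gcongr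
    _ = _ := by ring

theorem abs_puncture_le (ε : ℝ) (z : Plane) : |puncture ε z| ≤ 1 := by
  rw [puncture, abs_of_nonneg (by positivity)]
  exact div_le_one_of_le₀ (by nlinarith [sq_nonneg ε]) (by positivity)

/-- The integral of a directional derivative vanishes, for a bounded compactly supported function
whose derivative is weakly singular at the origin. -/
theorem integral_fderiv_eq_zero {u : Plane → ℝ} (hu : Measurable u) {A : ℝ} (v : Plane)
    (hd : ∀ z, z ≠ 0 → DifferentiableAt ℝ u z) (hA : ∀ z, |u z| ≤ A)
    (hsupp : ∀ z, 2 < ‖z‖ → u z = 0)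
    (hB : ∀ z, z ≠ 0 → |fderiv ℝ u z v| ≤ A * wt 1 z) :
    ∫ z, fderiv ℝ u z v = 0 := by
  have hA0 : 0 ≤ A := (abs_nonneg _).trans (hA 0)
  have hsing : ∀ z : Plane, z ≠ 0 → ‖z‖ ≤ 2 → wt 1 z = ‖z‖⁻¹ := fun z _ h ↦ by
    rw [wt_of_norm_le h, show (1:ℝ) - 2 = -1 by norm_num, Real.rpow_neg_one]
  have hw0 : ∀ ε : ℝ, 0 < ε → HasFDerivAt (fun z ↦ puncture ε z * u z) (0 : Plane →L[ℝ] ℝ) 0 := by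
    intro ε hε
    rw [hasFDerivAt_iff_isLittleO_nhds_zero]
    refine Asymptotics.IsBigO.trans_isLittleO (g := fun z : Plane ↦ ‖z‖ ^ 2) ?_ ?_
    · refine Asymptotics.IsBigO.of_bound (A / ε ^ 2) (Filter.Eventually.of_forall fun z ↦ ?_)
      simp only [zero_add, puncture, norm_zero, zero_apply, sub_zero]
      rw [show (0:ℝ) ^ 2 / (0 ^ 2 + ε ^ 2) * u 0 = 0 by simp, sub_zero, norm_mul,
        Real.norm_of_nonneg (show 0 ≤ ‖z‖ ^ 2 / (‖z‖ ^ 2 + ε ^ 2) by positivity),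
        Real.norm_of_nonneg (sq_nonneg ‖z‖), Real.norm_eq_abs]
      calc ‖z‖ ^ 2 / (‖z‖ ^ 2 + ε ^ 2) * |u z| ≤ ‖z‖ ^ 2 / (0 + ε ^ 2) * A := by
            gcongr
            exacts [by positivity, hA z]
        _ = _ := by ring
    · simpa using (Asymptotics.isLittleO_norm_pow_id (E' := Plane) one_lt_two)
  have hw : ∀ ε : ℝ, 0 < ε → ∀ z, z ≠ 0 → ∃ D : Plane →L[ℝ] ℝ,
      HasFDerivAt (fun z ↦ puncture ε z * u z) (puncture ε z • fderiv ℝ u z + u z • D) z ∧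
      ∀ v, |D v| ≤ 2 * ‖v‖ * (ε ^ 2 * ‖z‖ / (‖z‖ ^ 2 + ε ^ 2) ^ 2) := by
    intro ε hε z hz
    obtain ⟨D, hD, hDv⟩ := exists_hasFDerivAt_puncture hε z
    exact ⟨D, hD.mul (hd z hz).hasFDerivAt, hDv⟩
  have hdw : ∀ ε : ℝ, 0 < ε → Differentiable ℝ fun z ↦ puncture ε z * u z := fun ε hε z ↦ by
    rcases eq_or_ne z 0 with rfl | hz
    · exact (hw0 ε hε).differentiableAt
    · exact (hw ε hε z hz).choose_spec.1.differentiableAt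
  have hbound : ∀ ε : ℝ, 0 < ε → ∀ z, z ≠ 0 →
      |fderiv ℝ (fun z ↦ puncture ε z * u z) z v| ≤ (A + 2 * ‖v‖ * A) * wt 1 z := by
    intro ε hε z hz
    obtain ⟨D, hD, hDv⟩ := hw ε hε z hz
    have hz' : 0 < ‖z‖ := norm_pos_iff.2 hz
    rw [hD.fderiv]
    simp only [add_apply, smul_apply, smul_eq_mul]
    refine (abs_add_le _ _).trans ?_
    rw [abs_mul, abs_mul, add_mul]
    refine add_le_add ?_ ?_
    · exact (mul_le_of_le_one_left (abs_nonneg _) (abs_puncture_le _ _)).trans (hB z hz)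
    · rcases le_or_gt ‖z‖ 2 with h2 | h2
      · rw [hsing z hz h2]
        calc |u z| * |D v| ≤ A * (2 * ‖v‖ * (ε ^ 2 * ‖z‖ / (‖z‖ ^ 2 + ε ^ 2) ^ 2)) := by
              gcongr
              exacts [hA z, hDv v]
          _ ≤ A * (2 * ‖v‖ * ‖z‖⁻¹) := by
              gcongr
              rw [inv_eq_one_div, div_le_div_iff₀ (by positivity) hz']
              nlinarith [sq_nonneg (‖z‖ ^ 2), sq_nonneg (ε ^ 2), sq_nonneg (‖z‖ * ε)]
          _ = _ := by ring
      · rw [hsupp z h2, abs_zero, zero_mul]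
        exact mul_nonneg (by positivity) (wt_nonneg _ _)
  have hzero : ∀ ε : ℝ, 0 < ε → ∫ z, fderiv ℝ (fun z ↦ puncture ε z * u z) z v = 0 := by
    intro ε hε
    have h_int : Integrable fun z ↦ fderiv ℝ (fun z ↦ puncture ε z * u z) z v :=
      integrable_of_abs_le_wt one_pos (measurable_fderiv_apply_const ℝ _ v) (hbound ε hε)
    have h_int2 : Integrable fun z ↦ puncture ε z * u z := by
      refine integrable_of_abs_le_wt (α := 1) one_pos ?_ (A := 2 * A) fun z hz ↦ ?_
      · unfold puncture; fun_prop
      · rcases le_or_gt ‖z‖ 2 with h2 | h2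
        · have hz' : 0 < ‖z‖ := norm_pos_iff.2 hz
          rw [hsing z hz h2, abs_mul]
          have : 1 ≤ 2 * ‖z‖⁻¹ := by
            rw [← div_eq_mul_inv, le_div_iff₀ hz']; linarith
          calc |puncture ε z| * |u z| ≤ 1 * A := by
                gcongr
                exacts [abs_puncture_le _ _, hA z]
            _ ≤ 2 * A * ‖z‖⁻¹ := by nlinarith
        · rw [hsupp z h2, mul_zero, abs_zero]
          exact mul_nonneg (by positivity) (wt_nonneg _ _)
    have := integral_mul_fderiv_eq_neg_fderiv_mul_of_integrable (μ := (volume : Measure Plane))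
      (𝕜 := ℝ) (f := fun _ ↦ (1:ℝ)) (g := fun z ↦ puncture ε z * u z) (v := v) (by simp)
      (by simpa using h_int) (by simpa using h_int2) (fun x _ ↦ differentiableAt_const _)
      (fun x _ ↦ hdw ε hε x)
    simpa using this
  have hlim : Filter.Tendsto (fun n : ℕ ↦
      ∫ z, fderiv ℝ (fun z ↦ puncture (1 / ((n:ℝ) + 1)) z * u z) z v) Filter.atTop
      (nhds (∫ z, fderiv ℝ u z v)) := by
    refine tendsto_integral_of_dominated_convergence (fun z ↦ (A + 2 * ‖v‖ * A) * wt 1 z) ?_ ?_ ?_ ?_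
    · exact fun n ↦ (measurable_fderiv_apply_const ℝ _ v).aestronglyMeasurable
    · exact (integrable_wt one_pos).const_mul _
    · intro n
      filter_upwards [Measure.ae_ne volume (0 : Plane)] with z hz
      exact hbound _ Nat.one_div_pos_of_nat z hz
    · filter_upwards [Measure.ae_ne volume (0 : Plane)] with z hz
      have hz' : 0 < ‖z‖ := norm_pos_iff.2 hz
      choose D hD hDv using fun n : ℕ ↦ hw (1 / ((n:ℝ) + 1)) Nat.one_div_pos_of_nat z hz
      simp_rw [fun n ↦ (hD n).fderiv]
      simp only [add_apply, smul_apply, smul_eq_mul]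
      have ht := tendsto_one_div_add_atTop_nhds_zero_nat (𝕜 := ℝ)
      have t1 : Filter.Tendsto (fun n : ℕ ↦ puncture (1 / ((n:ℝ) + 1)) z) Filter.atTop (nhds 1) := by
        have : Filter.Tendsto (fun n : ℕ ↦ puncture (1 / ((n:ℝ) + 1)) z) Filter.atTop
            (nhds (‖z‖ ^ 2 / (‖z‖ ^ 2 + 0 ^ 2))) :=
          tendsto_const_nhds.div (tendsto_const_nhds.add (ht.pow 2)) (by positivity)
        simpa [hz'.ne'] using this
      have t2 : Filter.Tendsto (fun n : ℕ ↦ D n v) Filter.atTop (nhds 0) := by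
        refine squeeze_zero_norm (fun n ↦ hDv n v) ?_
        have : Filter.Tendsto (fun n : ℕ ↦ 2 * ‖v‖ * ((1 / ((n:ℝ) + 1)) ^ 2 * ‖z‖
            / (‖z‖ ^ 2 + (1 / ((n:ℝ) + 1)) ^ 2) ^ 2)) Filter.atTop
            (nhds (2 * ‖v‖ * (0 ^ 2 * ‖z‖ / (‖z‖ ^ 2 + 0 ^ 2) ^ 2))) :=
          (((ht.pow 2).mul_const _).div ((tendsto_const_nhds.add (ht.pow 2)).pow 2)
            (by positivity)).const_mul _
        simpa using this
      simpa using (t1.mul_const (fderiv ℝ u z v)).add (t2.const_mul (u z))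
  refine tendsto_nhds_unique hlim ?_
  simp_rw [fun n : ℕ ↦ hzero (1 / ((n:ℝ) + 1)) Nat.one_div_pos_of_nat]
  exact tendsto_const_nhds

theorem wt_one_of_norm_le {z : Plane} (hz : ‖z‖ ≤ 2) : wt 1 z = ‖z‖⁻¹ := by
  rw [wt_of_norm_le hz, show (1:ℝ) - 2 = -1 by norm_num, Real.rpow_neg_one]

theorem fderiv_eq_zero_of_two_lt_norm {K : Plane → ℝ} (hsupp : ∀ z, 2 < ‖z‖ → K z = 0) {z : Plane}
    (hz : 2 < ‖z‖) : fderiv ℝ K z = 0 := by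
  have : K =ᶠ[nhds z] fun _ ↦ 0 := by
    filter_upwards [continuous_norm.continuousAt.eventually_const_lt hz] with w hw using hsupp w hw
  rw [this.fderiv_eq, fderiv_fun_const, Pi.zero_apply]

/-- Integration by parts against a kernel of order `-1` at the origin. -/
theorem integral_fderiv_mul_kernel {f K : Plane → ℝ} {L : NNReal} (hf : LipschitzWith L f)
    (hfd : Differentiable ℝ f) (hK : Measurable K) (hKd : ∀ z, z ≠ 0 → DifferentiableAt ℝ K z)
    {A : ℝ} (hKA : ∀ z, z ≠ 0 → ‖z‖ ≤ 2 → |K z| ≤ A * ‖z‖⁻¹) (hsupp : ∀ z, 2 < ‖z‖ → K z = 0)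
    (v : Plane) (hK' : ∀ z, z ≠ 0 → ‖z‖ ≤ 2 → |fderiv ℝ K z v| ≤ A * ‖z‖⁻¹ ^ 2) (x : Plane) :
    Integrable (fun z ↦ fderiv ℝ f (x - z) v * K z) ∧
    Integrable (fun z ↦ (f (x - z) - f x) * fderiv ℝ K z v) ∧
    ∫ z, fderiv ℝ f (x - z) v * K z = ∫ z, (f (x - z) - f x) * fderiv ℝ K z v := by
  have hA0 : 0 ≤ A := by
    obtain ⟨z, hz⟩ := exists_norm_eq Plane zero_le_one
    have := (abs_nonneg _).trans (hKA z (by rintro rfl; simp at hz) (by linarith))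
    simpa [hz] using this
  have hL : ∀ z, |f (x - z) - f x| ≤ L * ‖z‖ := fun z ↦ by
    simpa [Real.norm_eq_abs] using hf.norm_sub_le (x - z) x
  have hL' : ∀ z, |fderiv ℝ f z v| ≤ L * ‖v‖ := fun z ↦
    ((fderiv ℝ f z).le_opNorm v).trans (by gcongr; exact norm_fderiv_le_of_lipschitz ℝ hf)
  have hb1 : ∀ z, z ≠ 0 → |fderiv ℝ f (x - z) v * K z| ≤ (L * ‖v‖ * A) * wt 1 z := fun z hz ↦ by
    rcases le_or_gt ‖z‖ 2 with h2 | h2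
    · rw [abs_mul, wt_one_of_norm_le h2, mul_assoc]
      exact mul_le_mul (hL' _) (hKA z hz h2) (abs_nonneg _) (by positivity)
    · rw [hsupp z h2, mul_zero, abs_zero]
      exact mul_nonneg (by positivity) (wt_nonneg _ _)
  have hb2 : ∀ z, z ≠ 0 → |(f (x - z) - f x) * fderiv ℝ K z v| ≤ (L * A) * wt 1 z := fun z hz ↦ by
    rcases le_or_gt ‖z‖ 2 with h2 | h2
    · have hz' : 0 < ‖z‖ := norm_pos_iff.2 hz
      rw [abs_mul, wt_one_of_norm_le h2]
      calc _ ≤ (L * ‖z‖) * (A * ‖z‖⁻¹ ^ 2) :=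
            mul_le_mul (hL _) (hK' z hz h2) (abs_nonneg _) (by positivity)
        _ = _ := by field_simp
    · rw [fderiv_eq_zero_of_two_lt_norm hsupp h2, zero_apply, mul_zero, abs_zero]
      exact mul_nonneg (by positivity) (wt_nonneg _ _)
  have hfc : Continuous f := hf.continuous
  have hmf : Measurable fun z ↦ fderiv ℝ f (x - z) v :=
    (measurable_fderiv_apply_const ℝ f v).comp (measurable_const.sub measurable_id)
  have hm1 : Measurable fun z ↦ fderiv ℝ f (x - z) v * K z := hmf.mul hK
  have hm2 : Measurable fun z ↦ (f (x - z) - f x) * fderiv ℝ K z v :=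
    (hfc.measurable.comp (measurable_const.sub measurable_id)).sub_const _ |>.mul
      (measurable_fderiv_apply_const ℝ K v)
  have hi1 := integrable_of_abs_le_wt one_pos hm1 hb1
  have hi2 := integrable_of_abs_le_wt one_pos hm2 hb2
  refine ⟨hi1, hi2, ?_⟩
  have hud : ∀ z, z ≠ 0 → HasFDerivAt (fun z ↦ (f (x - z) - f x) * K z)
      ((f (x - z) - f x) • fderiv ℝ K z + K z • (-fderiv ℝ f (x - z))) z := fun z hz ↦ by
    have h1 : HasFDerivAt (fun z ↦ f (x - z) - f x) (-fderiv ℝ f (x - z)) z := by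
      have := ((hfd (x - z)).hasFDerivAt.comp z ((hasFDerivAt_id z).const_sub x)).sub_const (f x)
      refine this.congr_fderiv ?_
      ext w; simp
    exact h1.mul (hKd z hz).hasFDerivAt
  have hue : ∀ z, z ≠ 0 → fderiv ℝ (fun z ↦ (f (x - z) - f x) * K z) z v =
      (f (x - z) - f x) * fderiv ℝ K z v - fderiv ℝ f (x - z) v * K z := fun z hz ↦ by
    rw [(hud z hz).fderiv]
    simp only [add_apply, smul_apply, neg_apply, smul_eq_mul]
    ring
  have key := integral_fderiv_eq_zero (u := fun z ↦ (f (x - z) - f x) * K z)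
    (A := L * A + L * ‖v‖ * A) ?_ v (fun z hz ↦ (hud z hz).differentiableAt) ?_ ?_ ?_
  · have hae : (fun z ↦ fderiv ℝ (fun z ↦ (f (x - z) - f x) * K z) z v) =ᵐ[volume]
        fun z ↦ (f (x - z) - f x) * fderiv ℝ K z v - fderiv ℝ f (x - z) v * K z := by
      filter_upwards [Measure.ae_ne volume (0 : Plane)] with z hz using hue z hz
    rw [integral_congr_ae hae, integral_sub hi2 hi1, sub_eq_zero] at key
    exact key.symm
  · exact ((hfc.measurable.comp (measurable_const.sub measurable_id)).sub_const _).mul hK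
  · intro z
    rcases eq_or_ne z 0 with rfl | hz
    · simp; positivity
    rcases le_or_gt ‖z‖ 2 with h2 | h2
    · have hz' : 0 < ‖z‖ := norm_pos_iff.2 hz
      rw [abs_mul]
      calc _ ≤ (L * ‖z‖) * (A * ‖z‖⁻¹) :=
            mul_le_mul (hL _) (hKA z hz h2) (abs_nonneg _) (by positivity)
        _ = L * A + 0 := by field_simp; simp
        _ ≤ _ := by gcongr; positivity
    · rw [hsupp z h2, mul_zero, abs_zero]; positivity
  · intro z h2
    simp [hsupp z h2]
  · intro z hz
    rw [hue z hz, add_mul]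
    exact (abs_sub _ _).trans (add_le_add (hb2 z hz) (hb1 z hz))

theorem abs_prod_le_prod {ι : Type*} {s : Finset ι} {a G : ι → ℝ} (h : ∀ i ∈ s, |a i| ≤ G i) :
    |∏ i ∈ s, a i| ≤ ∏ i ∈ s, G i := by
  rw [Finset.abs_prod]
  exact Finset.prod_le_prod (fun i _ ↦ abs_nonneg _) h

theorem abs_prod_sub_prod_le {ι : Type*} [DecidableEq ι] {s : Finset ι} {a b G : ι → ℝ} {ε : ℝ}
    (ha : ∀ i ∈ s, |a i| ≤ G i) (hb : ∀ i ∈ s, |b i| ≤ G i)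
    (hab : ∀ i ∈ s, |a i - b i| ≤ ε * G i) :
    |∏ i ∈ s, a i - ∏ i ∈ s, b i| ≤ s.card * ε * ∏ i ∈ s, G i := by
  induction s using Finset.induction_on with
  | empty => simp
  | insert i s hi ih =>
    simp only [Finset.forall_mem_insert] at ha hb hab
    rw [Finset.prod_insert hi, Finset.prod_insert hi, Finset.prod_insert hi,
      Finset.card_insert_of_notMem hi]
    have h1 := ih ha.2 hb.2 hab.2
    have h2 := abs_prod_le_prod hb.2
    have h3 := (abs_nonneg _).trans ha.1
    have h4 := (abs_nonneg _).trans hab.1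
    calc |a i * ∏ i ∈ s, a i - b i * ∏ i ∈ s, b i|
        = |a i * (∏ i ∈ s, a i - ∏ i ∈ s, b i) + (a i - b i) * ∏ i ∈ s, b i| := by ring_nf
      _ ≤ |a i| * |∏ i ∈ s, a i - ∏ i ∈ s, b i| + |a i - b i| * |∏ i ∈ s, b i| := by
          rw [← abs_mul, ← abs_mul]; exact abs_add_le _ _
      _ ≤ G i * (s.card * ε * ∏ i ∈ s, G i) + ε * G i * ∏ i ∈ s, G i := by
          gcongr
          · exact ha.1
          · exact hab.1
      _ = _ := by push_cast; ring

/-- The polynomial expression governing the derivative of a product of difference quotients times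
a homogeneous kernel. -/
def kernelPoly {ι : Type*} [Fintype ι] [DecidableEq ι] (a b : ι → ℝ) (s : ℝ) : ℝ :=
  ∑ i, b i * ∏ j ∈ Finset.univ.erase i, a j - (Fintype.card ι + 1) * s * ∏ j, a j

section kernelPoly
variable {ι : Type*} [Fintype ι] [DecidableEq ι] {a b a' b' G : ι → ℝ} {s ε : ℝ}

theorem abs_kernelPoly_le (ha : ∀ i, |a i| ≤ G i) (hb : ∀ i, |b i| ≤ G i) (hs : |s| ≤ 1) :
    |kernelPoly a b s| ≤ (2 * Fintype.card ι + 1) * ∏ i, G i := by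
  have hG : ∀ i, 0 ≤ G i := fun i ↦ (abs_nonneg _).trans (ha i)
  have hP : 0 ≤ ∏ i, G i := Finset.prod_nonneg fun i _ ↦ hG i
  have h1 : |∑ i, b i * ∏ j ∈ Finset.univ.erase i, a j| ≤ ∑ i : ι, ∏ j, G j := by
    refine (Finset.abs_sum_le_sum_abs _ _).trans (Finset.sum_le_sum fun i _ ↦ ?_)
    rw [abs_mul, ← Finset.mul_prod_erase Finset.univ G (Finset.mem_univ i)]
    exact mul_le_mul (hb i) (abs_prod_le_prod fun j _ ↦ ha j) (abs_nonneg _) (hG i)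
  have h2 : |(Fintype.card ι + 1) * s * ∏ j, a j| ≤ (Fintype.card ι + 1) * 1 * ∏ j, G j := by
    rw [abs_mul, abs_mul, abs_of_nonneg (a := (Fintype.card ι + 1 : ℝ)) (by positivity)]
    gcongr
    exact abs_prod_le_prod fun j _ ↦ ha j
  refine (abs_sub _ _).trans ((add_le_add h1 h2).trans (le_of_eq ?_))
  simp
  ring

theorem abs_kernelPoly_sub_le (ha : ∀ i, |a i| ≤ G i) (hb : ∀ i, |b i| ≤ G i)
    (ha' : ∀ i, |a' i| ≤ G i) (hε : 0 ≤ ε)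
    (haa : ∀ i, |a i - a' i| ≤ ε * G i) (hbb : ∀ i, |b i - b' i| ≤ ε * G i) (hs : |s| ≤ 1) :
    |kernelPoly a b s - kernelPoly a' b' s| ≤
      2 * (Fintype.card ι + 1) ^ 2 * ε * ∏ i, G i := by
  have hG : ∀ i, 0 ≤ G i := fun i ↦ (abs_nonneg _).trans (ha i)
  have hP : 0 ≤ ∏ i, G i := Finset.prod_nonneg fun i _ ↦ hG i
  set N : ℝ := (Fintype.card ι : ℝ) with hN
  have hN0 : 0 ≤ N := Nat.cast_nonneg _
  have h1 : |∑ i, b i * ∏ j ∈ Finset.univ.erase i, a j -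
      ∑ i, b' i * ∏ j ∈ Finset.univ.erase i, a' j| ≤ ∑ i : ι, (N + 1) * ε * ∏ j, G j := by
    rw [← Finset.sum_sub_distrib]
    refine (Finset.abs_sum_le_sum_abs _ _).trans (Finset.sum_le_sum fun i _ ↦ ?_)
    have h3 := abs_prod_sub_prod_le (s := Finset.univ.erase i) (fun j _ ↦ ha j)
      (fun j _ ↦ ha' j) (fun j _ ↦ haa j)
    have h4 : ((Finset.univ.erase i).card : ℝ) ≤ N := by
      rw [hN]; exact_mod_cast Finset.card_le_univ _
    have h5 := abs_prod_le_prod (s := Finset.univ.erase i) (fun j _ ↦ ha' j)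
    have h6 : 0 ≤ ∏ j ∈ Finset.univ.erase i, G j := Finset.prod_nonneg fun i _ ↦ hG i
    rw [← Finset.mul_prod_erase Finset.univ G (Finset.mem_univ i)]
    calc _ = |b i * (∏ j ∈ Finset.univ.erase i, a j - ∏ j ∈ Finset.univ.erase i, a' j) +
          (b i - b' i) * ∏ j ∈ Finset.univ.erase i, a' j| := by ring_nf
      _ ≤ |b i| * |∏ j ∈ Finset.univ.erase i, a j - ∏ j ∈ Finset.univ.erase i, a' j| +
          |b i - b' i| * |∏ j ∈ Finset.univ.erase i, a' j| := by
            rw [← abs_mul, ← abs_mul]; exact abs_add_le _ _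
      _ ≤ G i * (N * ε * ∏ j ∈ Finset.univ.erase i, G j) +
          (ε * G i) * ∏ j ∈ Finset.univ.erase i, G j := by
            have := hG i
            have := hb i
            have := hbb i
            gcongr
            exact h3.trans (by gcongr)
      _ = _ := by ring
  have h2 : |(N + 1) * s * ∏ j, a j - (N + 1) * s * ∏ j, a' j| ≤
      (N + 1) * 1 * (N * ε * ∏ j, G j) := by
    rw [← mul_sub, abs_mul, abs_mul, abs_of_nonneg (a := N + 1) (by positivity)]
    gcongr
    exact abs_prod_sub_prod_le (fun j _ ↦ ha j) (fun j _ ↦ ha' j) (fun j _ ↦ haa j)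
  have e : kernelPoly a b s - kernelPoly a' b' s = (∑ i, b i * ∏ j ∈ Finset.univ.erase i, a j -
      ∑ i, b' i * ∏ j ∈ Finset.univ.erase i, a' j) -
      ((N + 1) * s * ∏ j, a j - (N + 1) * s * ∏ j, a' j) := by
    simp only [kernelPoly]; ring
  rw [e]
  refine (abs_sub _ _).trans ((add_le_add h1 h2).trans ?_)
  simp only [Finset.sum_const, Finset.card_univ, nsmul_eq_mul, ← hN]
  have : 0 ≤ ε * ∏ j, G j := by positivity
  nlinarith

theorem kernelPoly_neg (hN : Even (Fintype.card ι)) :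
    kernelPoly (fun i ↦ -a i) b (-s) = -kernelPoly a b s := by
  simp only [kernelPoly, Finset.prod_neg, Finset.card_univ, hN.neg_one_pow, one_mul]
  rw [neg_sub', ← Finset.sum_neg_distrib]
  congr 1
  · refine Finset.sum_congr rfl fun i _ ↦ ?_
    have : Odd (Finset.univ.erase i).card := by
      rw [Finset.card_erase_of_mem (Finset.mem_univ i), Finset.card_univ]
      exact Nat.Even.sub_odd (Fintype.card_pos_iff.2 ⟨i⟩) hN odd_one
    rw [this.neg_one_pow]
    ring
  · ring

end kernelPoly

/-- A cutoff function at unit scale, with gradient bounded by `L`. -/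
structure IsCutoff (χ : Plane → ℝ) (L : ℝ) : Prop where
  differentiable : Differentiable ℝ χ
  mem_Icc : ∀ z, χ z ∈ Set.Icc (0 : ℝ) 1
  eq_one : ∀ z, ‖z‖ ≤ 1 → χ z = 1
  eq_zero : ∀ z, 2 ≤ ‖z‖ → χ z = 0
  fderiv_le : ∀ z, ‖fderiv ℝ χ z‖ ≤ L

theorem IsCutoff.fderiv_eq_zero_of_le_one {χ : Plane → ℝ} {L : ℝ} (hχ : IsCutoff χ L) {z : Plane}
    (hz : ‖z‖ ≤ 1) : fderiv ℝ χ z = 0 :=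
  IsLocalMax.fderiv_eq_zero (Filter.Eventually.of_forall fun w ↦ by
    rw [hχ.eq_one z hz]; exact (hχ.mem_Icc w).2)

theorem IsCutoff.nonneg {χ : Plane → ℝ} {L : ℝ} (hχ : IsCutoff χ L) : 0 ≤ L :=
  (norm_nonneg _).trans (hχ.fderiv_le 0)

theorem IsCutoff.abs_le_one {χ : Plane → ℝ} {L : ℝ} (hχ : IsCutoff χ L) (z : Plane) : |χ z| ≤ 1 := by
  rw [abs_of_nonneg (hχ.mem_Icc z).1]; exact (hχ.mem_Icc z).2

section
variable {ι : Type*}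

/-- Lipschitz and `C^{1,α}` control of the `g i` near `x`. -/
structure LocalBound (α : ℝ) (g : ι → Plane → ℝ) (G : ι → ℝ) (x : Plane) : Prop where
  differentiable : ∀ i, Differentiable ℝ (g i)
  norm_le : ∀ i z, ‖z‖ ≤ 2 → ‖fderiv ℝ (g i) (x - z)‖ ≤ G i
  sub_le : ∀ i z, ‖z‖ ≤ 2 → ‖fderiv ℝ (g i) (x - z) - fderiv ℝ (g i) x‖ ≤ G i * ‖z‖ ^ α

section LocalBound
variable {α : ℝ} {g : ι → Plane → ℝ} {G : ι → ℝ} {x : Plane}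

theorem LocalBound.nonneg (h : LocalBound α g G x) (i : ι) : 0 ≤ G i :=
  (norm_nonneg _).trans (h.norm_le i 0 (by simp))

theorem LocalBound.norm_self_le (h : LocalBound α g G x) (i : ι) : ‖fderiv ℝ (g i) x‖ ≤ G i := by
  simpa using h.norm_le i 0 (by simp)

theorem LocalBound.abs_diff_le (h : LocalBound α g G x) (i : ι) {z : Plane} (hz : ‖z‖ ≤ 2) :
    |g i x - g i (x - z)| ≤ G i * ‖z‖ := by
  have := (convex_closedBall x 2).norm_image_sub_le_of_norm_fderiv_le (𝕜 := ℝ) (f := g i)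
    (C := G i) (x := x - z) (y := x) (fun y _ ↦ h.differentiable i y) (fun y hy ↦ ?_)
    (by simpa [dist_eq_norm] using hz) (by simp)
  · simpa using this
  · simpa using h.norm_le i (x - y) (by rw [norm_sub_rev]; simpa [dist_eq_norm] using hy)

theorem LocalBound.abs_diff_sub_le (hα : 0 ≤ α) (h : LocalBound α g G x) (i : ι) {z : Plane}
    (hz : ‖z‖ ≤ 2) :
    |g i x - g i (x - z) - fderiv ℝ (g i) x z| ≤ G i * ‖z‖ ^ α * ‖z‖ := by
  have := (convex_closedBall x ‖z‖).norm_image_sub_le_of_norm_fderiv_le' (𝕜 := ℝ) (f := g i)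
    (C := G i * ‖z‖ ^ α) (φ := fderiv ℝ (g i) x) (x := x - z) (y := x)
    (fun y _ ↦ h.differentiable i y) (fun y hy ↦ ?_) (by simp) (by simp)
  · simpa using this
  · have hy' : ‖x - y‖ ≤ ‖z‖ := by rw [norm_sub_rev]; simpa [dist_eq_norm] using hy
    have h2 := h.sub_le i (x - y) (hy'.trans hz)
    rw [sub_sub_cancel] at h2
    refine h2.trans ?_
    gcongr
    exact h.nonneg i

end LocalBound

theorem hasFDerivAt_inv_norm_pow (m : ℕ) {z : Plane} (hz : z ≠ 0) :
    HasFDerivAt (fun z : Plane ↦ (‖z‖ ^ m)⁻¹)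
      ((-(m : ℝ) * (‖z‖ ^ (m + 2))⁻¹) • innerSL ℝ z) z := by
  have hz' : 0 < ‖z‖ := norm_pos_iff.2 hz
  have h1 : HasFDerivAt (fun z : Plane ↦ ‖z‖) (‖z‖⁻¹ • innerSL ℝ z) z := by
    have h2 : HasFDerivAt (fun z : Plane ↦ ‖z‖ ^ 2) (2 • (innerSL ℝ z)) z :=
      (hasStrictFDerivAt_norm_sq z).hasFDerivAt
    have h3 := h2.sqrt (by positivity)
    simp only [Real.sqrt_sq (norm_nonneg _)] at h3
    refine h3.congr_fderiv ?_
    ext w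
    simp
    ring
  have h4 : HasDerivAt (fun t : ℝ ↦ (t ^ m)⁻¹) (-(m : ℝ) * (‖z‖ ^ (m + 1))⁻¹) ‖z‖ := by
    have := hasDerivAt_zpow (-(m : ℤ)) ‖z‖ (Or.inl hz'.ne')
    simp only [zpow_neg, zpow_natCast] at this
    refine this.congr_deriv ?_
    rw [show -(m : ℤ) - 1 = -((m + 1 : ℕ) : ℤ) by push_cast; ring, zpow_neg, zpow_natCast]
    push_cast
    ring
  have h5 := h4.comp_hasFDerivAt z h1
  refine h5.congr_fderiv ?_
  ext w
  simp
  field_simp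
  ring

variable [Fintype ι] [DecidableEq ι]

/-- The product of differences of `g` against the truncated kernel `‖z‖ ^ (-N-1)`. -/
def diffKernel (χ : Plane → ℝ) (g : ι → Plane → ℝ) (x z : Plane) : ℝ :=
  (∏ i, (g i x - g i (x - z))) * (χ z * (‖z‖ ^ (Fintype.card ι + 1))⁻¹)

/-- The homogeneous leading part of the derivative of `diffKernel`. -/
def leadingKernel (g : ι → Plane → ℝ) (x v z : Plane) : ℝ :=
  ‖z‖⁻¹ ^ 2 * kernelPoly (fun i ↦ ‖z‖⁻¹ * fderiv ℝ (g i) x z) (fun i ↦ fderiv ℝ (g i) x v)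
    (‖z‖⁻¹ * inner ℝ z v)

theorem hasFDerivAt_diffKernel {χ : Plane → ℝ} (hχ : Differentiable ℝ χ) {g : ι → Plane → ℝ}
    (hg : ∀ i, Differentiable ℝ (g i)) (x : Plane) {z : Plane} (hz : z ≠ 0) :
    ∃ D : Plane →L[ℝ] ℝ, HasFDerivAt (diffKernel χ g x) D z ∧ ∀ v, D v =
      ‖z‖⁻¹ ^ 2 * (χ z * kernelPoly (fun i ↦ ‖z‖⁻¹ * (g i x - g i (x - z)))
        (fun i ↦ fderiv ℝ (g i) (x - z) v) (‖z‖⁻¹ * inner ℝ z v)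
        + ‖z‖ * fderiv ℝ χ z v * ∏ i, (‖z‖⁻¹ * (g i x - g i (x - z)))) := by
  have hz' : 0 < ‖z‖ := norm_pos_iff.2 hz
  have h1 : ∀ i, HasFDerivAt (fun z ↦ g i x - g i (x - z)) (fderiv ℝ (g i) (x - z)) z := fun i ↦ by
    have := ((hg i (x - z)).hasFDerivAt.comp z ((hasFDerivAt_id z).const_sub x)).const_sub (g i x)
    refine this.congr_fderiv ?_
    ext w; simp
  have h2 := HasFDerivAt.finsetProd (u := Finset.univ) fun i _ ↦ h1 i
  have h3 := (hχ z).hasFDerivAt.mul (hasFDerivAt_inv_norm_pow (Fintype.card ι + 1) hz)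
  refine ⟨_, h2.mul h3, fun v ↦ ?_⟩
  simp only [add_apply, smul_apply, smul_eq_mul, innerSL_apply_apply, kernelPoly, sum_apply,
    Finset.prod_mul_distrib, Finset.prod_const, Finset.card_univ]
  have h4 : ∀ i ∈ (Finset.univ : Finset ι), fderiv ℝ (g i) (x - z) v * (‖z‖⁻¹ ^ (Finset.univ.erase i).card *
      ∏ j ∈ Finset.univ.erase i, (g j x - g j (x - z))) = ‖z‖ * ‖z‖⁻¹ ^ Fintype.card ι *
      ((∏ j ∈ Finset.univ.erase i, (g j x - g j (x - z))) * fderiv ℝ (g i) (x - z) v) := by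
    intro i _
    have : Fintype.card ι = (Finset.univ.erase i).card + 1 := by
      rw [Finset.card_erase_of_mem (Finset.mem_univ i), Finset.card_univ]
      have := Fintype.card_pos_iff.2 ⟨i⟩
      omega
    rw [this, pow_succ]
    field_simp
  rw [Finset.sum_congr rfl h4, ← Finset.mul_sum]
  generalize ∑ i, (∏ j ∈ Finset.univ.erase i, (g j x - g j (x - z))) * fderiv ℝ (g i) (x - z) v = S
  generalize ∏ i, (g i x - g i (x - z)) = P
  push_cast
  simp only [inv_pow, pow_succ]
  field_simp
  ring

end

section
variable {ι : Type*} {χ : Plane → ℝ} {L α : ℝ} {g : ι → Plane → ℝ}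
  {G : ι → ℝ} {x : Plane}

theorem abs_inner_le_of_norm_le_one {z v : Plane} (hv : ‖v‖ ≤ 1) :
    |‖z‖⁻¹ * inner ℝ z v| ≤ 1 := by
  rcases eq_or_ne z 0 with rfl | hz
  · simp
  have hz' : 0 < ‖z‖ := norm_pos_iff.2 hz
  rw [abs_mul, abs_inv, abs_norm, inv_mul_le_one₀ hz']
  exact (abs_real_inner_le_norm z v).trans (mul_le_of_le_one_right (norm_nonneg _) hv)

theorem LocalBound.abs_scaled_le (h : LocalBound α g G x) (i : ι) {z : Plane} (hz : z ≠ 0)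
    (hz2 : ‖z‖ ≤ 2) : |‖z‖⁻¹ * (g i x - g i (x - z))| ≤ G i := by
  have hz' : 0 < ‖z‖ := norm_pos_iff.2 hz
  rw [abs_mul, abs_inv, abs_norm, inv_mul_le_iff₀ hz', mul_comm]
  exact h.abs_diff_le i hz2

theorem LocalBound.abs_fderiv_scaled_le (h : LocalBound α g G x) (i : ι) (z : Plane) :
    |‖z‖⁻¹ * fderiv ℝ (g i) x z| ≤ G i := by
  rcases eq_or_ne z 0 with rfl | hz
  · simpa using h.nonneg i
  have hz' : 0 < ‖z‖ := norm_pos_iff.2 hz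
  rw [abs_mul, abs_inv, abs_norm, inv_mul_le_iff₀ hz', mul_comm]
  exact ((fderiv ℝ (g i) x).le_opNorm z).trans (by gcongr; exact h.norm_self_le i)

theorem abs_apply_le_of_norm_le {D : Plane →L[ℝ] ℝ} {c : ℝ} (h : ‖D‖ ≤ c) {v : Plane}
    (hv : ‖v‖ ≤ 1) : |D v| ≤ c :=
  (D.le_opNorm v).trans ((mul_le_of_le_one_right (norm_nonneg _) hv).trans h)

variable [Fintype ι]

theorem LocalBound.abs_diffKernel_le (h : LocalBound α g G x) (hχ : IsCutoff χ L) {z : Plane}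
    (hz : z ≠ 0) (hz2 : ‖z‖ ≤ 2) : |diffKernel χ g x z| ≤ (∏ i, G i) * ‖z‖⁻¹ := by
  have hz' : 0 < ‖z‖ := norm_pos_iff.2 hz
  have hG : 0 ≤ ∏ i, G i := Finset.prod_nonneg fun i _ ↦ h.nonneg i
  rw [diffKernel, abs_mul, abs_mul, abs_of_nonneg (a := (‖z‖ ^ (Fintype.card ι + 1))⁻¹) (by positivity)]
  have h1 : |∏ i, (g i x - g i (x - z))| ≤ ∏ i, (G i * ‖z‖) :=
    abs_prod_le_prod fun i _ ↦ h.abs_diff_le i hz2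
  rw [Finset.prod_mul_distrib, Finset.prod_const, Finset.card_univ] at h1
  calc _ ≤ ((∏ i, G i) * ‖z‖ ^ Fintype.card ι) * (1 * (‖z‖ ^ (Fintype.card ι + 1))⁻¹) := by
        gcongr
        exact hχ.abs_le_one z
    _ = _ := by field_simp; ring

theorem diffKernel_eq_zero (hχ : IsCutoff χ L) {z : Plane} (hz : 2 < ‖z‖) :
    diffKernel χ g x z = 0 := by
  simp [diffKernel, hχ.eq_zero z hz.le]

theorem measurable_diffKernel (hχ : IsCutoff χ L) (hg : ∀ i, Differentiable ℝ (g i)) :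
    Measurable (diffKernel χ g x) := by
  have h1 := hχ.differentiable.continuous
  have h2 := fun i ↦ (hg i).continuous
  unfold diffKernel
  fun_prop

variable [DecidableEq ι]

theorem LocalBound.abs_fderiv_diffKernel_le (h : LocalBound α g G x) (hχ : IsCutoff χ L)
    {v : Plane} (hv : ‖v‖ ≤ 1) {z : Plane} (hz : z ≠ 0) (hz2 : ‖z‖ ≤ 2) :
    |fderiv ℝ (diffKernel χ g x) z v| ≤
      (2 * Fintype.card ι + 1 + 2 * L) * (∏ i, G i) * ‖z‖⁻¹ ^ 2 := by
  have hz' : 0 < ‖z‖ := norm_pos_iff.2 hz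
  have hG : 0 ≤ ∏ i, G i := Finset.prod_nonneg fun i _ ↦ h.nonneg i
  obtain ⟨D, hD, hDv⟩ := hasFDerivAt_diffKernel hχ.differentiable h.differentiable x hz
  rw [hD.fderiv, hDv, abs_mul, abs_of_nonneg (a := ‖z‖⁻¹ ^ 2) (by positivity), mul_comm]
  gcongr
  refine (abs_add_le _ _).trans ?_
  have h1 := abs_kernelPoly_le (fun i ↦ h.abs_scaled_le i hz hz2)
    (fun i ↦ abs_apply_le_of_norm_le (h.norm_le i z hz2) hv) (abs_inner_le_of_norm_le_one (z := z) hv)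
  have h2 := abs_prod_le_prod (s := Finset.univ) fun i _ ↦ h.abs_scaled_le i hz hz2
  have h3 := abs_apply_le_of_norm_le (hχ.fderiv_le z) hv
  rw [abs_mul, abs_mul, abs_mul, abs_norm]
  calc _ ≤ 1 * ((2 * Fintype.card ι + 1) * ∏ i, G i) + 2 * L * ∏ i, G i := by
        gcongr
        · exact hχ.abs_le_one z
        · exact mul_nonneg zero_le_two hχ.nonneg
    _ = _ := by ring

theorem LocalBound.abs_fderiv_diffKernel_sub_le (h : LocalBound α g G x) (hχ : IsCutoff χ L)
    (hα : 0 < α) {v : Plane} (hv : ‖v‖ ≤ 1) {z : Plane} (hz : z ≠ 0) :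
    |fderiv ℝ (diffKernel χ g x) z v - (Metric.closedBall 0 1).indicator (leadingKernel g x v) z| ≤
      2 * (Fintype.card ι + 1) ^ 2 * (1 + L) * (∏ i, G i) * wt α z := by
  have hz' : 0 < ‖z‖ := norm_pos_iff.2 hz
  have hG : 0 ≤ ∏ i, G i := Finset.prod_nonneg fun i _ ↦ h.nonneg i
  have hL := hχ.nonneg
  rcases le_or_gt ‖z‖ 1 with h1 | h1
  · have hz2 : ‖z‖ ≤ 2 := by linarith
    rw [Set.indicator_of_mem (by simpa using h1)]
    obtain ⟨D, hD, hDv⟩ := hasFDerivAt_diffKernel hχ.differentiable h.differentiable x hz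
    rw [hD.fderiv, hDv, hχ.fderiv_eq_zero_of_le_one h1, hχ.eq_one z h1, leadingKernel, zero_apply,
      mul_zero, zero_mul, add_zero, one_mul, ← mul_sub, abs_mul, wt_of_norm_le hz2,
      abs_of_nonneg (a := ‖z‖⁻¹ ^ 2) (by positivity)]
    have h2 := abs_kernelPoly_sub_le (fun i ↦ h.abs_scaled_le i hz hz2)
      (fun i ↦ abs_apply_le_of_norm_le (h.norm_le i z hz2) hv)
      (fun i ↦ h.abs_fderiv_scaled_le i z) (ε := ‖z‖ ^ α) (by positivity)
      (b' := fun i ↦ fderiv ℝ (g i) x v) (fun i ↦ ?_) (fun i ↦ ?_)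
      (abs_inner_le_of_norm_le_one (z := z) hv)
    · calc _ ≤ ‖z‖⁻¹ ^ 2 * (2 * (Fintype.card ι + 1) ^ 2 * ‖z‖ ^ α * ∏ i, G i) := by gcongr
        _ = 2 * (Fintype.card ι + 1) ^ 2 * (1 + 0) * (∏ i, G i) * (‖z‖ ^ α / ‖z‖ ^ 2) := by
          field_simp; simp
        _ = 2 * (Fintype.card ι + 1) ^ 2 * (1 + 0) * (∏ i, G i) * ‖z‖ ^ (α - 2) := by
          rw [Real.rpow_sub hz', Real.rpow_two]
        _ ≤ _ := by gcongr
    · rw [← mul_sub, abs_mul, abs_inv, abs_norm, inv_mul_le_iff₀ hz']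
      refine (h.abs_diff_sub_le hα.le i hz2).trans (le_of_eq (by ring))
    · rw [← sub_apply, mul_comm]
      exact abs_apply_le_of_norm_le (h.sub_le i z hz2) hv
  · rw [Set.indicator_of_notMem (by simpa using h1), sub_zero]
    rcases le_or_gt ‖z‖ 2 with hz2 | hz2
    · rw [wt_of_norm_le hz2]
      refine (h.abs_fderiv_diffKernel_le hχ hv hz hz2).trans ?_
      have h3 : ‖z‖⁻¹ ^ 2 ≤ ‖z‖ ^ (α - 2) := by
        rw [Real.rpow_sub hz', Real.rpow_two, inv_pow, inv_eq_one_div]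
        gcongr
        exact Real.one_le_rpow h1.le hα.le
      gcongr
      have : (0:ℝ) ≤ Fintype.card ι := Nat.cast_nonneg _
      nlinarith [mul_nonneg this hL, mul_nonneg (mul_nonneg this this) hL]
    · rw [fderiv_eq_zero_of_two_lt_norm (fun z hz ↦ diffKernel_eq_zero hχ hz) hz2, zero_apply,
        abs_zero]
      exact mul_nonneg (by positivity) (wt_nonneg _ _)

theorem leadingKernel_neg (hN : Even (Fintype.card ι)) (v z : Plane) :
    leadingKernel g x v (-z) = -leadingKernel g x v z := by
  simp only [leadingKernel, norm_neg, map_neg, inner_neg_left, mul_neg, kernelPoly_neg hN]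

theorem leadingKernel_smul (v : Plane) {r : ℝ} (hr : 0 < r) (z : Plane) :
    leadingKernel g x v (r • z) = r⁻¹ ^ 2 * leadingKernel g x v z := by
  have e : ∀ t : ℝ, (r * ‖z‖)⁻¹ * (r * t) = ‖z‖⁻¹ * t := fun t ↦ by
    rw [mul_inv]; field_simp
  simp only [leadingKernel, norm_smul, Real.norm_of_nonneg hr.le, map_smul, smul_eq_mul,
    real_inner_smul_left, e]
  rw [mul_inv]; ring

theorem LocalBound.abs_leadingKernel_le (h : LocalBound α g G x) {v : Plane} (hv : ‖v‖ ≤ 1)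
    {z : Plane} (hz : ‖z‖ = 1) :
    |leadingKernel g x v z| ≤ (2 * Fintype.card ι + 1) * ∏ i, G i := by
  rw [leadingKernel, abs_mul]
  refine (mul_le_of_le_one_left (abs_nonneg _) (by simp [hz])).trans ?_
  exact abs_kernelPoly_le (fun i ↦ h.abs_fderiv_scaled_le i z)
    (fun i ↦ abs_apply_le_of_norm_le (h.norm_self_le i) hv) (abs_inner_le_of_norm_le_one hv)

theorem measurable_leadingKernel (v : Plane) : Measurable (leadingKernel g x v) := by
  unfold leadingKernel kernelPoly
  fun_prop

end

section
variable {ι : Type*} [Fintype ι] [DecidableEq ι] {χ : Plane → ℝ} {L α : ℝ} {g : ι → Plane → ℝ}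
  {G : ι → ℝ} {x : Plane}

/-- The multilinear singular integral operator with kernel `diffKernel`. -/
def diffOp (χ f : Plane → ℝ) (g : ι → Plane → ℝ) (x : Plane) : ℝ :=
  ∫ z, f (x - z) * diffKernel χ g x z

theorem LocalBound.abs_diffKernel_update_le (h : LocalBound α g G x) (hχ : IsCutoff χ L)
    {v : Plane} (hv : ‖v‖ ≤ 1) (i : ι) {z : Plane} (hz : z ≠ 0) :
    |diffKernel χ (Function.update g i fun y ↦ fderiv ℝ (g i) y v) x z| ≤ (∏ i, G i) * wt α z := by
  have hz' : 0 < ‖z‖ := norm_pos_iff.2 hz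
  have hG : 0 ≤ ∏ i, G i := Finset.prod_nonneg fun i _ ↦ h.nonneg i
  rcases le_or_gt ‖z‖ 2 with hz2 | hz2
  · rw [diffKernel, abs_mul, abs_mul,
      abs_of_nonneg (a := (‖z‖ ^ (Fintype.card ι + 1))⁻¹) (by positivity), wt_of_norm_le hz2,
      ← Finset.mul_prod_erase Finset.univ _ (Finset.mem_univ i), abs_mul,
      ← Finset.mul_prod_erase Finset.univ G (Finset.mem_univ i), Function.update_self]
    have h0 : |fderiv ℝ (g i) x v - fderiv ℝ (g i) (x - z) v| ≤ G i * ‖z‖ ^ α := by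
      rw [abs_sub_comm, ← sub_apply]
      exact abs_apply_le_of_norm_le (h.sub_le i z hz2) hv
    have h1 : |∏ j ∈ Finset.univ.erase i, (Function.update g i (fun y ↦ fderiv ℝ (g i) y v) j x -
        Function.update g i (fun y ↦ fderiv ℝ (g i) y v) j (x - z))| ≤
        ∏ j ∈ Finset.univ.erase i, (G j * ‖z‖) := by
      refine abs_prod_le_prod fun j hj ↦ ?_
      rw [Function.update_of_ne (Finset.ne_of_mem_erase hj)]
      exact h.abs_diff_le j hz2
    have hc : Fintype.card ι = (Finset.univ.erase i).card + 1 := by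
      rw [Finset.card_erase_of_mem (Finset.mem_univ i), Finset.card_univ]
      have := Fintype.card_pos_iff.2 ⟨i⟩
      omega
    rw [Finset.prod_mul_distrib, Finset.prod_const] at h1
    have hGi := h.nonneg i
    have hGe : 0 ≤ ∏ j ∈ Finset.univ.erase i, G j := Finset.prod_nonneg fun i _ ↦ h.nonneg i
    calc _ ≤ (G i * ‖z‖ ^ α) * ((∏ j ∈ Finset.univ.erase i, G j) *
          ‖z‖ ^ (Finset.univ.erase i).card) * (1 * (‖z‖ ^ (Fintype.card ι + 1))⁻¹) := by
          gcongr
          exact hχ.abs_le_one z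
      _ = _ := by
          rw [hc, Real.rpow_sub hz', Real.rpow_two]
          field_simp
          ring
  · rw [diffKernel_eq_zero hχ hz2, abs_zero]
    exact mul_nonneg hG (wt_nonneg _ _)

theorem LocalBound.enorm_diffOp_update_le (h : LocalBound α g G x) (hχ : IsCutoff χ L)
    {v : Plane} (hv : ‖v‖ ≤ 1) (i : ι) (f : Plane → ℝ) :
    ‖diffOp χ f (Function.update g i fun y ↦ fderiv ℝ (g i) y v) x‖ₑ ≤
      ENNReal.ofReal (∏ i, G i) * majorant α f x := by
  have hG : 0 ≤ ∏ i, G i := Finset.prod_nonneg fun i _ ↦ h.nonneg i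
  calc _ ≤ ∫⁻ z, ‖f (x - z) * diffKernel χ (Function.update g i fun y ↦ fderiv ℝ (g i) y v) x z‖ₑ :=
        enorm_integral_le_lintegral_enorm _
    _ ≤ ∫⁻ z, ENNReal.ofReal (∏ i, G i) * (‖f (x - z)‖ₑ * ‖wt α z‖ₑ) := by
        refine lintegral_mono_ae ?_
        filter_upwards [Measure.ae_ne volume (0 : Plane)] with z hz
        rw [enorm_mul, mul_left_comm]
        refine mul_le_mul' le_rfl ?_
        rw [← Real.enorm_of_nonneg hG, ← enorm_mul, enorm_le_iff_norm_le, Real.norm_of_nonneg (mul_nonneg hG (wt_nonneg _ _))]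
        exact h.abs_diffKernel_update_le hχ hv i hz
    _ = ENNReal.ofReal (∏ i, G i) * ∫⁻ z, ‖f (x - z)‖ₑ * ‖wt α z‖ₑ :=
        lintegral_const_mul' _ _ ENNReal.ofReal_ne_top
    _ ≤ _ := by
        gcongr
        rw [majorant, add_assoc, add_left_comm]
        exact le_self_add

theorem LocalBound.enorm_diffOp_fderiv_le (h : LocalBound α g G x) (hχ : IsCutoff χ L)
    (hα : 0 < α) (hN : Even (Fintype.card ι)) {v : Plane} (hv : ‖v‖ ≤ 1) {f : Plane → ℝ}
    {Λ : NNReal} (hf : LipschitzWith Λ f) (hfd : Differentiable ℝ f) :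
    ‖diffOp χ (fun y ↦ fderiv ℝ f y v) g x‖ₑ ≤
      ENNReal.ofReal (2 * (Fintype.card ι + 1) ^ 2 * (1 + L) * (1 + ∫ z, wt α z) * ∏ i, G i) *
        majorant α f x := by
  have hG : 0 ≤ ∏ i, G i := Finset.prod_nonneg fun i _ ↦ h.nonneg i
  have hL := hχ.nonneg
  have hI : 0 ≤ ∫ z, wt α z := integral_nonneg (wt_nonneg α)
  have hN0 : (0:ℝ) ≤ Fintype.card ι := Nat.cast_nonneg _
  set N : ℝ := (Fintype.card ι : ℝ) with hNdef
  set P : ℝ := ∏ i, G i with hP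
  obtain ⟨-, i2, e⟩ := integral_fderiv_mul_kernel hf hfd (measurable_diffKernel (x := x) hχ h.differentiable)
    (A := (2 * N + 1 + 2 * L) * P)
    (fun z hz ↦ (hasFDerivAt_diffKernel hχ.differentiable h.differentiable x hz).choose_spec.1.differentiableAt)
    (fun z hz hz2 ↦ (h.abs_diffKernel_le hχ hz hz2).trans (by
      gcongr
      exact le_mul_of_one_le_left hG (by linarith)))
    (fun z hz ↦ diffKernel_eq_zero hχ hz) v
    (fun z hz hz2 ↦ h.abs_fderiv_diffKernel_le hχ hv hz hz2) x
  obtain ⟨j1, j2⟩ := enorm_integral_odd_kernel_le hf (measurable_leadingKernel (g := g) (x := x) v)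
    (leadingKernel_neg hN v) (fun r z hr ↦ leadingKernel_smul v hr z)
    (fun z hz ↦ h.abs_leadingKernel_le hv hz) x
  rw [diffOp, e]
  set Θ := (Metric.closedBall (0 : Plane) 1).indicator (leadingKernel g x v) with hΘ
  have split : ∫ z, (f (x - z) - f x) * fderiv ℝ (diffKernel χ g x) z v =
      (∫ z, (f (x - z) - f x) * Θ z) +
      ∫ z, (f (x - z) - f x) * (fderiv ℝ (diffKernel χ g x) z v - Θ z) := by
    simp only [mul_sub (f _ - _)]
    rw [integral_sub i2 j1]; ring
  set c : ℝ := 2 * (N + 1) ^ 2 * (1 + L) * P with hc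
  have hc0 : 0 ≤ c := by positivity
  have hw := measurable_wt α
  have hfm := hf.continuous.measurable
  have hwI : ∫⁻ z, ‖wt α z‖ₑ = ENNReal.ofReal (∫ z, wt α z) := by
    rw [ofReal_integral_eq_lintegral_ofReal (integrable_wt hα) (Filter.Eventually.of_forall (wt_nonneg α))]
    simp_rw [Real.enorm_of_nonneg (wt_nonneg α _)]
  have hsec : ‖∫ z, (f (x - z) - f x) * (fderiv ℝ (diffKernel χ g x) z v - Θ z)‖ₑ ≤
      ENNReal.ofReal c * ((∫⁻ z, ‖f (x - z)‖ₑ * ‖wt α z‖ₑ) +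
        ‖f x‖ₑ * ENNReal.ofReal (∫ z, wt α z)) := by
    calc _ ≤ ∫⁻ z, ‖(f (x - z) - f x) * (fderiv ℝ (diffKernel χ g x) z v - Θ z)‖ₑ :=
          enorm_integral_le_lintegral_enorm _
      _ ≤ ∫⁻ z, ENNReal.ofReal c * (‖f (x - z)‖ₑ * ‖wt α z‖ₑ + ‖f x‖ₑ * ‖wt α z‖ₑ) := by
          refine lintegral_mono_ae ?_
          filter_upwards [Measure.ae_ne volume (0 : Plane)] with z hz
          rw [enorm_mul, ← add_mul, mul_left_comm]
          refine mul_le_mul' enorm_sub_le ?_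
          rw [← Real.enorm_of_nonneg hc0, ← enorm_mul, enorm_le_iff_norm_le, Real.norm_of_nonneg (mul_nonneg hc0 (wt_nonneg _ _))]
          exact h.abs_fderiv_diffKernel_sub_le hχ hα hv hz
      _ = _ := by
          rw [lintegral_const_mul _ (by fun_prop), lintegral_add_left (by fun_prop),
            lintegral_const_mul _ (by fun_prop), hwI]
  rw [split]
  refine (enorm_add_le _ _).trans ((add_le_add j2 hsec).trans ?_)
  have hcI : c ≤ 2 * (N + 1) ^ 2 * (1 + L) * (1 + ∫ z, wt α z) * P := by
    rw [hc]
    have : 0 ≤ 2 * (N + 1) ^ 2 * (1 + L) * P := by positivity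
    nlinarith
  have h1 : (2 * N + 1) * P ≤ c := by
    rw [hc]
    gcongr
    nlinarith [mul_nonneg hN0 hL, mul_nonneg (mul_nonneg hN0 hN0) hL]
  rw [majorant, mul_add, mul_add, mul_add, ← mul_assoc, mul_right_comm, ← ENNReal.ofReal_mul hc0, ← add_assoc]
  gcongr ?_ * _ + ?_ * _ + ?_ * _
  · exact ENNReal.ofReal_le_ofReal (h1.trans hcI)
  · exact ENNReal.ofReal_le_ofReal hcI
  · refine ENNReal.ofReal_le_ofReal ?_
    rw [hc]
    have : 0 ≤ 2 * (N + 1) ^ 2 * (1 + L) * P := by positivity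
    nlinarith

/-- Pointwise bound for the directional derivative of `diffOp`. -/
theorem LocalBound.enorm_diffOp_deriv_le (h : LocalBound α g G x) (hχ : IsCutoff χ L)
    (hα : 0 < α) (hN : Even (Fintype.card ι)) {v : Plane} (hv : ‖v‖ ≤ 1) {f : Plane → ℝ}
    {Λ : NNReal} (hf : LipschitzWith Λ f) (hfd : Differentiable ℝ f) :
    ‖diffOp χ (fun y ↦ fderiv ℝ f y v) g x +
        ∑ i, diffOp χ f (Function.update g i fun y ↦ fderiv ℝ (g i) y v) x‖ₑ ≤
      ENNReal.ofReal (3 * (Fintype.card ι + 1) ^ 2 * (1 + L) * (1 + ∫ z, wt α z) * ∏ i, G i) *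
        majorant α f x := by
  have hG : 0 ≤ ∏ i, G i := Finset.prod_nonneg fun i _ ↦ h.nonneg i
  have hL := hχ.nonneg
  have hI : 0 ≤ ∫ z, wt α z := integral_nonneg (wt_nonneg α)
  have hN0 : (0:ℝ) ≤ Fintype.card ι := Nat.cast_nonneg _
  refine (enorm_add_le _ _).trans ((add_le_add (h.enorm_diffOp_fderiv_le hχ hα hN hv hf hfd)
    ((enorm_sum_le _ _).trans (Finset.sum_le_sum fun i _ ↦ h.enorm_diffOp_update_le hχ hv i f))).trans ?_)
  rw [Finset.sum_const, Finset.card_univ, nsmul_eq_mul, ← mul_assoc, ← add_mul,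
    ← ENNReal.ofReal_natCast, ← ENNReal.ofReal_mul hN0, ← ENNReal.ofReal_add (by positivity) (by positivity)]
  gcongr
  set N : ℝ := (Fintype.card ι : ℝ)
  have h1 : 1 ≤ (1 + L) * (1 + ∫ z, wt α z) := by nlinarith
  have h2 : N ≤ (N + 1) ^ 2 * ((1 + L) * (1 + ∫ z, wt α z)) := by
    calc N ≤ (N + 1) ^ 2 * 1 := by nlinarith
      _ ≤ _ := by gcongr
  nlinarith [mul_le_mul_of_nonneg_right h2 hG]

end

/-- Smooth functions all of whose derivatives are bounded. -/
structure BddSmooth (f : Plane → ℝ) : Prop where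
  contDiff : ∀ n : ℕ, ContDiff ℝ n f
  bdd : ∀ n : ℕ, ∃ C : ℝ, ∀ x, ‖iteratedFDeriv ℝ n f x‖ ≤ C

namespace BddSmooth
variable {f : Plane → ℝ}

theorem fderiv_apply (hf : BddSmooth f) (v : Plane) : BddSmooth fun y ↦ fderiv ℝ f y v := by
  refine ⟨fun n ↦ ?_, fun n ↦ ?_⟩
  · exact (contDiff_succ_iff_fderiv_apply.1 (hf.contDiff (n + 1))).2.2 v
  · obtain ⟨C, hC⟩ := hf.bdd (n + 1)
    refine ⟨‖v‖ * C, fun x ↦ ?_⟩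
    have h1 : ContDiff ℝ n (fderiv ℝ f) := (contDiff_succ_iff_fderiv.1 (hf.contDiff (n + 1))).2.2
    refine (norm_iteratedFDeriv_clm_apply_const (h1.contDiffAt) le_rfl).trans ?_
    gcongr
    rw [norm_iteratedFDeriv_fderiv]
    exact hC x

theorem differentiable (hf : BddSmooth f) : Differentiable ℝ f :=
  (hf.contDiff 1).differentiable (by simp)

theorem continuous_fderiv (hf : BddSmooth f) : Continuous (fderiv ℝ f) :=
  (hf.contDiff 1).continuous_fderiv (by simp)

theorem exists_abs_le (hf : BddSmooth f) : ∃ C : ℝ, ∀ x, |f x| ≤ C := by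
  simpa using hf.bdd 0

theorem exists_fderiv_le (hf : BddSmooth f) : ∃ C : ℝ, ∀ x, ‖fderiv ℝ f x‖ ≤ C := by
  simpa using hf.bdd 1

theorem exists_lipschitzWith (hf : BddSmooth f) : ∃ Λ : NNReal, LipschitzWith Λ f := by
  obtain ⟨C, hC⟩ := hf.exists_fderiv_le
  exact ⟨C.toNNReal, lipschitzWith_of_nnnorm_fderiv_le hf.differentiable fun x ↦ by
    rw [← NNReal.coe_le_coe, coe_nnnorm]; exact (hC x).trans (Real.le_coe_toNNReal C)⟩

theorem exists_fderiv_sub_le (hf : BddSmooth f) :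
    ∃ C : ℝ, ∀ x z, ‖fderiv ℝ f (x - z) - fderiv ℝ f x‖ ≤ C * ‖z‖ := by
  obtain ⟨C, hC⟩ := hf.bdd 2
  have h1 : Differentiable ℝ (fderiv ℝ f) :=
    ((hf.contDiff 2).fderiv_right (m := 1) (by norm_num)).differentiable (by simp)
  refine ⟨C, fun x z ↦ ?_⟩
  have := convex_univ.norm_image_sub_le_of_norm_fderiv_le (𝕜 := ℝ) (f := fderiv ℝ f) (C := C)
    (x := x) (y := x - z) (fun y _ ↦ h1 y) (fun y _ ↦ ?_) trivial trivial
  · simpa using this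
  · have h2 := hC y
    rw [← norm_iteratedFDeriv_fderiv, norm_iteratedFDeriv_one] at h2
    exact h2

end BddSmooth

section
variable {ι : Type*}

theorem exists_localBound_one {g : ι → Plane → ℝ} (hg : ∀ i, BddSmooth (g i)) :
    ∃ G : ι → ℝ, ∀ x, LocalBound 1 g G x := by
  choose C hC using fun i ↦ (hg i).exists_fderiv_le
  choose D hD using fun i ↦ (hg i).exists_fderiv_sub_le
  refine ⟨fun i ↦ max (C i) (D i), fun x ↦ ⟨fun i ↦ (hg i).differentiable, fun i z _ ↦ ?_, fun i z _ ↦ ?_⟩⟩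
  · exact (hC i _).trans (le_max_left _ _)
  · rw [Real.rpow_one]
    exact (hD i x z).trans (by gcongr; exact le_max_right _ _)

variable {χ f : Plane → ℝ} {L : ℝ} {g : ι → Plane → ℝ}

theorem BddSmooth.update [DecidableEq ι] (hg : ∀ i, BddSmooth (g i)) (i : ι) (v : Plane) (j : ι) :
    BddSmooth (Function.update g i (fun y ↦ fderiv ℝ (g i) y v) j) := by
  rcases eq_or_ne j i with rfl | hj
  · simpa using (hg j).fderiv_apply v
  · simpa [hj] using hg j

variable [Fintype ι]

theorem integrable_diffOp (hχ : IsCutoff χ L) (hf : BddSmooth f) (hg : ∀ i, BddSmooth (g i))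
    (x : Plane) : Integrable fun z ↦ f (x - z) * diffKernel χ g x z := by
  obtain ⟨G, hG⟩ := exists_localBound_one hg
  obtain ⟨M, hM⟩ := hf.exists_abs_le
  have hG0 : 0 ≤ ∏ i, G i := Finset.prod_nonneg fun i _ ↦ (hG x).nonneg i
  have hM0 : 0 ≤ M := (abs_nonneg _).trans (hM 0)
  have hfc := hf.differentiable.continuous
  have hKm := measurable_diffKernel (x := x) hχ fun i ↦ (hg i).differentiable
  refine integrable_of_abs_le_wt one_pos (by fun_prop) (A := M * ∏ i, G i) fun z hz ↦ ?_
  rw [abs_mul, mul_assoc]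
  refine mul_le_mul (hM _) ?_ (abs_nonneg _) hM0
  rcases le_or_gt ‖z‖ 2 with h2 | h2
  · rw [wt_one_of_norm_le h2]; exact (hG x).abs_diffKernel_le hχ hz h2
  · rw [diffKernel_eq_zero hχ h2, abs_zero]; exact mul_nonneg hG0 (wt_nonneg _ _)

variable [DecidableEq ι]

theorem diffKernel_update (χ : Plane → ℝ) (g : ι → Plane → ℝ) (i : ι) (u : Plane → ℝ) (x z : Plane) :
    diffKernel χ (Function.update g i u) x z = (u x - u (x - z)) *
      (∏ j ∈ Finset.univ.erase i, (g j x - g j (x - z))) * (χ z * (‖z‖ ^ (Fintype.card ι + 1))⁻¹) := by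
  rw [diffKernel, ← Finset.mul_prod_erase Finset.univ _ (Finset.mem_univ i), Function.update_self]
  congr 2
  exact Finset.prod_congr rfl fun j hj ↦ by rw [Function.update_of_ne (Finset.ne_of_mem_erase hj)]

theorem hasFDerivAt_diffOp (hχ : IsCutoff χ L) (hf : BddSmooth f) (hg : ∀ i, BddSmooth (g i))
    (x : Plane) : ∃ D : Plane →L[ℝ] ℝ, HasFDerivAt (diffOp χ f g) D x ∧ ∀ v, D v =
      diffOp χ (fun y ↦ fderiv ℝ f y v) g x +
        ∑ i, diffOp χ f (Function.update g i fun y ↦ fderiv ℝ (g i) y v) x := by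
  obtain ⟨G, hG⟩ := exists_localBound_one hg
  obtain ⟨M, hM⟩ := hf.exists_abs_le
  obtain ⟨M', hM'⟩ := hf.exists_fderiv_le
  have hG0 : 0 ≤ ∏ i, G i := Finset.prod_nonneg fun i _ ↦ (hG x).nonneg i
  have hM0 : 0 ≤ M := (abs_nonneg _).trans (hM 0)
  have hM'0 : 0 ≤ M' := (norm_nonneg _).trans (hM' 0)
  have hfc := hf.differentiable.continuous
  have hgc := fun i ↦ (hg i).differentiable.continuous
  have hf'c := hf.continuous_fderiv
  have hg'c := fun i ↦ (hg i).continuous_fderiv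
  have hχc := hχ.differentiable.continuous
  have hK : ∀ x z, z ≠ 0 → |diffKernel χ g x z| ≤ (∏ i, G i) * wt 1 z := fun x z hz ↦ by
    rcases le_or_gt ‖z‖ 2 with h2 | h2
    · rw [wt_one_of_norm_le h2]; exact (hG x).abs_diffKernel_le hχ hz h2
    · rw [diffKernel_eq_zero hχ h2, abs_zero]; exact mul_nonneg hG0 (wt_nonneg _ _)
  let F' : Plane → Plane → Plane →L[ℝ] ℝ := fun x z ↦ diffKernel χ g x z • fderiv ℝ f (x - z) +
    f (x - z) • ((χ z * (‖z‖ ^ (Fintype.card ι + 1))⁻¹) •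
      ∑ i, (∏ j ∈ Finset.univ.erase i, (g j x - g j (x - z))) • (fderiv ℝ (g i) x - fderiv ℝ (g i) (x - z)))
  have hF'v : ∀ x z v, F' x z v = fderiv ℝ f (x - z) v * diffKernel χ g x z +
      ∑ i, f (x - z) * diffKernel χ (Function.update g i fun y ↦ fderiv ℝ (g i) y v) x z := by
    intro x z v
    simp only [F', add_apply, smul_apply, smul_eq_mul, sum_apply, sub_apply, diffKernel_update,
      Finset.mul_sum]
    congr 1
    · ring
    · exact Finset.sum_congr rfl fun i _ ↦ by ring
  have hv1 : ∀ x z v, z ≠ 0 → ‖v‖ ≤ 1 →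
      |fderiv ℝ f (x - z) v * diffKernel χ g x z| ≤ M' * (∏ i, G i) * wt 1 z := fun x z v hz hv ↦ by
    rw [abs_mul, mul_assoc]
    exact mul_le_mul (abs_apply_le_of_norm_le (hM' _) hv) (hK x z hz) (abs_nonneg _) hM'0
  have hv2 : ∀ x z v i, z ≠ 0 → ‖v‖ ≤ 1 →
      |f (x - z) * diffKernel χ (Function.update g i fun y ↦ fderiv ℝ (g i) y v) x z| ≤
        M * (∏ i, G i) * wt 1 z := fun x z v i hz hv ↦ by
    rw [abs_mul, mul_assoc]
    exact mul_le_mul (hM _) ((hG x).abs_diffKernel_update_le hχ hv i hz) (abs_nonneg _) hM0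
  have hbound : ∀ x z, z ≠ 0 → ‖F' x z‖ ≤ (M' + Fintype.card ι * M) * (∏ i, G i) * wt 1 z := by
    intro x z hz
    have := wt_nonneg 1 z
    refine ContinuousLinearMap.opNorm_le_of_unit_norm (by positivity) fun v hv ↦ ?_
    rw [hF'v, Real.norm_eq_abs]
    refine (abs_add_le _ _).trans ((add_le_add (hv1 x z v hz hv.le)
      ((Finset.abs_sum_le_sum_abs _ _).trans (Finset.sum_le_sum fun i _ ↦ hv2 x z v i hz hv.le))).trans ?_)
    simp only [Finset.sum_const, Finset.card_univ, nsmul_eq_mul]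
    exact le_of_eq (by ring)
  have hKm : ∀ x, Measurable (diffKernel χ g x) := fun x ↦
    measurable_diffKernel hχ fun i ↦ (hg i).differentiable
  have hFm : ∀ x, Measurable fun z ↦ f (x - z) * diffKernel χ g x z := fun x ↦ by
    have := hKm x
    fun_prop
  have hF'm : ∀ x, Measurable (F' x) := fun x ↦ by
    have := hKm x
    refine Measurable.add (this.smul (hf'c.measurable.comp (measurable_const.sub measurable_id))) ?_
    have h1 : Measurable fun z ↦ f (x - z) := by fun_prop
    have h2 : Measurable fun z : Plane ↦ χ z * (‖z‖ ^ (Fintype.card ι + 1))⁻¹ := by fun_prop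
    refine h1.smul (h2.smul (Finset.measurable_fun_sum _ fun i _ ↦ ?_))
    have h3 : Measurable fun z ↦ ∏ j ∈ Finset.univ.erase i, (g j x - g j (x - z)) := by fun_prop
    refine h3.smul ?_
    exact ((hg'c i).measurable.comp (measurable_const.sub measurable_id)).const_sub _
  have hF'i : ∀ x, Integrable (F' x) := fun x ↦ by
    refine ((integrable_wt one_pos).const_mul ((M' + Fintype.card ι * M) * ∏ i, G i)).mono'
      (hF'm x).aestronglyMeasurable ?_
    filter_upwards [Measure.ae_ne volume (0 : Plane)] with z hz using hbound x z hz
  have hdiff : ∀ x z, HasFDerivAt (fun x ↦ f (x - z) * diffKernel χ g x z) (F' x z) x := by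
    intro x z
    have h1 : ∀ {u : Plane → ℝ}, Differentiable ℝ u →
        HasFDerivAt (fun x ↦ u (x - z)) (fderiv ℝ u (x - z)) x := fun {u} hu ↦ by
      have := (hu (x - z)).hasFDerivAt.comp x ((hasFDerivAt_id x).sub_const z)
      exact this
    have h2 : ∀ i, HasFDerivAt (fun x ↦ g i x - g i (x - z))
        (fderiv ℝ (g i) x - fderiv ℝ (g i) (x - z)) x := fun i ↦
      ((hg i).differentiable x).hasFDerivAt.sub (h1 (hg i).differentiable)
    have h3 := (HasFDerivAt.finsetProd (u := Finset.univ) fun i _ ↦ h2 i).mul_const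
      (χ z * (‖z‖ ^ (Fintype.card ι + 1))⁻¹)
    refine ((h1 hf.differentiable).mul h3).congr_fderiv ?_
    simp only [F', diffKernel]
    exact add_comm _ _
  refine ⟨∫ z, F' x z, ?_, fun v ↦ ?_⟩
  · refine hasFDerivAt_integral_of_dominated_of_fderiv_le (s := Set.univ) (F' := F')
      (bound := fun z ↦ (M' + Fintype.card ι * M) * (∏ i, G i) * wt 1 z) Filter.univ_mem
      (Filter.Eventually.of_forall fun x ↦ (hFm x).aestronglyMeasurable) (integrable_diffOp hχ hf hg x)
      (hF'm x).aestronglyMeasurable ?_ ((integrable_wt one_pos).const_mul _) ?_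
    · filter_upwards [Measure.ae_ne volume (0 : Plane)] with z hz y _ using hbound y z hz
    · exact Filter.Eventually.of_forall fun z y _ ↦ hdiff y z
  · rw [ContinuousLinearMap.integral_apply (hF'i x)]
    simp_rw [hF'v]
    have hi := fun i ↦ integrable_diffOp hχ hf (BddSmooth.update hg i v) x
    rw [integral_add (integrable_diffOp hχ (hf.fderiv_apply v) hg x)
      (integrable_finsetSum _ fun i _ ↦ hi i), integral_finsetSum _ fun i _ ↦ hi i]
    rfl

theorem BddSmooth.fderiv_diffOp_apply (hχ : IsCutoff χ L) (hf : BddSmooth f)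
    (hg : ∀ i, BddSmooth (g i)) (x v : Plane) : fderiv ℝ (diffOp χ f g) x v =
      diffOp χ (fun y ↦ fderiv ℝ f y v) g x +
        ∑ i, diffOp χ f (Function.update g i fun y ↦ fderiv ℝ (g i) y v) x := by
  obtain ⟨D, hD, hDv⟩ := hasFDerivAt_diffOp hχ hf hg x
  rw [hD.fderiv, hDv]

theorem BddSmooth.contDiff_diffOp (hχ : IsCutoff χ L) (n : ℕ) (hf : BddSmooth f)
    (hg : ∀ i, BddSmooth (g i)) : ContDiff ℝ n (diffOp χ f g) := by
  have hd : ∀ {f g}, BddSmooth f → (∀ i : ι, BddSmooth (g i)) → Differentiable ℝ (diffOp χ f g) :=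
    fun hf hg x ↦ (hasFDerivAt_diffOp hχ hf hg x).choose_spec.1.differentiableAt
  induction n generalizing f g with
  | zero => exact contDiff_zero.2 (hd hf hg).continuous
  | succ n ih =>
    push_cast
    refine contDiff_succ_iff_fderiv_apply.2 ⟨hd hf hg, by simp, fun v ↦ ?_⟩
    simp_rw [hf.fderiv_diffOp_apply hχ hg _ v]
    exact (ih (hf.fderiv_apply v) hg).add
      (ContDiff.sum fun i _ ↦ ih hf (BddSmooth.update hg i v))

end

/-- The iterated partial derivative of `φ` along the word `m` in the coordinate directions. -/
def wordDeriv (φ : Plane → ℝ) {n : ℕ} (m : Fin n → Fin 2) (y : Plane) : ℝ :=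
  iteratedFDeriv ℝ n φ y fun i ↦ EuclideanSpace.single (m i) (1:ℝ)

theorem norm_single_one (a : Fin 2) : ‖(EuclideanSpace.single a (1:ℝ) : Plane)‖ = 1 := by simp

theorem hasFDerivAt_wordDeriv {φ : Plane → ℝ} (hφ : ∀ n : ℕ, ContDiff ℝ n φ) {n : ℕ}
    (m : Fin n → Fin 2) (y : Plane) :
    HasFDerivAt (wordDeriv φ m) ((ContinuousMultilinearMap.apply ℝ (fun _ : Fin n ↦ Plane) ℝ
      fun i ↦ EuclideanSpace.single (m i) (1:ℝ)).comp (fderiv ℝ (iteratedFDeriv ℝ n φ) y)) y := by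
  have h1 : DifferentiableAt ℝ (iteratedFDeriv ℝ n φ) y :=
    ((hφ (n + 1)).differentiable_iteratedFDeriv (by exact_mod_cast Nat.lt_succ_self n)) y
  exact (ContinuousMultilinearMap.apply ℝ (fun _ : Fin n ↦ Plane) ℝ
      fun i ↦ EuclideanSpace.single (m i) (1:ℝ)).hasFDerivAt.comp y h1.hasFDerivAt

theorem fderiv_wordDeriv_apply {φ : Plane → ℝ} (hφ : ∀ n : ℕ, ContDiff ℝ n φ) {n : ℕ}
    (m : Fin n → Fin 2) (y v : Plane) :
    fderiv ℝ (wordDeriv φ m) y v =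
      iteratedFDeriv ℝ (n + 1) φ y (Fin.cons v fun i ↦ EuclideanSpace.single (m i) (1:ℝ)) := by
  rw [(hasFDerivAt_wordDeriv hφ m y).fderiv, iteratedFDeriv_succ_apply_left]
  simp

theorem fderiv_wordDeriv_single {φ : Plane → ℝ} (hφ : ∀ n : ℕ, ContDiff ℝ n φ) {n : ℕ}
    (m : Fin n → Fin 2) (y : Plane) (a : Fin 2) :
    fderiv ℝ (wordDeriv φ m) y (EuclideanSpace.single a (1:ℝ)) = wordDeriv φ (Fin.cons a m : Fin (n + 1) → Fin 2) y := by
  rw [fderiv_wordDeriv_apply hφ, wordDeriv]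
  congr 1
  ext i : 1
  refine Fin.cases ?_ (fun i ↦ ?_) i <;> simp

/-- `ψ` is an iterated partial derivative of order `n` of `φ`. -/
def IsDer (n : ℕ) (φ ψ : Plane → ℝ) : Prop := ∃ m : Fin n → Fin 2, ψ = wordDeriv φ m

theorem isDer_zero (φ : Plane → ℝ) : IsDer 0 φ φ := ⟨Fin.elim0, by ext y; simp [wordDeriv]⟩

theorem IsDer.fderiv_single {φ ψ : Plane → ℝ} (hφ : BddSmooth φ) {n : ℕ} (h : IsDer n φ ψ)
    (a : Fin 2) : IsDer (n + 1) φ fun y ↦ fderiv ℝ ψ y (EuclideanSpace.single a (1:ℝ)) := by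
  obtain ⟨m, rfl⟩ := h
  exact ⟨Fin.cons a m, funext fun y ↦ fderiv_wordDeriv_single hφ.contDiff m y a⟩

theorem BddSmooth.bddSmooth_wordDeriv {φ : Plane → ℝ} (hφ : BddSmooth φ) {n : ℕ} (m : Fin n → Fin 2) :
    BddSmooth (wordDeriv φ m) := by
  induction n with
  | zero =>
    have : wordDeriv φ m = φ := by ext y; simp [wordDeriv]
    rwa [this]
  | succ n ih =>
    have := (ih (Fin.tail m)).fderiv_apply (EuclideanSpace.single (m 0) (1:ℝ))
    simp_rw [fderiv_wordDeriv_single hφ.contDiff, Fin.cons_self_tail] at this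
    exact this

theorem IsDer.bddSmooth {φ ψ : Plane → ℝ} (hφ : BddSmooth φ) {n : ℕ} (h : IsDer n φ ψ) :
    BddSmooth ψ := by
  obtain ⟨m, rfl⟩ := h
  exact hφ.bddSmooth_wordDeriv m

theorem norm_le_sum_words {n : ℕ} (A : Plane [×n]→L[ℝ] ℝ) :
    ‖A‖ ≤ ∑ m : Fin n → Fin 2, ‖A fun i ↦ EuclideanSpace.single (m i) (1:ℝ)‖ := by
  refine A.opNorm_le_bound (Finset.sum_nonneg fun _ _ ↦ norm_nonneg _) fun v ↦ ?_
  have e : v = fun i ↦ ∑ a : Fin 2, v i a • EuclideanSpace.single a (1:ℝ) := by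
    ext i a
    fin_cases a <;> simp
  have e2 : A v = ∑ m : Fin n → Fin 2, (∏ i, v i (m i)) • A fun i ↦ EuclideanSpace.single (m i) (1:ℝ) := by
    conv_lhs => rw [e]
    rw [ContinuousMultilinearMap.map_sum]
    exact Finset.sum_congr rfl fun m _ ↦ ContinuousMultilinearMap.map_smul_univ _ _ _
  rw [e2, Finset.sum_mul]
  refine (norm_sum_le _ _).trans (Finset.sum_le_sum fun m _ ↦ ?_)
  rw [norm_smul, norm_prod, mul_comm]
  gcongr with i
  exact PiLp.norm_apply_le (v i) (m i)

theorem exists_wordDeriv_diffOp_expansion {ι : Type} [Fintype ι] [DecidableEq ι] {χ f : Plane → ℝ}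
    {L : ℝ} {g : ι → Plane → ℝ} (hχ : IsCutoff χ L) (hf : BddSmooth f) (hg : ∀ i, BddSmooth (g i))
    {n : ℕ} (m : Fin n → Fin 2) :
    ∃ (κ : Type) (_ : Fintype κ) (a : κ → ℕ) (b : κ → ι → ℕ) (F : κ → Plane → ℝ)
      (K : κ → ι → Plane → ℝ), Fintype.card κ = (Fintype.card ι + 1) ^ n ∧
      (∀ c, a c + ∑ i, b c i = n) ∧ (∀ c, IsDer (a c) f (F c)) ∧
      (∀ c i, IsDer (b c i) (g i) (K c i)) ∧
      wordDeriv (diffOp χ f g) m = fun x ↦ ∑ c, diffOp χ (F c) (K c) x := by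
  have hM : ∀ n : ℕ, ContDiff ℝ n (diffOp χ f g) := fun n ↦ hf.contDiff_diffOp hχ n hg
  induction n with
  | zero =>
    refine ⟨Unit, inferInstance, fun _ ↦ 0, fun _ _ ↦ 0, fun _ ↦ f, fun _ ↦ g, by simp, by simp,
      fun _ ↦ isDer_zero f, fun _ i ↦ isDer_zero _, ?_⟩
    ext x
    simp [wordDeriv]
  | succ n ih =>
    obtain ⟨κ, hκ, a, b, F, K, hcard, hsum, hF, hK, e⟩ := ih (Fin.tail m)
    set v : Plane := EuclideanSpace.single (m 0) (1:ℝ) with hv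
    refine ⟨κ × Option ι, inferInstance,
      fun c ↦ c.2.elim (a c.1 + 1) fun _ ↦ a c.1,
      fun c ↦ c.2.elim (b c.1) fun i ↦ Function.update (b c.1) i (b c.1 i + 1),
      fun c ↦ c.2.elim (fun y ↦ fderiv ℝ (F c.1) y v) fun _ ↦ F c.1,
      fun c ↦ c.2.elim (K c.1) fun i ↦ Function.update (K c.1) i fun y ↦ fderiv ℝ (K c.1 i) y v,
      ?_, ?_, ?_, ?_, ?_⟩
    · simp [hcard, pow_succ]
    · rintro ⟨c, _ | i⟩
      · have := hsum c; simp; omega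
      · have := hsum c
        simp only [Option.elim_some]
        rw [← Finset.add_sum_erase _ _ (Finset.mem_univ i)] at this ⊢
        rw [Function.update_self, Finset.sum_congr rfl fun j hj ↦
          Function.update_of_ne (Finset.ne_of_mem_erase hj) _ _]
        omega
    · rintro ⟨c, _ | i⟩
      · exact (hF c).fderiv_single hf _
      · exact hF c
    · rintro ⟨c, _ | i⟩ j
      · exact hK c j
      · simp only [Option.elim_some]
        rcases eq_or_ne j i with rfl | hj
        · simpa using (hK c j).fderiv_single (hg j) _
        · simpa [hj] using hK c j
    · have h1 := fun y ↦ fderiv_wordDeriv_single hM (Fin.tail m) y (m 0)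
      rw [Fin.cons_self_tail] at h1
      ext x
      have hFs := fun c ↦ (hF c).bddSmooth hf
      have hKs := fun c i ↦ (hK c i).bddSmooth (hg i)
      rw [← h1, e, fderiv_fun_sum fun c _ ↦
        ((hFs c).contDiff_diffOp hχ 1 (hKs c)).differentiable (by simp) x, sum_apply,
        Fintype.sum_prod_type]
      refine Finset.sum_congr rfl fun c _ ↦ ?_
      rw [(hFs c).fderiv_diffOp_apply hχ (hKs c), Fintype.sum_option]
      rfl

/-- The sum of the majorants of all partial derivatives of order at most `k`. -/
def derMajorant (α : ℝ) (k : ℕ) (f : Plane → ℝ) (x : Plane) : ℝ≥0∞ :=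
  ∑ a ∈ Finset.range (k + 1), ∑ m : Fin a → Fin 2, majorant α (wordDeriv f m) x

theorem IsDer.majorant_le {α : ℝ} {k a : ℕ} {f F : Plane → ℝ} (h : IsDer a f F) (ha : a ≤ k)
    (x : Plane) : majorant α F x ≤ derMajorant α k f x := by
  obtain ⟨m, rfl⟩ := h
  refine le_trans ?_ (Finset.single_le_sum
    (f := fun a ↦ ∑ m : Fin a → Fin 2, majorant α (wordDeriv f m) x) (fun _ _ ↦ zero_le)
    (Finset.mem_range.2 (Nat.lt_succ_of_le ha)))
  exact Finset.single_le_sum (f := fun m : Fin a → Fin 2 ↦ majorant α (wordDeriv f m) x)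
    (fun _ _ ↦ zero_le) (Finset.mem_univ m)

theorem enorm_iteratedFDeriv_diffOp_le {ι : Type} [Fintype ι] [DecidableEq ι] {χ f h : Plane → ℝ}
    {L α : ℝ} (hχ : IsCutoff χ L) (hα : 0 < α) (hN : Even (Fintype.card ι)) (hf : BddSmooth f)
    (hh : BddSmooth h) {x : Plane} {A : ℕ → ℝ} {R : ℝ} {n k : ℕ} (hnk : n ≤ k)
    (hA : ∀ (b : ℕ) (ψ : Plane → ℝ), IsDer b h ψ → (∀ z : Plane, ‖z‖ ≤ 2 → ‖fderiv ℝ ψ (x - z)‖ ≤ A b) ∧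
      ∀ z : Plane, ‖z‖ ≤ 2 → ‖fderiv ℝ ψ (x - z) - fderiv ℝ ψ x‖ ≤ A b * ‖z‖ ^ α)
    (hR : ∀ b : ι → ℕ, ∑ i, b i ≤ n → ∏ i, A (b i) ≤ R) :
    ‖iteratedFDeriv ℝ (n + 1) (diffOp χ f fun _ : ι ↦ h) x‖ₑ ≤
      2 ^ (n + 1) * (Fintype.card ι + 1 : ℝ≥0∞) ^ n *
      ENNReal.ofReal (3 * (Fintype.card ι + 1) ^ 2 * (1 + L) * (1 + ∫ z, wt α z) * R) *
        derMajorant α k f x := by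
  have hI : 0 ≤ ∫ z, wt α z := integral_nonneg (wt_nonneg α)
  have hL := hχ.nonneg
  set M := diffOp χ f fun _ : ι ↦ h with hMdef
  set Q : ℝ≥0∞ := ENNReal.ofReal (3 * (Fintype.card ι + 1) ^ 2 * (1 + L) * (1 + ∫ z, wt α z) * R) *
        derMajorant α k f x with hQ
  have hM : ∀ n : ℕ, ContDiff ℝ n M := fun n ↦ hf.contDiff_diffOp hχ n fun _ ↦ hh
  have key : ∀ m : Fin (n + 1) → Fin 2, ‖wordDeriv M m x‖ₑ ≤ (Fintype.card ι + 1 : ℝ≥0∞) ^ n * Q := by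
    intro m
    obtain ⟨κ, hκ, a, b, F, K, hcard, hsum, hF, hK, e⟩ :=
      exists_wordDeriv_diffOp_expansion (ι := ι) hχ hf (fun _ ↦ hh) (Fin.tail m)
    have h1 := fderiv_wordDeriv_single hM (Fin.tail m) x (m 0)
    rw [Fin.cons_self_tail] at h1
    have hFs := fun c ↦ (hF c).bddSmooth hf
    have hKs := fun c i ↦ (hK c i).bddSmooth hh
    rw [← h1, hMdef, e, fderiv_fun_sum fun c _ ↦
        ((hFs c).contDiff_diffOp hχ 1 (hKs c)).differentiable (by simp) x, sum_apply]
    refine (enorm_sum_le _ _).trans ?_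
    have h2 : ∀ c ∈ Finset.univ, ‖fderiv ℝ (diffOp χ (F c) (K c)) x (EuclideanSpace.single (m 0) (1:ℝ))‖ₑ ≤ Q := by
      intro c _
      rw [(hFs c).fderiv_diffOp_apply hχ (hKs c)]
      obtain ⟨Λ, hΛ⟩ := (hFs c).exists_lipschitzWith
      have hloc : LocalBound α (K c) (fun i ↦ A (b c i)) x :=
        ⟨fun i ↦ (hKs c i).differentiable, fun i ↦ (hA _ _ (hK c i)).1, fun i ↦ (hA _ _ (hK c i)).2⟩
      refine (hloc.enorm_diffOp_deriv_le hχ hα hN (norm_single_one _).le hΛ (hFs c).differentiable).trans ?_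
      rw [hQ]
      gcongr
      · exact hR _ (by have := hsum c; omega)
      · exact (hF c).majorant_le (by have := hsum c; omega) x
    refine (Finset.sum_le_sum h2).trans (le_of_eq ?_)
    rw [Finset.sum_const, Finset.card_univ, hcard, nsmul_eq_mul]
    push_cast
    rfl
  have h3 := norm_le_sum_words (iteratedFDeriv ℝ (n + 1) M x)
  calc ‖iteratedFDeriv ℝ (n + 1) M x‖ₑ
      = ENNReal.ofReal ‖iteratedFDeriv ℝ (n + 1) M x‖ := (ofReal_norm _).symm
    _ ≤ ENNReal.ofReal (∑ m : Fin (n + 1) → Fin 2, ‖wordDeriv M m x‖) := ENNReal.ofReal_le_ofReal h3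
    _ = ∑ m : Fin (n + 1) → Fin 2, ‖wordDeriv M m x‖ₑ := by
        rw [ENNReal.ofReal_sum_of_nonneg fun _ _ ↦ norm_nonneg _]
        simp_rw [ofReal_norm]
    _ ≤ ∑ m : Fin (n + 1) → Fin 2, (Fintype.card ι + 1 : ℝ≥0∞) ^ n * Q := Finset.sum_le_sum fun m _ ↦ key m
    _ = _ := by
        rw [Finset.sum_const, Finset.card_univ, hQ]
        simp
        ring

section LogConvex
variable {B : ℕ → ℝ}

theorem mul_le_mul_succ_of_sq_le (h0 : ∀ m, 0 ≤ B m) (hB : ∀ m, B (m + 1) ^ 2 ≤ B m * B (m + 2))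
    {j l : ℕ} (hjl : j ≤ l) : B (j + 1) * B l ≤ B j * B (l + 1) := by
  induction l, hjl using Nat.le_induction with
  | base => rw [mul_comm]
  | succ l _ ih =>
    rcases (h0 l).eq_or_lt with hl | hl
    · have h1 := hB l
      rw [← hl, zero_mul] at h1
      have h2 : B (l + 1) = 0 := by nlinarith
      rw [h2, mul_zero]
      exact mul_nonneg (h0 _) (h0 _)
    · refine le_of_mul_le_mul_left ?_ hl
      calc B l * (B (j + 1) * B (l + 1)) = (B (j + 1) * B l) * B (l + 1) := by ring
        _ ≤ (B j * B (l + 1)) * B (l + 1) := mul_le_mul_of_nonneg_right ih (h0 _)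
        _ = B j * B (l + 1) ^ 2 := by ring
        _ ≤ B j * (B l * B (l + 2)) := mul_le_mul_of_nonneg_left (hB l) (h0 j)
        _ = _ := by ring

theorem mul_le_zero_mul_add_of_le (h0 : ∀ m, 0 ≤ B m)
    (hB : ∀ m, B (m + 1) ^ 2 ≤ B m * B (m + 2)) {a b : ℕ} (hab : a ≤ b) :
    B a * B b ≤ B 0 * B (a + b) := by
  induction a generalizing b with
  | zero => simp
  | succ a ih =>
    refine (mul_le_mul_succ_of_sq_le h0 hB (by omega)).trans ?_
    have := ih (b := b + 1) (by omega)
    rwa [show a + (b + 1) = a + 1 + b by omega] at this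

theorem mul_le_zero_mul_add (h0 : ∀ m, 0 ≤ B m)
    (hB : ∀ m, B (m + 1) ^ 2 ≤ B m * B (m + 2)) (a b : ℕ) :
    B a * B b ≤ B 0 * B (a + b) := by
  rcases le_total a b with h | h
  · exact mul_le_zero_mul_add_of_le h0 hB h
  · rw [mul_comm, add_comm]
    exact mul_le_zero_mul_add_of_le h0 hB h

theorem prod_le_zero_pow_mul_sum (h0 : ∀ m, 0 ≤ B m)
    (hB : ∀ m, B (m + 1) ^ 2 ≤ B m * B (m + 2)) {ι : Type*} {s : Finset ι} (hs : s.Nonempty)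
    (b : ι → ℕ) : ∏ i ∈ s, B (b i) ≤ B 0 ^ (s.card - 1) * B (∑ i ∈ s, b i) := by
  induction hs using Finset.Nonempty.cons_induction with
  | singleton a => simp
  | cons a s ha hs ih =>
    rw [Finset.prod_cons, Finset.sum_cons, Finset.card_cons]
    obtain ⟨c, hc⟩ := Nat.exists_eq_add_of_lt hs.card_pos
    rw [hc] at ih ⊢
    simp only [zero_add, Nat.add_sub_cancel] at ih ⊢
    calc B (b a) * ∏ i ∈ s, B (b i) ≤ B (b a) * (B 0 ^ c * B (∑ i ∈ s, b i)) :=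
          mul_le_mul_of_nonneg_left ih (h0 _)
      _ = B 0 ^ c * (B (b a) * B (∑ i ∈ s, b i)) := by ring
      _ ≤ B 0 ^ c * (B 0 * B (b a + ∑ i ∈ s, b i)) :=
          mul_le_mul_of_nonneg_left (mul_le_zero_mul_add h0 hB _ _) (pow_nonneg (h0 0) _)
      _ = _ := by ring

theorem prod_le_of_sq_le {A : ℕ → ℝ} (h0 : ∀ m, 0 ≤ A m)
    (hA : ∀ m, A (m + 1) ^ 2 ≤ 8 * A m * A (m + 2)) {ι : Type*} [Fintype ι] [Nonempty ι]
    (b : ι → ℕ) :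
    ∏ i, A (b i) ≤ 8 ^ (∑ i, b i) ^ 2 * A 0 ^ (Fintype.card ι - 1) * A (∑ i, b i) := by
  have h1 := prod_le_zero_pow_mul_sum (B := fun m ↦ 8 ^ m ^ 2 * A m)
    (fun m ↦ mul_nonneg (by positivity) (h0 m)) (fun m ↦ ?_) Finset.univ_nonempty b
  · have h2 : ∏ i, A (b i) ≤ ∏ i, 8 ^ b i ^ 2 * A (b i) :=
      Finset.prod_le_prod (fun i _ ↦ h0 _) fun i _ ↦
        le_mul_of_one_le_left (h0 _) (one_le_pow₀ (by norm_num))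
    refine h2.trans (h1.trans (le_of_eq ?_))
    rw [Finset.card_univ]
    simp
    ring
  · calc (8 ^ (m + 1) ^ 2 * A (m + 1)) ^ 2 = 8 ^ (2 * (m + 1) ^ 2) * A (m + 1) ^ 2 := by ring
      _ ≤ 8 ^ (2 * (m + 1) ^ 2) * (8 * A m * A (m + 2)) := by gcongr; exact hA m
      _ = 8 ^ (2 * (m + 1) ^ 2 + 1) * (A m * A (m + 2)) := by ring
      _ ≤ 8 ^ (2 * (m + 1) ^ 2 + 2) * (A m * A (m + 2)) := by
          refine mul_le_mul_of_nonneg_right ?_ (mul_nonneg (h0 _) (h0 _))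
          exact pow_le_pow_right₀ (by norm_num) (by omega)
      _ = _ := by
          rw [show 2 * (m + 1) ^ 2 + 2 = m ^ 2 + (m + 2) ^ 2 by ring, pow_add]
          ring

end LogConvex

section Landau
variable {E F : Type*} [NormedAddCommGroup E] [NormedSpace ℝ E] [NormedAddCommGroup F]
  [NormedSpace ℝ F]

theorem sq_norm_fderiv_le {f : E → F} {a b : ℝ} (hf : Differentiable ℝ f) (ha : ∀ x, ‖f x‖ ≤ a)
    (hb0 : 0 ≤ b) (hb : ∀ x y, ‖fderiv ℝ f y - fderiv ℝ f x‖ ≤ b * ‖y - x‖) (x : E) :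
    ‖fderiv ℝ f x‖ ^ 2 ≤ 8 * a * b := by
  have ha0 : 0 ≤ a := (norm_nonneg _).trans (ha x)
  have h1 : ∀ v : E, ‖fderiv ℝ f x v‖ ≤ 2 * a + b * ‖v‖ ^ 2 := by
    intro v
    have h2 := (convex_closedBall x ‖v‖).norm_image_sub_le_of_norm_fderiv_le' (𝕜 := ℝ) (f := f)
      (φ := fderiv ℝ f x) (C := b * ‖v‖) (x := x) (y := x + v) (fun y _ ↦ hf y)
      (fun y hy ↦ (hb x y).trans (by
        gcongr; simpa [dist_eq_norm] using hy)) (by simp) (by simp)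
    rw [add_sub_cancel_left] at h2
    calc ‖fderiv ℝ f x v‖ = ‖f (x + v) - f x - (f (x + v) - f x - fderiv ℝ f x v)‖ := by
          congr 1; abel
      _ ≤ ‖f (x + v)‖ + ‖f x‖ + ‖f (x + v) - f x - fderiv ℝ f x v‖ :=
          (norm_sub_le _ _).trans (by gcongr; exact norm_sub_le _ _)
      _ ≤ a + a + b * ‖v‖ * ‖v‖ := by gcongr <;> exact ha _
      _ = _ := by ring
  have h3 : ∀ t : ℝ, 0 < t → t * ‖fderiv ℝ f x‖ ≤ 2 * a + b * t ^ 2 := by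
    intro t ht
    rw [← le_div_iff₀' ht]
    refine ContinuousLinearMap.opNorm_le_of_unit_norm (by positivity) fun v hv ↦ ?_
    rw [le_div_iff₀' ht]
    simpa [norm_smul, abs_of_pos ht, hv] using h1 (t • v)
  have h4 : discrim b (-‖fderiv ℝ f x‖) (2 * a) ≤ 0 := by
    refine discrim_le_zero fun t ↦ ?_
    rcases le_or_gt t 0 with ht | ht
    · have : 0 ≤ -t * ‖fderiv ℝ f x‖ := mul_nonneg (by linarith) (norm_nonneg _)
      nlinarith [mul_nonneg hb0 (mul_self_nonneg t)]
    · nlinarith [h3 t ht]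
  rw [discrim] at h4
  nlinarith

theorem norm_iteratedFDeriv_sub_le {w : E → F} (hw : ∀ n : ℕ, ContDiff ℝ n w) {m : ℕ} {b : ℝ}
    (hb : ∀ x, ‖iteratedFDeriv ℝ (m + 1) w x‖ ≤ b) (x y : E) :
    ‖iteratedFDeriv ℝ m w y - iteratedFDeriv ℝ m w x‖ ≤ b * ‖y - x‖ :=
  convex_univ.norm_image_sub_le_of_norm_fderiv_le (𝕜 := ℝ)
    (fun z _ ↦ ((hw (m + 1)).differentiable_iteratedFDeriv (by exact_mod_cast Nat.lt_succ_self m)) z)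
    (fun z _ ↦ by rw [norm_fderiv_iteratedFDeriv]; exact hb z) trivial trivial

theorem sq_norm_iteratedFDeriv_le {w : E → F} (hw : ∀ n : ℕ, ContDiff ℝ n w) {m : ℕ} {a b : ℝ}
    (ha : ∀ x, ‖iteratedFDeriv ℝ m w x‖ ≤ a) (hb : ∀ x, ‖iteratedFDeriv ℝ (m + 2) w x‖ ≤ b)
    (x : E) : ‖iteratedFDeriv ℝ (m + 1) w x‖ ^ 2 ≤ 8 * a * b := by
  rw [← norm_fderiv_iteratedFDeriv]
  refine sq_norm_fderiv_le
    ((hw (m + 1)).differentiable_iteratedFDeriv (by exact_mod_cast Nat.lt_succ_self m)) ha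
    ((norm_nonneg _).trans (hb x)) (fun y z ↦ ?_) x
  refine le_trans (le_of_eq ?_) (norm_iteratedFDeriv_sub_le hw hb y z)
  rw [fderiv_iteratedFDeriv]
  simp only [Function.comp_apply]
  rw [← dist_eq_norm, ← dist_eq_norm, LinearIsometryEquiv.dist_map]

end Landau

section Family
variable {T E : Type*} [NormedAddCommGroup E] [NormedSpace ℝ E]

/-- The supremum of the `(m+1)`-st derivatives of a family of functions. -/
def supDeriv (w : T → E → ℝ) (m : ℕ) : ℝ := ⨆ i : T × E, ‖iteratedFDeriv ℝ (m + 1) (w i.1) i.2‖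

theorem supDeriv_nonneg (w : T → E → ℝ) (m : ℕ) : 0 ≤ supDeriv w m :=
  Real.iSup_nonneg fun _ ↦ norm_nonneg _

theorem supDeriv_le {w : T → E → ℝ} {m : ℕ} {C : ℝ} [Nonempty T]
    (h : ∀ t x, ‖iteratedFDeriv ℝ (m + 1) (w t) x‖ ≤ C) : supDeriv w m ≤ C :=
  ciSup_le fun i ↦ h i.1 i.2

theorem le_supDeriv {w : T → E → ℝ} {m : ℕ}
    (h : ∃ C, ∀ t x, ‖iteratedFDeriv ℝ (m + 1) (w t) x‖ ≤ C) (t : T) (x : E) :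
    ‖iteratedFDeriv ℝ (m + 1) (w t) x‖ ≤ supDeriv w m := by
  obtain ⟨C, hC⟩ := h
  refine le_ciSup (f := fun i : T × E ↦ ‖iteratedFDeriv ℝ (m + 1) (w i.1) i.2‖) ⟨C, ?_⟩ (t, x)
  rintro _ ⟨i, rfl⟩
  exact hC i.1 i.2

theorem supDeriv_sq_le [Nonempty T] {w : T → E → ℝ} (hw : ∀ t, ∀ n : ℕ, ContDiff ℝ n (w t))
    (h : ∀ m, ∃ C, ∀ t x, ‖iteratedFDeriv ℝ (m + 1) (w t) x‖ ≤ C) (m : ℕ) :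
    supDeriv w (m + 1) ^ 2 ≤ 8 * supDeriv w m * supDeriv w (m + 2) := by
  have h0 : 0 ≤ 8 * supDeriv w m * supDeriv w (m + 2) :=
    mul_nonneg (mul_nonneg (by norm_num) (supDeriv_nonneg _ _)) (supDeriv_nonneg _ _)
  refine (Real.le_sqrt (supDeriv_nonneg _ _) h0).1 (supDeriv_le fun t x ↦ ?_)
  exact Real.le_sqrt_of_sq_le (sq_norm_iteratedFDeriv_le (hw t) (le_supDeriv (h m) t)
    (le_supDeriv (h (m + 2)) t) x)

end Family

/-- The point with `i`-th coordinate `t` and `j`-th coordinate `s`. -/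
def planePt (i j : Fin 2) (t s : ℝ) : Plane :=
  t • EuclideanSpace.single i (1:ℝ) + s • EuclideanSpace.single j (1:ℝ)

theorem planePt_apply_left {i j : Fin 2} (hij : i ≠ j) (t s : ℝ) : planePt i j t s i = t := by
  simp [planePt, hij]

theorem planePt_apply_right {i j : Fin 2} (hij : i ≠ j) (t s : ℝ) : planePt i j t s j = s := by
  simp [planePt, hij.symm]

theorem planePt_eta {i j : Fin 2} (hij : i ≠ j) (z : Plane) : planePt i j (z i) (z j) = z := by
  ext l
  fin_cases i <;> fin_cases j <;> fin_cases l <;> simp_all [planePt]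

theorem measurePreserving_planePt {i j : Fin 2} (hij : i ≠ j) :
    MeasurePreserving (fun w : ℝ × ℝ ↦ planePt i j w.1 w.2) volume volume := by
  have h1 : MeasurePreserving (fun w : ℝ × ℝ ↦ planePt 0 1 w.1 w.2) volume volume := by
    have h2 := ((EuclideanSpace.volume_preserving_symm_measurableEquiv_toLp (Fin 2)).symm.comp
      (volume_preserving_finTwoArrow ℝ).symm)
    have e : (fun w : ℝ × ℝ ↦ planePt 0 1 w.1 w.2) =
        (MeasurableEquiv.toLp 2 (Fin 2 → ℝ)).symm.symm ∘ MeasurableEquiv.finTwoArrow.symm := by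
      funext w
      ext l
      fin_cases l <;> simp [planePt]
    rw [e]
    exact h2
  fin_cases i <;> fin_cases j
  · exact absurd rfl hij
  · exact h1
  · have e : (fun w : ℝ × ℝ ↦ planePt 1 0 w.1 w.2) =
        (fun w : ℝ × ℝ ↦ planePt 0 1 w.1 w.2) ∘ Prod.swap := by
      funext w
      simp [planePt, add_comm]
    have h2 := h1.comp (Measure.measurePreserving_swap (μ := (volume : Measure ℝ)) (ν := volume))
    rw [← e] at h2
    exact h2
  · exact absurd rfl hij

theorem lintegral_planePt {i j : Fin 2} (hij : i ≠ j) {f : Plane → ℝ≥0∞} (hf : Measurable f) :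
    ∫⁻ s, ∫⁻ t, f (planePt i j t s) = ∫⁻ z, f z := by
  have h := measurePreserving_planePt hij
  rw [← h.lintegral_comp hf, Measure.volume_eq_prod, lintegral_prod_symm]
  exact (hf.comp h.measurable).aemeasurable

theorem hasDerivAt_planePt_left (i j : Fin 2) (t s : ℝ) :
    HasDerivAt (fun t ↦ planePt i j t s) (EuclideanSpace.single i (1:ℝ)) t := by
  simpa [planePt] using ((hasDerivAt_id t).smul_const (EuclideanSpace.single i (1:ℝ) : Plane)).add_const
    (s • EuclideanSpace.single j (1:ℝ))

theorem hasDerivAt_planePt_right (i j : Fin 2) (t s : ℝ) :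
    HasDerivAt (fun s ↦ planePt i j t s) (EuclideanSpace.single j (1:ℝ)) s := by
  simpa [planePt] using ((hasDerivAt_id s).smul_const (EuclideanSpace.single j (1:ℝ) : Plane)).const_add
    (t • EuclideanSpace.single i (1:ℝ))

theorem contDiff_planePt_left (i j : Fin 2) (s : ℝ) {n : ℕ} :
    ContDiff ℝ n fun t ↦ planePt i j t s := by
  unfold planePt; fun_prop

theorem contDiff_planePt_right (i j : Fin 2) (t : ℝ) {n : ℕ} :
    ContDiff ℝ n fun s ↦ planePt i j t s := by
  unfold planePt; fun_prop

theorem hasCompactSupport_comp_planePt {i j : Fin 2} (hij : i ≠ j) {g : Plane → ℝ}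
    (hg : HasCompactSupport g) (t : ℝ) : HasCompactSupport fun s ↦ g (planePt i j t s) := by
  refine hg.comp_isClosedEmbedding (g := fun s ↦ planePt i j t s) ?_
  refine Topology.IsClosedEmbedding.of_continuous_injective_isClosedMap
    (contDiff_planePt_right i j t (n := 0)).continuous (fun s s' h ↦ ?_) ?_
  · simpa [planePt_apply_right hij] using congrArg (fun z : Plane ↦ z j) h
  · intro S hS
    have : (fun s ↦ planePt i j t s) '' S = {z | z i = t} ∩ (fun z : Plane ↦ z j) ⁻¹' S := by
      ext z
      constructor
      · rintro ⟨s, hs, rfl⟩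
        exact ⟨planePt_apply_left hij t s, by simpa [planePt_apply_right hij] using hs⟩
      · rintro ⟨h1, h2⟩
        refine ⟨z j, h2, ?_⟩
        have h3 : z i = t := h1
        rw [← h3]
        exact planePt_eta hij z
    rw [this]
    exact (isClosed_eq (by fun_prop) continuous_const).inter (hS.preimage (by fun_prop))

/-- A difference along one coordinate direction of a compactly supported function is controlled
by the integral of the mixed second derivative over a strip. -/
theorem enorm_sub_le_lintegral_strip {i j : Fin 2} (hij : i ≠ j) {g : Plane → ℝ}
    (hg : ContDiff ℝ 2 g) (hgs : HasCompactSupport g) {M : Plane → ℝ≥0∞} (hM : Measurable M)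
    (hgM : ∀ z, ‖fderiv ℝ (fun y ↦ fderiv ℝ g y (EuclideanSpace.single j (1:ℝ))) z
      (EuclideanSpace.single i (1:ℝ))‖ₑ ≤ M z) {a a' : ℝ} (ha : a ≤ a') (s : ℝ) :
    ‖g (planePt i j a' s) - g (planePt i j a s)‖ₑ ≤ ∫⁻ z in {z : Plane | z i ∈ Set.Icc a a'}, M z := by
  set H : Plane → ℝ := fun y ↦ fderiv ℝ g y (EuclideanSpace.single j (1:ℝ)) with hH
  have hH1 : ContDiff ℝ 1 H := (hg.fderiv_right (m := 1) (by norm_num)).clm_apply contDiff_const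
  have hg1 : Differentiable ℝ g := hg.differentiable (by simp)
  set φ : ℝ → ℝ := fun s ↦ g (planePt i j a' s) - g (planePt i j a s) with hφ
  have hφd : ∀ s, HasDerivAt φ (H (planePt i j a' s) - H (planePt i j a s)) s := fun s ↦
    ((hg1 _).hasFDerivAt.comp_hasDerivAt s (hasDerivAt_planePt_right i j a' s)).sub
      ((hg1 _).hasFDerivAt.comp_hasDerivAt s (hasDerivAt_planePt_right i j a s))
  have hφ1 : ContDiff ℝ 1 φ :=
    ((hg.of_le (by norm_num)).comp (contDiff_planePt_right i j a' (n := 1))).sub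
      ((hg.of_le (by norm_num)).comp (contDiff_planePt_right i j a (n := 1)))
  have hφs : HasCompactSupport φ :=
    (hasCompactSupport_comp_planePt hij hgs a').sub (hasCompactSupport_comp_planePt hij hgs a)
  have h1 := hφs.enorm_le_lintegral_Ici_deriv hφ1 s
  have hS : MeasurableSet {z : Plane | z i ∈ Set.Icc a a'} :=
    measurableSet_Icc.preimage (by fun_prop : Measurable fun z : Plane ↦ z i)
  have h2 : ∀ s, ‖deriv φ s‖ₑ ≤
      ∫⁻ t, {z : Plane | z i ∈ Set.Icc a a'}.indicator M (planePt i j t s) := by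
    intro s
    rw [(hφd s).deriv]
    have h3 : ContDiff ℝ 1 fun t ↦ H (planePt i j t s) := hH1.comp (contDiff_planePt_left i j s (n := 1))
    refine (enorm_sub_le_lintegral_deriv_of_contDiffOn_Icc h3.contDiffOn ha).trans ?_
    rw [← lintegral_indicator measurableSet_Icc]
    refine lintegral_mono fun t ↦ ?_
    by_cases ht : t ∈ Set.Icc a a'
    · rw [Set.indicator_of_mem ht, Set.indicator_of_mem (by simpa [planePt_apply_left hij] using ht)]
      have h4 := (hH1.differentiable (by simp) (planePt i j t s)).hasFDerivAt.comp_hasDerivAt t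
        (hasDerivAt_planePt_left i j t s)
      refine le_trans (le_of_eq ?_) (hgM _)
      rw [← h4.deriv]
      rfl
    · rw [Set.indicator_of_notMem ht]
      exact zero_le
  calc ‖φ s‖ₑ ≤ ∫⁻ s in Set.Iic s, ‖deriv φ s‖ₑ := h1
    _ ≤ ∫⁻ s, ‖deriv φ s‖ₑ := setLIntegral_le_lintegral _ _
    _ ≤ ∫⁻ s, ∫⁻ t, {z : Plane | z i ∈ Set.Icc a a'}.indicator M (planePt i j t s) := lintegral_mono h2
    _ = _ := by rw [lintegral_planePt hij (hM.indicator hS), lintegral_indicator hS]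

theorem volume_strip_inter_le {i j : Fin 2} (hij : i ≠ j) (x : Plane) (R a a' : ℝ) :
    volume ({z : Plane | z i ∈ Set.Icc a a'} ∩ Metric.closedBall x R) ≤
      ENNReal.ofReal (a' - a) * ENNReal.ofReal (2 * R) := by
  have hS : MeasurableSet ({z : Plane | z i ∈ Set.Icc a a'} ∩ {z : Plane | z j ∈ Set.Icc (x j - R) (x j + R)}) :=
    (measurableSet_Icc.preimage (by fun_prop : Measurable fun z : Plane ↦ z i)).inter
      (measurableSet_Icc.preimage (by fun_prop : Measurable fun z : Plane ↦ z j))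
  calc volume ({z : Plane | z i ∈ Set.Icc a a'} ∩ Metric.closedBall x R)
      ≤ volume ({z : Plane | z i ∈ Set.Icc a a'} ∩ {z : Plane | z j ∈ Set.Icc (x j - R) (x j + R)}) := by
        refine measure_mono (Set.inter_subset_inter_right _ fun z hz ↦ ?_)
        have h1 : |z j - x j| ≤ R := by
          have := PiLp.norm_apply_le (z - x) j
          rw [mem_closedBall_iff_norm] at hz
          exact (by simpa using this : |z j - x j| ≤ ‖z - x‖).trans hz
        rw [abs_le] at h1
        exact ⟨by linarith, by linarith⟩
    _ = volume (Set.Icc a a' ×ˢ Set.Icc (x j - R) (x j + R)) := by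
        rw [← (measurePreserving_planePt hij).measure_preimage hS.nullMeasurableSet]
        congr 1
        ext w
        simp only [Set.mem_preimage, Set.mem_inter_iff, Set.mem_ofPred_eq, planePt_apply_left hij,
          planePt_apply_right hij, Set.mem_prod]
    _ = _ := by
        rw [Measure.volume_eq_prod, Measure.prod_prod, Real.volume_Icc, Real.volume_Icc]
        congr 2
        ring

/-- The Hölder bound along one coordinate direction from an `L^q` bound on the mixed second
derivative. -/
theorem enorm_sub_le_eLpNorm {i j : Fin 2} (hij : i ≠ j) {g : Plane → ℝ}
    (hg : ContDiff ℝ 2 g) (hgs : HasCompactSupport g) {M : Plane → ℝ} (hM : Measurable M)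
    (hgM : ∀ z, ‖fderiv ℝ (fun y ↦ fderiv ℝ g y (EuclideanSpace.single j (1:ℝ))) z
      (EuclideanSpace.single i (1:ℝ))‖ₑ ≤ ‖M z‖ₑ) {x : Plane} {R : ℝ}
    (hMs : ∀ z, R < ‖z - x‖ → M z = 0) {q : ℝ≥0∞} (hq : 1 ≤ q) (a a' : ℝ) (s : ℝ) :
    ‖g (planePt i j a' s) - g (planePt i j a s)‖ₑ ≤
      eLpNorm M q volume * (ENNReal.ofReal |a' - a| * ENNReal.ofReal (2 * R)) ^ (1 - 1 / q.toReal) := by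
  wlog ha : a ≤ a' generalizing a a' with H
  · rw [abs_sub_comm, ← enorm_neg, neg_sub]
    exact H a' a (le_of_not_ge ha)
  rw [abs_of_nonneg (sub_nonneg.2 ha)]
  have hS : MeasurableSet {z : Plane | z i ∈ Set.Icc a a'} :=
    measurableSet_Icc.preimage (by fun_prop : Measurable fun z : Plane ↦ z i)
  set S := {z : Plane | z i ∈ Set.Icc a a'} ∩ Metric.closedBall x R with hSdef
  refine (enorm_sub_le_lintegral_strip hij hg hgs hM.enorm hgM ha s).trans ?_
  have h1 : ∫⁻ z in {z : Plane | z i ∈ Set.Icc a a'}, ‖M z‖ₑ = ∫⁻ z in S, ‖M z‖ₑ := by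
    rw [← lintegral_indicator hS, ← lintegral_indicator (hS.inter measurableSet_closedBall)]
    refine lintegral_congr fun z ↦ ?_
    rw [← Set.indicator_indicator]
    congr 1
    refine (Set.indicator_eq_self.2 fun y hy ↦ ?_).symm
    by_contra hy'
    rw [mem_closedBall_iff_norm, not_le] at hy'
    simp [hMs y hy'] at hy
  rw [h1, ← eLpNorm_one_eq_lintegral_enorm]
  refine (eLpNorm_le_eLpNorm_mul_rpow_measure_univ hq hM.aestronglyMeasurable).trans ?_
  have hα : 0 ≤ 1 - 1 / q.toReal := by
    rcases eq_or_ne q ⊤ with rfl | hq'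
    · simp
    · have : 1 ≤ q.toReal := by simpa using ENNReal.toReal_mono hq' hq
      rw [sub_nonneg, div_le_one (by linarith)]
      exact this
  rw [ENNReal.toReal_one, div_one]
  gcongr
  · exact Measure.restrict_le_self
  · rw [Measure.restrict_apply_univ]
    exact volume_strip_inter_le hij x R a a'

/-- The Hölder exponent of the embedding of `W^{2,q}` (mixed derivatives) in the plane. -/
def holderExp (q : ℝ≥0∞) : ℝ := 1 - 1 / q.toReal

theorem holderExp_pos {q : ℝ≥0∞} (hq : 1 < q) : 0 < holderExp q := by
  unfold holderExp
  rcases eq_or_ne q ⊤ with rfl | hq'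
  · simp
  · have : 1 < q.toReal := by simpa using (ENNReal.toReal_lt_toReal (by simp) hq').2 hq
    rw [sub_pos, div_lt_one (by linarith)]
    exact this

theorem holderExp_le_one (q : ℝ≥0∞) : holderExp q ≤ 1 := by
  have : 0 ≤ 1 / q.toReal := by positivity
  unfold holderExp
  linarith

theorem hasCompactSupport_of_eq_zero {F : Type*} [Zero F] {g : Plane → F} {x : Plane} {R : ℝ}
    (h : ∀ z, R < ‖z - x‖ → g z = 0) : HasCompactSupport g :=
  HasCompactSupport.intro (isCompact_closedBall x R) fun z hz ↦ h z (by
    rwa [mem_closedBall_iff_norm, not_le] at hz)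

section
variable {g M : Plane → ℝ} {x : Plane} {q : ℝ≥0∞} {D : ℝ}

theorem abs_planePt_sub_le {i j : Fin 2} (hij : i ≠ j) (hg : ContDiff ℝ 2 g)
    (hgs : ∀ z, 4 < ‖z - x‖ → g z = 0) (hM : Measurable M) (hMs : ∀ z, 4 < ‖z - x‖ → M z = 0)
    (hgM : ∀ i j : Fin 2, ∀ z, ‖fderiv ℝ (fun y ↦ fderiv ℝ g y (EuclideanSpace.single j (1:ℝ))) z
      (EuclideanSpace.single i (1:ℝ))‖ₑ ≤ ‖M z‖ₑ) (hq : 1 < q) (hD0 : 0 ≤ D)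
    (hD : eLpNorm M q volume ≤ ENNReal.ofReal D) (a a' s : ℝ) :
    |g (planePt i j a' s) - g (planePt i j a s)| ≤ 8 * D * |a' - a| ^ holderExp q := by
  have h1 := enorm_sub_le_eLpNorm hij hg (hasCompactSupport_of_eq_zero hgs) hM (hgM i j) hMs hq.le a a' s
  have h2 : eLpNorm M q volume * (ENNReal.ofReal |a' - a| * ENNReal.ofReal (2 * 4)) ^ (1 - 1 / q.toReal) ≤
      ENNReal.ofReal (8 * D * |a' - a| ^ holderExp q) := by
    rw [← ENNReal.ofReal_mul (abs_nonneg _), show 1 - 1 / q.toReal = holderExp q from rfl,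
      ENNReal.ofReal_rpow_of_nonneg (by positivity) (holderExp_pos hq).le]
    refine (mul_le_mul_left hD _).trans ?_
    rw [← ENNReal.ofReal_mul hD0]
    refine ENNReal.ofReal_le_ofReal ?_
    rw [Real.mul_rpow (abs_nonneg _) (by norm_num)]
    have h3 : ((2:ℝ) * 4) ^ holderExp q ≤ 8 := by
      calc ((2:ℝ) * 4) ^ holderExp q ≤ ((2:ℝ) * 4) ^ (1:ℝ) :=
            Real.rpow_le_rpow_of_exponent_le (by norm_num) (holderExp_le_one q)
        _ = 8 := by norm_num
    calc D * (|a' - a| ^ holderExp q * (2 * 4) ^ holderExp q)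
        ≤ D * (|a' - a| ^ holderExp q * 8) := by gcongr
      _ = _ := by ring
  have h4 := h1.trans h2
  rw [Real.enorm_eq_ofReal_abs] at h4
  exact (ENNReal.ofReal_le_ofReal_iff (by positivity)).1 h4

theorem abs_add_sub_le (hg : ContDiff ℝ 2 g)
    (hgs : ∀ z, 4 < ‖z - x‖ → g z = 0) (hM : Measurable M) (hMs : ∀ z, 4 < ‖z - x‖ → M z = 0)
    (hgM : ∀ i j : Fin 2, ∀ z, ‖fderiv ℝ (fun y ↦ fderiv ℝ g y (EuclideanSpace.single j (1:ℝ))) z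
      (EuclideanSpace.single i (1:ℝ))‖ₑ ≤ ‖M z‖ₑ) (hq : 1 < q) (hD0 : 0 ≤ D)
    (hD : eLpNorm M q volume ≤ ENNReal.ofReal D) (y τ : Plane) :
    |g (y + τ) - g y| ≤ 16 * D * ‖τ‖ ^ holderExp q := by
  have h1 := abs_planePt_sub_le (i := 0) (j := 1) (by simp) hg hgs hM hMs hgM hq hD0 hD
    (y 0) (y 0 + τ 0) (y 1 + τ 1)
  have h2 := abs_planePt_sub_le (i := 1) (j := 0) (by simp) hg hgs hM hMs hgM hq hD0 hD
    (y 1) (y 1 + τ 1) (y 0)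
  have e1 : planePt 0 1 (y 0 + τ 0) (y 1 + τ 1) = y + τ := planePt_eta (by simp) (y + τ)
  have e2 : planePt 1 0 (y 1) (y 0) = y := planePt_eta (by simp) y
  have e3 : planePt 0 1 (y 0) (y 1 + τ 1) = planePt 1 0 (y 1 + τ 1) (y 0) := by
    simp [planePt, add_comm]
  rw [e1, e3] at h1
  rw [e2] at h2
  have h3 : ∀ i, |y i + τ i - y i| ^ holderExp q ≤ ‖τ‖ ^ holderExp q := by
    intro i
    refine Real.rpow_le_rpow (abs_nonneg _) ?_ (holderExp_pos hq).le
    rw [add_sub_cancel_left]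
    exact PiLp.norm_apply_le τ i
  calc |g (y + τ) - g y| ≤ |g (y + τ) - g (planePt 1 0 (y 1 + τ 1) (y 0))| +
        |g (planePt 1 0 (y 1 + τ 1) (y 0)) - g y| := abs_sub_le _ _ _
    _ ≤ 8 * D * ‖τ‖ ^ holderExp q + 8 * D * ‖τ‖ ^ holderExp q := by
        refine add_le_add (h1.trans ?_) (h2.trans ?_)
        · exact mul_le_mul_of_nonneg_left (h3 0) (by positivity)
        · exact mul_le_mul_of_nonneg_left (h3 1) (by positivity)
    _ = _ := by ring

theorem abs_le_of_eLpNorm_le (hg : ContDiff ℝ 2 g)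
    (hgs : ∀ z, 4 < ‖z - x‖ → g z = 0) (hM : Measurable M) (hMs : ∀ z, 4 < ‖z - x‖ → M z = 0)
    (hgM : ∀ i j : Fin 2, ∀ z, ‖fderiv ℝ (fun y ↦ fderiv ℝ g y (EuclideanSpace.single j (1:ℝ))) z
      (EuclideanSpace.single i (1:ℝ))‖ₑ ≤ ‖M z‖ₑ) (hq : 1 < q) (hD0 : 0 ≤ D)
    (hD : eLpNorm M q volume ≤ ENNReal.ofReal D) (y : Plane) : |g y| ≤ 144 * D := by
  rcases lt_or_ge 4 ‖y - x‖ with hy | hy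
  · rw [hgs y hy, abs_zero]; positivity
  set τ : Plane := EuclideanSpace.single 0 9
  have hτ : ‖τ‖ = 9 := by simp [τ]
  have h1 := abs_add_sub_le hg hgs hM hMs hgM hq hD0 hD y τ
  have h2 : g (y + τ) = 0 := hgs _ (by
    have := norm_sub_norm_le τ (x - y)
    rw [hτ, norm_sub_rev x y] at this
    rw [show y + τ - x = τ - (x - y) by abel]
    linarith)
  have h3 : ‖τ‖ ^ holderExp q ≤ 9 := by
    rw [hτ]
    calc (9:ℝ) ^ holderExp q ≤ 9 ^ (1:ℝ) :=
          Real.rpow_le_rpow_of_exponent_le (by norm_num) (holderExp_le_one q)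
      _ = 9 := by norm_num
  rw [h2, zero_sub, abs_neg] at h1
  calc |g y| ≤ 16 * D * ‖τ‖ ^ holderExp q := h1
    _ ≤ 16 * D * 9 := by gcongr
    _ = _ := by ring
end

section
variable {u : Plane → ℝ} {x : Plane} {q : ℝ≥0∞} {D : ℝ}

theorem iteratedFDeriv_eq_zero_of_vanish (hs : ∀ z, 4 < ‖z - x‖ → u z = 0) (n : ℕ) {z : Plane}
    (hz : 4 < ‖z - x‖) : iteratedFDeriv ℝ n u z = 0 := by
  have h1 : u =ᶠ[nhds z] fun _ ↦ 0 := by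
    have h2 : {z : Plane | 4 < ‖z - x‖} ∈ nhds z :=
      (isOpen_lt continuous_const (by fun_prop)).mem_nhds hz
    filter_upwards [h2] with w hw using hs w hw
  rw [(Filter.EventuallyEq.iteratedFDeriv ℝ h1 n).eq_of_nhds]
  simp

theorem abs_wordDeriv_le (u : Plane → ℝ) {n : ℕ} (m : Fin n → Fin 2) (y : Plane) :
    |wordDeriv u m y| ≤ ‖iteratedFDeriv ℝ n u y‖ := by
  have := (iteratedFDeriv ℝ n u y).le_opNorm fun i ↦ EuclideanSpace.single (m i) (1:ℝ)
  simpa [wordDeriv] using this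

theorem fderiv_fderiv_wordDeriv (hu : ∀ n : ℕ, ContDiff ℝ n u) {n : ℕ} (m : Fin n → Fin 2)
    (i j : Fin 2) (z : Plane) :
    fderiv ℝ (fun y ↦ fderiv ℝ (wordDeriv u m) y (EuclideanSpace.single j (1:ℝ))) z
      (EuclideanSpace.single i (1:ℝ)) = wordDeriv u (Fin.cons i (Fin.cons j m : Fin (n + 1) → Fin 2) : Fin (n + 2) → Fin 2) z := by
  simp_rw [fderiv_wordDeriv_single hu m]
  exact fderiv_wordDeriv_single hu _ z i

theorem contDiff_wordDeriv (hu : ∀ n : ℕ, ContDiff ℝ n u) {n : ℕ} (m : Fin n → Fin 2) (l : ℕ) :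
    ContDiff ℝ l (wordDeriv u m) :=
  (ContinuousMultilinearMap.apply ℝ (fun _ : Fin n ↦ Plane) ℝ
    fun i ↦ EuclideanSpace.single (m i) (1:ℝ)).contDiff.comp
    ((hu (l + n)).iteratedFDeriv_right (by norm_cast))

theorem norm_iteratedFDeriv_embedding (hu : ∀ n : ℕ, ContDiff ℝ n u)
    (hs : ∀ z, 4 < ‖z - x‖ → u z = 0) (hq : 1 < q) (hD0 : 0 ≤ D) {n : ℕ}
    (hD : eLpNorm (iteratedFDeriv ℝ (n + 2) u) q volume ≤ ENNReal.ofReal D) :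
    (∀ y, ‖iteratedFDeriv ℝ n u y‖ ≤ 2 ^ n * (144 * D)) ∧
    ∀ y τ, ‖iteratedFDeriv ℝ n u (y + τ) - iteratedFDeriv ℝ n u y‖ ≤
      2 ^ n * (144 * D) * ‖τ‖ ^ holderExp q := by
  set M : Plane → ℝ := fun z ↦ ‖iteratedFDeriv ℝ (n + 2) u z‖ with hMdef
  have hM : Measurable M := ((hu (n + 2)).continuous_iteratedFDeriv le_rfl).norm.measurable
  have hMs : ∀ z, 4 < ‖z - x‖ → M z = 0 := fun z hz ↦ by
    simp [hMdef, iteratedFDeriv_eq_zero_of_vanish hs _ hz]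
  have hMD : eLpNorm M q volume ≤ ENNReal.ofReal D := by rwa [hMdef, eLpNorm_norm]
  have hgs : ∀ (m : Fin n → Fin 2) (z : Plane), 4 < ‖z - x‖ → wordDeriv u m z = 0 := fun m z hz ↦ by
    simp [wordDeriv, iteratedFDeriv_eq_zero_of_vanish hs _ hz]
  have hgM : ∀ (m : Fin n → Fin 2) (i j : Fin 2), ∀ z,
      ‖fderiv ℝ (fun y ↦ fderiv ℝ (wordDeriv u m) y (EuclideanSpace.single j (1:ℝ))) z
        (EuclideanSpace.single i (1:ℝ))‖ₑ ≤ ‖M z‖ₑ := fun m i j z ↦ by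
    rw [fderiv_fderiv_wordDeriv hu, enorm_le_iff_norm_le, hMdef, norm_norm]
    exact abs_wordDeriv_le u _ z
  constructor
  · intro y
    refine (norm_le_sum_words _).trans ((Finset.sum_le_sum fun m _ ↦
      abs_le_of_eLpNorm_le (contDiff_wordDeriv hu m 2) (hgs m) hM hMs (hgM m) hq hD0 hMD y).trans ?_)
    simp
  · intro y τ
    refine (norm_le_sum_words _).trans ((Finset.sum_le_sum fun m _ ↦
      abs_add_sub_le (contDiff_wordDeriv hu m 2) (hgs m) hM hMs (hgM m) hq hD0 hMD y τ).trans ?_)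
    have h1 : 0 ≤ ‖τ‖ ^ holderExp q := by positivity
    simp only [Finset.sum_const, Finset.card_univ, Fintype.card_fun, Fintype.card_fin, nsmul_eq_mul,
      Nat.cast_pow, Nat.cast_ofNat]
    rw [mul_assoc (2 ^ n : ℝ)]
    gcongr
    norm_num

end

/-- A smooth function can be localized to a ball with uniform control of its derivatives. -/
theorem exists_localizer (K : ℕ) : ∃ C : ℝ, 0 ≤ C ∧ ∀ (x : Plane) (h : Plane → ℝ),
    (∀ n : ℕ, ContDiff ℝ n h) → ∃ u : Plane → ℝ, (∀ n : ℕ, ContDiff ℝ n u) ∧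
      (∀ z, ‖z - x‖ < 3 → u z = h z) ∧ (∀ z, 4 < ‖z - x‖ → u z = 0) ∧
      ∀ n ≤ K, ∀ z, ‖iteratedFDeriv ℝ n u z‖ ≤
        C * ∑ j ∈ Finset.range (n + 1), ‖iteratedFDeriv ℝ j h z‖ := by
  let η : ContDiffBump (0 : Plane) := ⟨3, 4, by norm_num, by norm_num⟩
  have h1 : ∀ n : ℕ, ∃ C : ℝ, ∀ z, ‖iteratedFDeriv ℝ n η z‖ ≤ C := fun n ↦
    (η.hasCompactSupport.iteratedFDeriv n).exists_bound_of_continuous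
      (η.contDiff.continuous_iteratedFDeriv (n := n) le_rfl)
  choose C hC using h1
  have hC0 : ∀ n, 0 ≤ C n := fun n ↦ (norm_nonneg _).trans (hC n 0)
  refine ⟨2 ^ K * ∑ i ∈ Finset.range (K + 1), C i,
    mul_nonneg (by positivity) (Finset.sum_nonneg fun i _ ↦ hC0 i), fun x h hh ↦ ?_⟩
  have hη : ∀ n : ℕ, ContDiff ℝ n fun y ↦ η (y - x) := fun n ↦
    η.contDiff.comp (contDiff_id.sub contDiff_const)
  refine ⟨fun y ↦ η (y - x) * h y, fun n ↦ (hη n).mul (hh n), fun z hz ↦ ?_, fun z hz ↦ ?_,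
    fun n hn z ↦ ?_⟩
  · show η (z - x) * h z = _
    rw [η.one_of_mem_closedBall (by simpa using hz.le), one_mul]
  · show η (z - x) * h z = _
    rw [η.zero_of_le_dist (by simpa using hz.le), zero_mul]
  · refine (norm_iteratedFDeriv_mul_le (N := (n : WithTop ℕ∞)) (hη n) (hh n) z le_rfl).trans ?_
    have h2 : ∀ i ∈ Finset.range (n + 1), (n.choose i : ℝ) * ‖iteratedFDeriv ℝ i (fun y ↦ η (y - x)) z‖ *
        ‖iteratedFDeriv ℝ (n - i) h z‖ ≤
        (2 ^ K * ∑ i ∈ Finset.range (K + 1), C i) * ‖iteratedFDeriv ℝ (n - i) h z‖ := by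
      intro i hi
      have hi' := Finset.mem_range.1 hi
      have h3 : (n.choose i : ℝ) ≤ 2 ^ K := by
        have h4 : n.choose i ≤ 2 ^ K := (Nat.choose_le_two_pow n i).trans (Nat.pow_le_pow_right (by norm_num) hn)
        exact_mod_cast h4
      have h4 : ‖iteratedFDeriv ℝ i (fun y ↦ η (y - x)) z‖ ≤ ∑ i ∈ Finset.range (K + 1), C i := by
        rw [iteratedFDeriv_comp_sub]
        exact (hC i _).trans (Finset.single_le_sum (f := C) (fun i _ ↦ hC0 i)
          (Finset.mem_range.2 (by omega)))
      gcongr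
    refine (Finset.sum_le_sum h2).trans (le_of_eq ?_)
    rw [← Finset.mul_sum]
    congr 1
    exact Finset.sum_range_reflect (fun j ↦ ‖iteratedFDeriv ℝ j h z‖) (n + 1)

/-- A function together with its Hölder difference quotients. -/
def quotFamily (α : ℝ) (u : Plane → ℝ) : Option Plane → Plane → ℝ
  | none => u
  | some τ => fun y ↦ (‖τ‖ ^ α)⁻¹ • (u (y + τ) - u y)

theorem contDiff_quotFamily (α : ℝ) {u : Plane → ℝ} (hu : ∀ n : ℕ, ContDiff ℝ n u)
    (t : Option Plane) (n : ℕ) : ContDiff ℝ n (quotFamily α u t) := by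
  cases t with
  | none => exact hu n
  | some τ =>
    exact (((hu n).comp (contDiff_id.add contDiff_const)).sub (hu n)).const_smul _

theorem iteratedFDeriv_quotFamily_some (α : ℝ) {u : Plane → ℝ} (hu : ∀ n : ℕ, ContDiff ℝ n u)
    (τ : Plane) (n : ℕ) (y : Plane) : iteratedFDeriv ℝ n (quotFamily α u (some τ)) y =
      (‖τ‖ ^ α)⁻¹ • (iteratedFDeriv ℝ n u (y + τ) - iteratedFDeriv ℝ n u y) := by
  have h1 : ContDiff ℝ n fun y ↦ u (y + τ) := (hu n).comp (contDiff_id.add contDiff_const)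
  have h2 : quotFamily α u (some τ) = (‖τ‖ ^ α)⁻¹ • ((fun y ↦ u (y + τ)) - u) := rfl
  have h3 : ContDiff ℝ n ((fun y ↦ u (y + τ)) - u) := h1.sub (hu n)
  rw [h2, iteratedFDeriv_const_smul_apply h3.contDiffAt, iteratedFDeriv_sub h1 (hu n)]
  simp [iteratedFDeriv_comp_add_right]

theorem norm_iteratedFDeriv_quotFamily_le {α : ℝ} {u : Plane → ℝ} (hu : ∀ n : ℕ, ContDiff ℝ n u)
    {n : ℕ} {C : ℝ} (h1 : ∀ y, ‖iteratedFDeriv ℝ n u y‖ ≤ C)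
    (h2 : ∀ y τ, ‖iteratedFDeriv ℝ n u (y + τ) - iteratedFDeriv ℝ n u y‖ ≤ C * ‖τ‖ ^ α)
    (t : Option Plane) (y : Plane) : ‖iteratedFDeriv ℝ n (quotFamily α u t) y‖ ≤ C := by
  have hC : 0 ≤ C := (norm_nonneg _).trans (h1 0)
  cases t with
  | none => exact h1 y
  | some τ =>
    rw [iteratedFDeriv_quotFamily_some α hu, norm_smul, norm_inv, Real.norm_of_nonneg (by positivity)]
    rcases (by positivity : 0 ≤ ‖τ‖ ^ α).eq_or_lt with h | h
    · rw [← h]; simpa using hC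
    · rw [inv_mul_le_iff₀ h, mul_comm]
      exact h2 y τ

theorem norm_iteratedFDeriv_quotFamily_le_of_bound {α : ℝ} (hα : 0 < α) (hα1 : α ≤ 1) {u : Plane → ℝ}
    (hu : ∀ n : ℕ, ContDiff ℝ n u) {n : ℕ} {C : ℝ} (h1 : ∀ y, ‖iteratedFDeriv ℝ n u y‖ ≤ C)
    (h2 : ∀ y, ‖iteratedFDeriv ℝ (n + 1) u y‖ ≤ C)
    (t : Option Plane) (y : Plane) : ‖iteratedFDeriv ℝ n (quotFamily α u t) y‖ ≤ 2 * C := by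
  have hC : 0 ≤ C := (norm_nonneg _).trans (h1 0)
  refine norm_iteratedFDeriv_quotFamily_le hu (fun y ↦ (h1 y).trans (by linarith)) (fun y τ ↦ ?_) t y
  rcases le_total ‖τ‖ 1 with hτ | hτ
  · have h3 := norm_iteratedFDeriv_sub_le hu h2 y (y + τ)
    rw [add_sub_cancel_left] at h3
    have h4 : ‖τ‖ ≤ ‖τ‖ ^ α := by
      simpa using Real.rpow_le_rpow_of_exponent_ge' (norm_nonneg τ) hτ hα.le hα1
    refine h3.trans (mul_le_mul (by linarith) h4 (norm_nonneg _) (by linarith))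
  · have h4 : 1 ≤ ‖τ‖ ^ α := Real.one_le_rpow hτ hα.le
    calc _ ≤ ‖iteratedFDeriv ℝ n u (y + τ)‖ + ‖iteratedFDeriv ℝ n u y‖ := norm_sub_le _ _
      _ ≤ C + C := add_le_add (h1 _) (h1 _)
      _ = 2 * C * 1 := by ring
      _ ≤ _ := by gcongr

theorem exists_bound_of_vanish {u : Plane → ℝ} (hu : ∀ n : ℕ, ContDiff ℝ n u) {x : Plane}
    (hs : ∀ z, 4 < ‖z - x‖ → u z = 0) (n : ℕ) : ∃ C, ∀ y, ‖iteratedFDeriv ℝ n u y‖ ≤ C :=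
  (hasCompactSupport_of_eq_zero fun _ hz ↦ iteratedFDeriv_eq_zero_of_vanish hs n hz).exists_bound_of_continuous
    ((hu n).continuous_iteratedFDeriv le_rfl)

theorem exists_bound_quotFamily {α : ℝ} (hα : 0 < α) (hα1 : α ≤ 1) {u : Plane → ℝ}
    (hu : ∀ n : ℕ, ContDiff ℝ n u) {x : Plane} (hs : ∀ z, 4 < ‖z - x‖ → u z = 0) (m : ℕ) :
    ∃ C, ∀ t y, ‖iteratedFDeriv ℝ (m + 1) (quotFamily α u t) y‖ ≤ C := by
  obtain ⟨C, hC⟩ := exists_bound_of_vanish hu hs (m + 1)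
  obtain ⟨C', hC'⟩ := exists_bound_of_vanish hu hs (m + 2)
  exact ⟨2 * max C C', norm_iteratedFDeriv_quotFamily_le_of_bound hα hα1 hu
    (fun y ↦ (hC y).trans (le_max_left _ _)) fun y ↦ (hC' y).trans (le_max_right _ _)⟩

theorem prod_supDeriv_quotFamily_le {q : ℝ≥0∞} (hq : 1 < q) {u : Plane → ℝ}
    (hu : ∀ n : ℕ, ContDiff ℝ n u) {x : Plane} (hs : ∀ z, 4 < ‖z - x‖ → u z = 0) {E D : ℝ}
    (h1 : ∀ y, ‖iteratedFDeriv ℝ 1 u y‖ ≤ E) (h2 : ∀ y, ‖iteratedFDeriv ℝ 2 u y‖ ≤ E)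
    (hD0 : 0 ≤ D) {k : ℕ} (hD : ∀ m ≤ k, eLpNorm (iteratedFDeriv ℝ (m + 3) u) q volume ≤ ENNReal.ofReal D)
    {ι : Type*} [Fintype ι] [Nonempty ι] (b : ι → ℕ) (hb : ∑ i, b i ≤ k) :
    ∏ i, supDeriv (quotFamily (holderExp q) u) (b i) ≤
      8 ^ k ^ 2 * (2 * E) ^ (Fintype.card ι - 1) * (2 ^ (k + 1) * (144 * D)) := by
  have hE : 0 ≤ E := (norm_nonneg _).trans (h1 0)
  set A := supDeriv (quotFamily (holderExp q) u) with hA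
  have hA0 := supDeriv_nonneg (quotFamily (holderExp q) u)
  refine (prod_le_of_sq_le hA0 (supDeriv_sq_le (contDiff_quotFamily _ hu)
    (exists_bound_quotFamily (holderExp_pos hq) (holderExp_le_one q) hu hs)) b).trans ?_
  set s := ∑ i, b i
  have h3 : A 0 ≤ 2 * E := supDeriv_le fun t y ↦
    norm_iteratedFDeriv_quotFamily_le_of_bound (holderExp_pos hq) (holderExp_le_one q) hu h1 h2 t y
  have h4 : A s ≤ 2 ^ (k + 1) * (144 * D) := by
    have h5 := norm_iteratedFDeriv_embedding hu hs hq hD0 (hD s hb)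
    refine (supDeriv_le fun t y ↦ norm_iteratedFDeriv_quotFamily_le hu h5.1 h5.2 t y).trans ?_
    gcongr
    norm_num
  have := hA0 0
  have := hA0 s
  gcongr
  norm_num

theorem norm_fderiv_wordDeriv_le {u : Plane → ℝ} (hu : ∀ n : ℕ, ContDiff ℝ n u) {n : ℕ}
    (m : Fin n → Fin 2) (y : Plane) :
    ‖fderiv ℝ (wordDeriv u m) y‖ ≤ ‖iteratedFDeriv ℝ (n + 1) u y‖ := by
  refine ContinuousLinearMap.opNorm_le_bound _ (norm_nonneg _) fun v ↦ ?_
  rw [fderiv_wordDeriv_apply hu]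
  refine (ContinuousMultilinearMap.le_opNorm _ _).trans (le_of_eq ?_)
  simp [Fin.prod_univ_succ]

theorem norm_fderiv_wordDeriv_sub_le {u : Plane → ℝ} (hu : ∀ n : ℕ, ContDiff ℝ n u) {n : ℕ}
    (m : Fin n → Fin 2) (y y' : Plane) :
    ‖fderiv ℝ (wordDeriv u m) y' - fderiv ℝ (wordDeriv u m) y‖ ≤
      ‖iteratedFDeriv ℝ (n + 1) u y' - iteratedFDeriv ℝ (n + 1) u y‖ := by
  refine ContinuousLinearMap.opNorm_le_bound _ (norm_nonneg _) fun v ↦ ?_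
  rw [sub_apply, fderiv_wordDeriv_apply hu, fderiv_wordDeriv_apply hu, ← sub_apply]
  refine (ContinuousMultilinearMap.le_opNorm _ _).trans (le_of_eq ?_)
  simp [Fin.prod_univ_succ]

theorem fderiv_wordDeriv_congr {u h : Plane → ℝ} {x z : Plane} (hz : ‖z - x‖ < 3)
    (huh : ∀ z, ‖z - x‖ < 3 → u z = h z) {n : ℕ} (m : Fin n → Fin 2) :
    fderiv ℝ (wordDeriv h m) z = fderiv ℝ (wordDeriv u m) z := by
  have h1 : h =ᶠ[nhds z] u := by
    have h2 : {z : Plane | ‖z - x‖ < 3} ∈ nhds z :=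
      (isOpen_lt (by fun_prop) continuous_const).mem_nhds hz
    filter_upwards [h2] with w hw using (huh w hw).symm
  have h3 : wordDeriv h m =ᶠ[nhds z] wordDeriv u m := by
    filter_upwards [Filter.EventuallyEq.iteratedFDeriv ℝ h1 n] with w hw
    rw [wordDeriv, wordDeriv, hw]
  exact h3.fderiv_eq

theorem IsDer.norm_fderiv_le_supDeriv {α : ℝ} (hα : 0 < α) (hα1 : α ≤ 1) {u h : Plane → ℝ}
    (hu : ∀ n : ℕ, ContDiff ℝ n u) {x : Plane} (hs : ∀ z, 4 < ‖z - x‖ → u z = 0)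
    (huh : ∀ z, ‖z - x‖ < 3 → u z = h z) {b : ℕ} {ψ : Plane → ℝ} (hψ : IsDer b h ψ) :
    (∀ z : Plane, ‖z‖ ≤ 2 → ‖fderiv ℝ ψ (x - z)‖ ≤ supDeriv (quotFamily α u) b) ∧
      ∀ z : Plane, ‖z‖ ≤ 2 → ‖fderiv ℝ ψ (x - z) - fderiv ℝ ψ x‖ ≤
        supDeriv (quotFamily α u) b * ‖z‖ ^ α := by
  obtain ⟨m, rfl⟩ := hψ
  have hb := exists_bound_quotFamily hα hα1 hu hs b
  have h1 : ∀ z : Plane, ‖z‖ ≤ 2 → fderiv ℝ (wordDeriv h m) (x - z) = fderiv ℝ (wordDeriv u m) (x - z) :=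
    fun z hz ↦ fderiv_wordDeriv_congr (by rw [sub_sub_cancel_left, norm_neg]; linarith) huh m
  constructor
  · intro z hz
    rw [h1 z hz]
    exact (norm_fderiv_wordDeriv_le hu m _).trans (le_supDeriv hb none (x - z))
  · intro z hz
    have h2 := h1 0 (by simp)
    rw [sub_zero] at h2
    rw [h1 z hz, h2]
    refine (norm_fderiv_wordDeriv_sub_le hu m _ _).trans ?_
    rcases eq_or_ne z 0 with rfl | hz0
    · simp [Real.zero_rpow hα.ne']
    have h3 := le_supDeriv hb (some (-z)) x
    have h4 : 0 < ‖z‖ ^ α := by positivity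
    rw [iteratedFDeriv_quotFamily_some α hu, norm_smul, norm_inv, Real.norm_of_nonneg (by positivity),
      norm_neg, inv_mul_le_iff₀ h4, mul_comm, ← sub_eq_add_neg] at h3
    exact h3

/-- The `W^{K,q}` norm of `h` on the closed ball of radius `4` about `x`. -/
def localNorm (q : ℝ≥0∞) (K : ℕ) (h : Plane → ℝ) (x : Plane) : ℝ≥0∞ :=
  ∑ j ∈ Finset.range (K + 1), eLpNorm (iteratedFDeriv ℝ j h) q
    (volume.restrict (Metric.closedBall x 4))

theorem BddSmooth.localNorm_ne_top {h : Plane → ℝ} (hh : BddSmooth h) (q : ℝ≥0∞) (K : ℕ) (x : Plane) :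
    localNorm q K h x ≠ ⊤ := by
  refine ENNReal.sum_ne_top.2 fun j _ ↦ ?_
  obtain ⟨C, hC⟩ := hh.bdd j
  have : IsFiniteMeasure (volume.restrict (Metric.closedBall x 4)) :=
    ⟨by rw [Measure.restrict_apply_univ]; exact measure_closedBall_lt_top⟩
  exact (MemLp.of_bound ((hh.contDiff j).continuous_iteratedFDeriv (m := j) le_rfl).aestronglyMeasurable
    C (Filter.Eventually.of_forall hC)).eLpNorm_ne_top

theorem eLpNorm_le_localNorm {q : ℝ≥0∞} (hq : 1 ≤ q) {u h : Plane → ℝ} {x : Plane} {C : ℝ}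
    (hh : ∀ n : ℕ, ContDiff ℝ n h) (hs : ∀ z, 4 < ‖z - x‖ → u z = 0) {n K : ℕ} (hn : n ≤ K)
    (hu : ∀ z, ‖iteratedFDeriv ℝ n u z‖ ≤ C * ∑ j ∈ Finset.range (n + 1), ‖iteratedFDeriv ℝ j h z‖) :
    eLpNorm (iteratedFDeriv ℝ n u) q volume ≤ ENNReal.ofReal C * localNorm q K h x := by
  have hsupp : Function.support (iteratedFDeriv ℝ n u) ⊆ Metric.closedBall x 4 := by
    intro z hz
    by_contra hz'
    rw [mem_closedBall_iff_norm, not_le] at hz'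
    exact hz (iteratedFDeriv_eq_zero_of_vanish hs n hz')
  rw [← eLpNorm_restrict_eq_of_support_subset hsupp]
  set μ := (volume : Measure Plane).restrict (Metric.closedBall x 4)
  let g : ℕ → Plane → ℝ := fun j z ↦ ‖iteratedFDeriv ℝ j h z‖
  have h1 : ∀ z, ‖iteratedFDeriv ℝ n u z‖ ≤ C * ‖(∑ j ∈ Finset.range (n + 1), g j) z‖ := by
    intro z
    rw [Finset.sum_apply, Real.norm_of_nonneg (Finset.sum_nonneg fun _ _ ↦ norm_nonneg _)]
    exact hu z
  refine (eLpNorm_le_mul_eLpNorm_of_ae_le_mul (Filter.Eventually.of_forall h1) q).trans ?_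
  gcongr
  refine (eLpNorm_sum_le (fun j _ ↦ ((hh j).continuous_iteratedFDeriv
    (m := j) le_rfl).norm.aestronglyMeasurable) hq).trans ?_
  refine (Finset.sum_le_sum fun j _ ↦ (eLpNorm_norm (iteratedFDeriv ℝ j h)).le).trans ?_
  exact Finset.sum_le_sum_of_subset (Finset.range_mono (by omega))

theorem exists_enorm_iteratedFDeriv_diffOp_le {χ : Plane → ℝ} {L : ℝ} (hχ : IsCutoff χ L)
    {q : ℝ≥0∞} (hq : 1 < q) (k : ℕ) : ∃ C₁ C₂ : ℝ, 0 ≤ C₁ ∧ 0 ≤ C₂ ∧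
      ∀ (ι : Type) [Fintype ι] [DecidableEq ι] [Nonempty ι] (_ : Even (Fintype.card ι))
        (f h : Plane → ℝ) (_ : BddSmooth f) (_ : BddSmooth h) (E : ℝ)
        (_ : ∀ j ≤ 2, ∀ z, ‖iteratedFDeriv ℝ j h z‖ ≤ E) (n : ℕ) (_ : n ≤ k) (x : Plane),
        ‖iteratedFDeriv ℝ (n + 1) (diffOp χ f fun _ : ι ↦ h) x‖ₑ ≤
          ENNReal.ofReal (C₁ * (Fintype.card ι + 1) ^ (k + 2) * (C₂ * E) ^ (Fintype.card ι - 1)) *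
            localNorm q (k + 3) h x * derMajorant (holderExp q) k f x := by
  obtain ⟨C, hC, hloc⟩ := exists_localizer (k + 3)
  have hL : 0 ≤ L := (norm_nonneg _).trans (hχ.fderiv_le 0)
  have hW : 0 ≤ ∫ z : Plane, wt (holderExp q) z := integral_nonneg (wt_nonneg _)
  set W := ∫ z : Plane, wt (holderExp q) z
  refine ⟨2 ^ (k + 1) * (3 * (1 + L) * (1 + W) * 8 ^ k ^ 2 * (2 ^ (k + 1) * (144 * C))),
    6 * C, by positivity, by positivity, fun ι _ _ _ hN f h hf hh E hE n hnk x ↦ ?_⟩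
  obtain ⟨u, hu, huh, hus, hub⟩ := hloc x h hh.contDiff
  have hE0 : 0 ≤ E := (norm_nonneg _).trans (hE 0 (by norm_num) 0)
  set T := (localNorm q (k + 3) h x).toReal
  have hT : localNorm q (k + 3) h x = ENNReal.ofReal T :=
    (ENNReal.ofReal_toReal (hh.localNorm_ne_top q (k + 3) x)).symm
  have hT0 : 0 ≤ T := ENNReal.toReal_nonneg
  have hu2 : ∀ j ≤ 2, ∀ z, ‖iteratedFDeriv ℝ j u z‖ ≤ 3 * C * E := by
    intro j hj z
    refine (hub j (by omega) z).trans ?_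
    have : ∑ i ∈ Finset.range (j + 1), ‖iteratedFDeriv ℝ i h z‖ ≤ ∑ i ∈ Finset.range (j + 1), E :=
      Finset.sum_le_sum fun i hi ↦ hE i (by have := Finset.mem_range.1 hi; omega) z
    rw [Finset.sum_const, Finset.card_range, nsmul_eq_mul] at this
    have h3 : ((j + 1 : ℕ) : ℝ) ≤ 3 := by exact_mod_cast (by omega : j + 1 ≤ 3)
    calc _ ≤ C * (3 * E) := by gcongr; exact this.trans (by gcongr)
      _ = _ := by ring
  have hD : ∀ m ≤ k, eLpNorm (iteratedFDeriv ℝ (m + 3) u) q volume ≤ ENNReal.ofReal (C * T) := by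
    intro m hm
    rw [ENNReal.ofReal_mul hC, ← hT]
    exact eLpNorm_le_localNorm hq.le hh.contDiff hus (by omega) (hub (m + 3) (by omega))
  set R := 8 ^ k ^ 2 * (2 * (3 * C * E)) ^ (Fintype.card ι - 1) * (2 ^ (k + 1) * (144 * (C * T))) with hR
  have hR0 : 0 ≤ R := by positivity
  refine (enorm_iteratedFDeriv_diffOp_le hχ (holderExp_pos hq) hN hf hh (R := R)
    (A := supDeriv (quotFamily (holderExp q) u)) hnk
    (fun b ψ hψ ↦ hψ.norm_fderiv_le_supDeriv (holderExp_pos hq) (holderExp_le_one q) hu hus huh)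
    (fun b hb ↦ prod_supDeriv_quotFamily_le hq hu hus (hu2 1 (by norm_num)) (hu2 2 le_rfl) (by positivity)
      hD b (hb.trans hnk))).trans ?_
  refine mul_le_mul_left ?_ _
  rw [hT, ← ENNReal.ofReal_mul (by positivity)]
  have e1 : (2 : ℝ≥0∞) ^ (n + 1) * (Fintype.card ι + 1 : ℝ≥0∞) ^ n =
      ENNReal.ofReal (2 ^ (n + 1) * (Fintype.card ι + 1 : ℝ) ^ n) := by
    rw [ENNReal.ofReal_mul (by positivity), ENNReal.ofReal_pow (by positivity),
      ENNReal.ofReal_pow (by positivity), ENNReal.ofReal_add (by positivity) (by norm_num)]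
    simp
  rw [e1, ← ENNReal.ofReal_mul (by positivity)]
  refine ENNReal.ofReal_le_ofReal ?_
  calc _ ≤ 2 ^ (k + 1) * (Fintype.card ι + 1 : ℝ) ^ k *
        (3 * (Fintype.card ι + 1) ^ 2 * (1 + L) * (1 + W) * R) := by
        gcongr
        · norm_num
        · linarith [(Nat.cast_nonneg (Fintype.card ι) : (0:ℝ) ≤ _)]
    _ = _ := by
        rw [hR]
        ring

section
variable {α : Type*} [MeasurableSpace α] {μ : Measure α}

theorem eLpNorm_ennreal_eq {p : ℝ≥0∞} (hp0 : p ≠ 0) (hp : p ≠ ⊤) (a : α → ℝ≥0∞) :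
    eLpNorm a p μ = (∫⁻ x, a x ^ p.toReal ∂μ) ^ (1 / p.toReal) := by
  rw [eLpNorm_eq_lintegral_rpow_enorm_toReal hp0 hp]
  simp

theorem eLpNorm_ennreal_const_mul {p : ℝ≥0∞} (hp0 : p ≠ 0) (hp : p ≠ ⊤) (c : ℝ≥0∞) {a : α → ℝ≥0∞}
    (ha : Measurable a) : eLpNorm (fun x ↦ c * a x) p μ = c * eLpNorm a p μ := by
  have hp1 : 0 < p.toReal := ENNReal.toReal_pos hp0 hp
  rw [eLpNorm_ennreal_eq hp0 hp, eLpNorm_ennreal_eq hp0 hp]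
  simp_rw [ENNReal.mul_rpow_of_nonneg _ _ hp1.le]
  rw [lintegral_const_mul _ (ha.pow_const _), ENNReal.mul_rpow_of_nonneg _ _ (by positivity),
    ← ENNReal.rpow_mul, mul_one_div_cancel hp1.ne', ENNReal.rpow_one]

/-- Hölder's inequality for `ℝ≥0∞`-valued functions. -/
theorem eLpNorm_ennreal_mul_le {p q r : ℝ≥0∞} (hp : 1 < p) (hp' : p ≠ ⊤) (hq : 1 < q)
    (hr : r⁻¹ = p⁻¹ + q⁻¹) {a b : α → ℝ≥0∞} (ha : Measurable a) (hb : Measurable b) :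
    eLpNorm (fun x ↦ a x * b x) r μ ≤ eLpNorm a q μ * eLpNorm b p μ := by
  have hp0 : p ≠ 0 := (zero_lt_one.trans hp).ne'
  rcases eq_or_ne q ⊤ with rfl | hq'
  · have : r = p := by simpa using hr
    subst this
    rw [← eLpNorm_ennreal_const_mul hp0 hp' _ hb]
    refine eLpNorm_mono_enorm_ae ?_
    filter_upwards [enorm_ae_le_eLpNormEssSup a μ] with x hx
    rw [eLpNorm_exponent_top]
    exact mul_le_mul_left hx _
  · have hq0 : q ≠ 0 := (zero_lt_one.trans hq).ne'
    have hr0 : r ≠ 0 := by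
      rintro rfl
      have : p⁻¹ + q⁻¹ ≠ ⊤ := ENNReal.add_ne_top.2 ⟨by simpa, by simpa⟩
      rw [← hr] at this
      simp at this
    have hrt : r ≠ ⊤ := by
      rintro rfl
      rw [ENNReal.inv_top] at hr
      exact hp' (by simpa using (add_eq_zero.1 hr.symm).1)
    have hr1 : r.toReal⁻¹ = q.toReal⁻¹ + p.toReal⁻¹ := by
      rw [← ENNReal.toReal_inv, hr, ENNReal.toReal_add (by simpa) (by simpa), ENNReal.toReal_inv,
        ENNReal.toReal_inv, add_comm]
    have hr2 := ENNReal.toReal_pos hr0 hrt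
    have hp2 := ENNReal.toReal_pos hp0 hp'
    have hq2 := ENNReal.toReal_pos hq0 hq'
    rw [eLpNorm_ennreal_eq hr0 hrt, eLpNorm_ennreal_eq hq0 hq', eLpNorm_ennreal_eq hp0 hp']
    refine ENNReal.lintegral_Lp_mul_le_Lq_mul_Lr hr2 ?_ (by simpa using hr1) μ ha.aemeasurable
      hb.aemeasurable
    have : q.toReal⁻¹ < r.toReal⁻¹ := by rw [hr1]; linarith [inv_pos.2 hp2]
    exact (inv_lt_inv₀ hq2 hr2).1 this

theorem eLpNorm_ennreal_sum_le {p : ℝ≥0∞} (hp : 1 ≤ p) {ι : Type*} (s : Finset ι) {f : ι → α → ℝ≥0∞}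
    (hf : ∀ i, Measurable (f i)) :
    eLpNorm (fun x ↦ ∑ i ∈ s, f i x) p μ ≤ ∑ i ∈ s, eLpNorm (f i) p μ := by
  have e : (fun x ↦ ∑ i ∈ s, f i x) = ∑ i ∈ s, f i := by
    ext x
    rw [Finset.sum_apply]
  rw [e]
  exact eLpNorm_sum_le (fun i _ ↦ (hf i).aestronglyMeasurable) hp

end

theorem exists_eLpNorm_derMajorant_le {p : ℝ≥0∞} (hp : 1 < p) (hp' : p ≠ ⊤) {α : ℝ} (hα : 0 < α)
    (k : ℕ) : ∃ C : ℝ≥0∞, C ≠ ⊤ ∧ ∀ f : Plane → ℝ, BddSmooth f →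
      eLpNorm (derMajorant α k f) p volume ≤ C * sobNorm k p f := by
  have hp0 : p ≠ 0 := (zero_lt_one.trans hp).ne'
  have hp1 : 1 < p.toReal := by simpa using (ENNReal.toReal_lt_toReal (by simp) hp').2 hp
  obtain ⟨C, hC, hmaj⟩ := exists_majorant_bound hp1 hα
  refine ⟨2 ^ k * C ^ (1 / p.toReal), ENNReal.mul_ne_top (by simp)
    (ENNReal.rpow_ne_top_of_nonneg (by positivity) hC), fun f hf ↦ ?_⟩
  have hmeas : ∀ {a : ℕ} (m : Fin a → Fin 2), Measurable (majorant α (wordDeriv f m)) := fun {a} m ↦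
    measurable_majorant ((hf.bddSmooth_wordDeriv m).contDiff 0).continuous.measurable
  have hone : ∀ {a : ℕ} (m : Fin a → Fin 2), eLpNorm (majorant α (wordDeriv f m)) p volume ≤
      C ^ (1 / p.toReal) * eLpNorm (iteratedFDeriv ℝ a f) p volume := by
    intro a m
    obtain ⟨Λ, hΛ⟩ := (hf.bddSmooth_wordDeriv m).exists_lipschitzWith
    calc _ ≤ C ^ (1 / p.toReal) * eLpNorm (wordDeriv f m) p volume := by
          rw [eLpNorm_ennreal_eq hp0 hp', eLpNorm_eq_lintegral_rpow_enorm_toReal hp0 hp',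
            ← ENNReal.mul_rpow_of_nonneg _ _ (by positivity)]
          exact ENNReal.rpow_le_rpow (hmaj Λ _ hΛ) (by positivity)
      _ ≤ _ := by
          gcongr
          exact eLpNorm_mono fun y ↦ abs_wordDeriv_le f m y
  have hmeas' : ∀ a : ℕ, Measurable fun x ↦ ∑ m : Fin a → Fin 2, majorant α (wordDeriv f m) x := fun a ↦
    Finset.measurable_fun_sum _ fun m _ ↦ hmeas m
  refine (eLpNorm_ennreal_sum_le hp.le (Finset.range (k + 1)) hmeas').trans ?_
  rw [sobNorm, Finset.mul_sum]
  refine Finset.sum_le_sum fun a ha ↦ ?_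
  refine (eLpNorm_ennreal_sum_le hp.le Finset.univ fun m : Fin a → Fin 2 ↦ hmeas m).trans ?_
  refine (Finset.sum_le_sum fun m _ ↦ hone m).trans ?_
  rw [Finset.sum_const, Finset.card_univ, nsmul_eq_mul, ← mul_assoc]
  have hcard : (Fintype.card (Fin a → Fin 2) : ℝ≥0∞) ≤ 2 ^ k := by
    rw [Fintype.card_fun, Fintype.card_fin, Fintype.card_fin, Nat.cast_pow]
    exact pow_le_pow_right₀ (by norm_num) (by have := Finset.mem_range.1 ha; omega)
  gcongr

theorem lintegral_closedBall_eq (F : Plane → ℝ≥0∞) (x : Plane) :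
    ∫⁻ y in Metric.closedBall x 4, F y =
      ∫⁻ y, {z : Plane × Plane | ‖z.2 - z.1‖ ≤ 4}.indicator (fun z ↦ F z.2) (x, y) := by
  rw [← lintegral_indicator Metric.isClosed_closedBall.measurableSet]
  refine lintegral_congr fun y ↦ ?_
  simp only [Set.indicator, mem_closedBall_iff_norm, Set.mem_ofPred_eq]

theorem measurable_indicator_near {F : Plane → ℝ≥0∞} (hF : Measurable F) :
    Measurable ({z : Plane × Plane | ‖z.2 - z.1‖ ≤ 4}.indicator fun z ↦ F z.2) :=
  (hF.comp measurable_snd).indicator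
    (isClosed_le (by fun_prop) continuous_const).measurableSet

theorem lintegral_lintegral_closedBall {F : Plane → ℝ≥0∞} (hF : Measurable F) :
    ∫⁻ x, ∫⁻ y in Metric.closedBall x 4, F y =
      volume (Metric.closedBall (0 : Plane) 4) * ∫⁻ y, F y := by
  simp_rw [lintegral_closedBall_eq]
  rw [lintegral_lintegral_swap (f := fun x y ↦ {z : Plane × Plane | ‖z.2 - z.1‖ ≤ 4}.indicator
    (fun z ↦ F z.2) (x, y)) (measurable_indicator_near hF).aemeasurable, ← lintegral_const_mul _ hF]
  refine lintegral_congr fun y ↦ ?_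
  have : ∀ x : Plane, {z : Plane × Plane | ‖z.2 - z.1‖ ≤ 4}.indicator (fun z ↦ F z.2) (x, y) =
      (Metric.closedBall y 4).indicator (fun _ ↦ F y) x := by
    intro x
    simp only [Set.indicator, mem_closedBall_iff_norm, Set.mem_ofPred_eq, norm_sub_rev]
  simp_rw [this]
  rw [lintegral_indicator_const Metric.isClosed_closedBall.measurableSet, mul_comm,
    Measure.addHaar_closedBall_center]

section
variable {q : ℝ≥0∞} {F : Type*} [NormedAddCommGroup F] {g : Plane → F}

theorem measurable_eLpNorm_closedBall (hq0 : q ≠ 0) (hq : q ≠ ⊤) (hg : Continuous g) :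
    Measurable fun x ↦ eLpNorm g q (volume.restrict (Metric.closedBall x 4)) := by
  simp_rw [eLpNorm_eq_lintegral_rpow_enorm_toReal hq0 hq, lintegral_closedBall_eq]
  exact ((measurable_indicator_near (hg.enorm.measurable.pow_const _)).lintegral_prod_right').pow_const _

theorem eLpNorm_eLpNorm_closedBall_le (hq0 : q ≠ 0) (hq : q ≠ ⊤) (hg : Continuous g) :
    eLpNorm (fun x ↦ eLpNorm g q (volume.restrict (Metric.closedBall x 4))) q volume ≤
      volume (Metric.closedBall (0 : Plane) 4) ^ (1 / q.toReal) * eLpNorm g q volume := by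
  have hq1 := ENNReal.toReal_pos hq0 hq
  rw [eLpNorm_ennreal_eq hq0 hq]
  simp_rw [eLpNorm_eq_lintegral_rpow_enorm_toReal hq0 hq, ← ENNReal.rpow_mul,
    one_div_mul_cancel hq1.ne', ENNReal.rpow_one]
  rw [lintegral_lintegral_closedBall (hg.enorm.measurable.pow_const _),
    ENNReal.mul_rpow_of_nonneg _ _ (by positivity)]

end

/-- A measurable majorant of `localNorm` whose `L^q` norm is controlled by the Sobolev norm. -/
theorem exists_localNorm_majorant {q : ℝ≥0∞} (hq : 1 < q) (K : ℕ) : ∃ C : ℝ≥0∞, C ≠ ⊤ ∧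
    ∀ h : Plane → ℝ, BddSmooth h → ∃ a : Plane → ℝ≥0∞, Measurable a ∧
      (∀ x, localNorm q K h x ≤ a x) ∧ eLpNorm a q volume ≤ C * sobNorm K q h := by
  rcases eq_or_ne q ⊤ with rfl | hq'
  · refine ⟨1, by simp, fun h hh ↦ ⟨fun _ ↦ sobNorm K ⊤ h, measurable_const, fun x ↦ ?_, ?_⟩⟩
    · exact Finset.sum_le_sum fun j _ ↦ eLpNorm_mono_measure _ Measure.restrict_le_self
    · rw [one_mul, eLpNorm_exponent_top]
      exact eLpNormEssSup_le_of_ae_enorm_bound (Filter.Eventually.of_forall fun _ ↦ le_rfl)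
  · have hq0 : q ≠ 0 := (zero_lt_one.trans hq).ne'
    have hcont : ∀ h : Plane → ℝ, BddSmooth h → ∀ j : ℕ, Continuous (iteratedFDeriv ℝ j h) :=
      fun h hh j ↦ (hh.contDiff j).continuous_iteratedFDeriv (m := j) le_rfl
    refine ⟨volume (Metric.closedBall (0 : Plane) 4) ^ (1 / q.toReal),
      ENNReal.rpow_ne_top_of_nonneg (by positivity) measure_closedBall_lt_top.ne, fun h hh ↦
      ⟨localNorm q K h, ?_, fun _ ↦ le_rfl, ?_⟩⟩
    · exact Finset.measurable_fun_sum _ fun j _ ↦ measurable_eLpNorm_closedBall hq0 hq' (hcont h hh j)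
    · refine (eLpNorm_ennreal_sum_le hq.le (Finset.range (K + 1))
        fun j ↦ measurable_eLpNorm_closedBall hq0 hq' (hcont h hh j)).trans ?_
      rw [sobNorm, Finset.mul_sum]
      exact Finset.sum_le_sum fun j _ ↦ eLpNorm_eLpNorm_closedBall_le hq0 hq' (hcont h hh j)

theorem BddSmooth.measurable_derMajorant {f : Plane → ℝ} (hf : BddSmooth f) (α : ℝ) (k : ℕ) :
    Measurable (derMajorant α k f) :=
  Finset.measurable_fun_sum _ fun _ _ ↦ Finset.measurable_fun_sum _ fun m _ ↦
    measurable_majorant ((hf.bddSmooth_wordDeriv m).contDiff 0).continuous.measurable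

theorem SchwartzMap.bddSmooth (f : SchwartzMap Plane ℝ) : BddSmooth f where
  contDiff n := f.smooth n
  bdd n := by
    obtain ⟨C, _, hC⟩ := f.decay 0 n
    exact ⟨C, fun x ↦ by simpa using hC x⟩

theorem exists_isCutoff {χ : Plane → ℝ} (hχsm : ContDiff ℝ (⊤ : ℕ∞) χ)
    (hχr : ∀ x, χ x ∈ Set.Icc (0 : ℝ) 1) (hχ1 : ∀ x : Plane, ‖x‖ ≤ 1 → χ x = 1)
    (hχs : Function.support χ ⊆ Metric.ball (0 : Plane) 2) : ∃ L, IsCutoff χ L := by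
  have h0 : ∀ z : Plane, 2 ≤ ‖z‖ → χ z = 0 := fun z hz ↦ by
    by_contra h
    have := hχs h
    rw [mem_ball_zero_iff] at this
    linarith
  have hc : HasCompactSupport χ :=
    hasCompactSupport_of_eq_zero (x := 0) (R := 2) fun z hz ↦ h0 z (by simpa using hz.le)
  obtain ⟨L, hL⟩ := (hc.fderiv (𝕜 := ℝ)).exists_bound_of_continuous
    (hχsm.continuous_fderiv (by simp))
  exact ⟨L, hχsm.differentiable (by simp), hχr, hχ1, h0, hL⟩

theorem integral_eq_diffOp (χ ρ h : Plane → ℝ) (n : ℕ) (z : Plane) :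
    ∫ y : Plane, ρ y * (h z - h y) ^ (2 * n) * (χ (z - y) * ‖z - y‖ ^ (-(2 * (n : ℤ)) - 1)) =
      diffOp χ ρ (fun _ : Fin (2 * n) ↦ h) z := by
  rw [diffOp, ← integral_sub_left_eq_self _ volume z]
  refine integral_congr_ae (Filter.Eventually.of_forall fun y ↦ ?_)
  have e : -(2 * (n : ℤ)) - 1 = -((2 * n + 1 : ℕ) : ℤ) := by push_cast; ring
  simp only [diffKernel, Finset.prod_const, Finset.card_univ, Fintype.card_fin, sub_sub_cancel, e,
    zpow_neg, zpow_natCast]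
  ring

theorem Continuous.enorm_le_eLpNorm_top {F : Type*} [NormedAddCommGroup F] {f : Plane → F}
    (hf : Continuous f) (x : Plane) : ‖f x‖ₑ ≤ eLpNorm f ⊤ volume := by
  have h1 : IsClosed {x | ‖f x‖ₑ ≤ eLpNorm f ⊤ volume} := isClosed_le hf.enorm continuous_const
  have h2 : Dense {x | ‖f x‖ₑ ≤ eLpNorm f ⊤ volume} :=
    Measure.dense_of_ae (μ := volume) (by
      simpa only [eLpNorm_exponent_top] using enorm_ae_le_eLpNormEssSup f volume)
  have := h2.closure_eq
  rw [h1.closure_eq] at this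
  exact Set.eq_univ_iff_forall.1 this x

namespace BddSmooth
variable {h : Plane → ℝ}

theorem sobNorm_top_ne_top (hh : BddSmooth h) (m : ℕ) : sobNorm m ⊤ h ≠ ⊤ := by
  refine ENNReal.sum_ne_top.2 fun j _ ↦ ?_
  obtain ⟨C, hC⟩ := hh.bdd j
  exact (memLp_top_of_bound
    ((hh.contDiff j).continuous_iteratedFDeriv (m := j) le_rfl).aestronglyMeasurable C
    (Filter.Eventually.of_forall hC)).eLpNorm_ne_top

theorem norm_iteratedFDeriv_le_sobNorm (hh : BddSmooth h) {j m : ℕ} (hj : j ≤ m) (z : Plane) :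
    ‖iteratedFDeriv ℝ j h z‖ ≤ (sobNorm m ⊤ h).toReal := by
  rw [← toReal_enorm]
  refine ENNReal.toReal_mono (hh.sobNorm_top_ne_top m) ?_
  refine (Continuous.enorm_le_eLpNorm_top
    ((hh.contDiff j).continuous_iteratedFDeriv (m := j) le_rfl) z).trans ?_
  exact Finset.single_le_sum (f := fun j ↦ eLpNorm (iteratedFDeriv ℝ j h) ⊤ volume)
    (fun _ _ ↦ zero_le) (Finset.mem_range.2 (Nat.lt_succ_of_le hj))

end BddSmooth

theorem exists_pow_bound (k : ℕ) {M C : ℝ} (hM : 0 ≤ M) (hC : 0 ≤ C) : ∃ B : ℝ, 0 < B ∧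
    ∀ n : ℕ, 1 ≤ n → M * (((2 * n : ℕ) : ℝ) + 1) ^ (k + 2) * C ^ (2 * n - 1) ≤ B ^ n := by
  refine ⟨(1 + M) * 3 ^ (k + 2) * (1 + C) ^ 2, by positivity, fun n hn ↦ ?_⟩
  have h1 : M ≤ (1 + M) ^ n :=
    (by linarith : M ≤ 1 + M).trans (le_self_pow₀ (by linarith) (by omega))
  have h2 : ((2 * n : ℕ) : ℝ) + 1 ≤ 3 ^ n := by
    have := one_add_mul_le_pow (a := (2:ℝ)) (by norm_num) n
    push_cast
    norm_num at this
    linarith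
  have h3 : C ^ (2 * n - 1) ≤ (1 + C) ^ (2 * n) :=
    (pow_le_pow_left₀ hC (by linarith) _).trans (pow_le_pow_right₀ (by linarith) (by omega))
  calc _ ≤ (1 + M) ^ n * (3 ^ n) ^ (k + 2) * (1 + C) ^ (2 * n) := by gcongr
    _ = _ := by rw [mul_pow, mul_pow, ← pow_mul, ← pow_mul, ← pow_mul, mul_comm n (k + 2)]

theorem sobNorm_fderiv_eq {F : Plane → ℝ} (m : ℕ) (s : ℝ≥0∞) :
    sobNorm m s (fun x ↦ fderiv ℝ F x) =
      ∑ j ∈ Finset.range (m + 1), eLpNorm (iteratedFDeriv ℝ (j + 1) F) s volume :=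
  Finset.sum_congr rfl fun _ _ ↦ eLpNorm_congr_norm_ae
    (Filter.Eventually.of_forall fun _ ↦ norm_iteratedFDeriv_fderiv)

/-- Sobolev bounds, with constant exponential in `n`, for the short-range part
`K_n ρ(x) = ∇ₓ ∫ ρ(y) (h(x) − h(y))^{2n} Γ_n(x−y) dy`, `Γ_n(x) = χ(x)‖x‖^{−(2n+1)}`,
of the `n`-th Taylor term of the single layer potential of the Dirichlet-to-Neumann
operator (Lemma `Kn<1-Wkp` of the paper). -/
theorem stmt9 (χ : EuclideanSpace ℝ (Fin 2) → ℝ) (hχsm : ContDiff ℝ (⊤ : ℕ∞) χ)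
    (hχr : ∀ x, χ x ∈ Set.Icc (0 : ℝ) 1)
    (hχ1 : ∀ x : EuclideanSpace ℝ (Fin 2), ‖x‖ ≤ 1 → χ x = 1)
    (hχs : Function.support χ ⊆ Metric.ball (0 : EuclideanSpace ℝ (Fin 2)) 2)
    (k : ℕ) (p q r : ℝ≥0∞) (hp : 1 < p) (hp' : p ≠ ⊤) (hq : 1 < q) (hr : r⁻¹ = p⁻¹ + q⁻¹) :
    ∃ B : ℝ, 0 < B ∧
      ∀ n : ℕ, 1 ≤ n →
      ∀ h ρ : SchwartzMap (EuclideanSpace ℝ (Fin 2)) ℝ,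
        sobNorm k r (fun x => fderiv ℝ
            (fun z => ∫ y : EuclideanSpace ℝ (Fin 2),
              ρ y * (h z - h y) ^ (2 * n) * (χ (z - y) * ‖z - y‖ ^ (-(2 * (n : ℤ)) - 1))) x) ≤
          ENNReal.ofReal (B ^ n) * sobNorm 2 ⊤ (⇑h) ^ (2 * n - 1) *
            sobNorm (k + 3) q (⇑h) * sobNorm k p (⇑ρ) := by
  obtain ⟨L, hχ⟩ := exists_isCutoff hχsm hχr hχ1 hχs
  obtain ⟨C₁, C₂, hC₁, hC₂, hpt⟩ := exists_enorm_iteratedFDeriv_diffOp_le hχ hq k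
  obtain ⟨Ca, hCa, ha⟩ := exists_localNorm_majorant hq (k + 3)
  obtain ⟨Cb, hCb, hb⟩ := exists_eLpNorm_derMajorant_le hp hp' (holderExp_pos hq) k
  have hp0 : p ≠ 0 := (zero_lt_one.trans hp).ne'
  have hM0 : 0 ≤ (k + 1) * (Ca.toReal * Cb.toReal) * C₁ := by positivity
  obtain ⟨B, hB, hBn⟩ := exists_pow_bound k hM0 hC₂
  refine ⟨B, hB, fun n hn h ρ ↦ ?_⟩
  simp_rw [integral_eq_diffOp]
  rw [sobNorm_fderiv_eq]
  have hh := h.bddSmooth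
  have hρ := ρ.bddSmooth
  obtain ⟨a, ham, hax, hanorm⟩ := ha h hh
  have hne : Nonempty (Fin (2 * n)) := ⟨⟨0, by omega⟩⟩
  set E := (sobNorm 2 ⊤ h).toReal with hE
  have hE0 : 0 ≤ E := ENNReal.toReal_nonneg
  set c := C₁ * (((2 * n : ℕ) : ℝ) + 1) ^ (k + 2) * (C₂ * E) ^ (2 * n - 1) with hc
  have hc0 : 0 ≤ c := by positivity
  have hone : ∀ j ∈ Finset.range (k + 1),
      eLpNorm (iteratedFDeriv ℝ (j + 1) (diffOp χ ρ fun _ : Fin (2 * n) ↦ h)) r volume ≤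
        Ca * sobNorm (k + 3) q h * (ENNReal.ofReal c * (Cb * sobNorm k p ρ)) := by
    intro j hj
    refine (eLpNorm_mono_enorm (g := fun x ↦ a x * (ENNReal.ofReal c * derMajorant (holderExp q) k ρ x))
      fun x ↦ ?_).trans ((eLpNorm_ennreal_mul_le hp hp' hq hr ham
        ((hρ.measurable_derMajorant _ k).const_mul _)).trans ?_)
    · have := hpt (Fin (2 * n)) (by simp) ρ h hρ hh E
        (fun i hi z ↦ hh.norm_iteratedFDeriv_le_sobNorm hi z) j
        (Nat.lt_succ_iff.1 (Finset.mem_range.1 hj)) x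
      rw [Fintype.card_fin] at this
      refine this.trans ?_
      rw [enorm_eq_self, mul_comm (ENNReal.ofReal _), mul_assoc]
      exact mul_le_mul_left (hax x) _
    · rw [eLpNorm_ennreal_const_mul hp0 hp' _ (hρ.measurable_derMajorant _ k)]
      gcongr
      exact hb ρ hρ
  refine (Finset.sum_le_sum hone).trans ?_
  rw [Finset.sum_const, Finset.card_range, nsmul_eq_mul]
  have e1 : sobNorm 2 ⊤ (h : Plane → ℝ) = ENNReal.ofReal E :=
    (ENNReal.ofReal_toReal (hh.sobNorm_top_ne_top 2)).symm
  have e2 : ((k + 1 : ℕ) : ℝ≥0∞) * (Ca * Cb * ENNReal.ofReal c) ≤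
      ENNReal.ofReal (B ^ n) * sobNorm 2 ⊤ (h : Plane → ℝ) ^ (2 * n - 1) := by
    rw [e1, ← ENNReal.ofReal_toReal hCa, ← ENNReal.ofReal_toReal hCb,
      ← ENNReal.ofReal_natCast, ← ENNReal.ofReal_mul (by positivity), ← ENNReal.ofReal_mul (by positivity),
      ← ENNReal.ofReal_mul (by positivity), ← ENNReal.ofReal_pow hE0, ← ENNReal.ofReal_mul (by positivity)]
    refine ENNReal.ofReal_le_ofReal ?_
    calc _ = ((k + 1) * (Ca.toReal * Cb.toReal) * C₁) * (((2 * n : ℕ) : ℝ) + 1) ^ (k + 2) *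
          C₂ ^ (2 * n - 1) * E ^ (2 * n - 1) := by
          rw [hc, mul_pow]
          push_cast
          ring
      _ ≤ _ := by
          gcongr
          exact hBn n hn
  calc _ = ((k + 1 : ℕ) : ℝ≥0∞) * (Ca * Cb * ENNReal.ofReal c) * sobNorm (k + 3) q h * sobNorm k p ρ := by
        ring
    _ ≤ _ := by gcongr

end
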